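/- arXiv:2304.00120 — 2 statements merged into one kernel-verified Lean document; each statement's English description precedes it below -/
import Mathlib

section
/- Let a ∈ ℤ⁴ be a nonzero vector. Then there exist linearly independent vectors x₁, x₂, x₃ ∈ ℤ⁴ with ⟨a,x₁⟩ = ⟨a,x₂⟩ = ⟨a,x₃⟩ = 0 and ‖x₁‖_∞ · ‖x₂‖_∞ · ‖x₃‖_∞ ≤ (27/19) · ‖a‖_∞. -/
theorem plane_product_false {x y z : ℝ} (hx : 0 ≤ x) (hx1 : x ≤ 1) (hy : 0 ≤ y) (hy1 : y ≤ 1)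
    (hz : 0 ≤ z) (hz1 : z ≤ 1) (h₁ : 8 / 27 < x * (1 - y)) (h₂ : 8 / 27 < y * (1 - z))
    (h₃ : 8 / 27 < z * (1 - x)) : False := by
  have e₁ : x * (1 - x) ≤ 1 / 4 := by nlinarith [sq_nonneg (x - 1 / 2)]
  have e₂ : y * (1 - y) ≤ 1 / 4 := by nlinarith [sq_nonneg (y - 1 / 2)]
  have e₃ : z * (1 - z) ≤ 1 / 4 := by nlinarith [sq_nonneg (z - 1 / 2)]
  have a₁ : (8 / 27 : ℝ) * (8 / 27) * (8 / 27) <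
      x * (1 - y) * (y * (1 - z)) * (z * (1 - x)) := by
    gcongr
  have a₂ : x * (1 - x) * (y * (1 - y)) * (z * (1 - z)) ≤ 1 / 4 * (1 / 4) * (1 / 4) := by
    have : 0 ≤ x * (1 - x) := mul_nonneg hx (by linarith)
    have : 0 ≤ y * (1 - y) := mul_nonneg hy (by linarith)
    have : 0 ≤ z * (1 - z) := mul_nonneg hz (by linarith)
    gcongr
  nlinarith

/-- Lower bound for the determinant in the cyclic configuration. -/
theorem cyclic_det_lower {b₁ b₂ b₃ c₁ c₂ c₃ q₁ q₂ q₃ : ℝ} (hb₁ : b₁ ≤ 1) (hb₂ : b₂ ≤ 1)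
    (hb₃ : b₃ ≤ 1) (hc₁ : c₁ ≤ 1) (hc₂ : c₂ ≤ 1) (hc₃ : c₃ ≤ 1) (hs₁ : 1 ≤ b₁ + c₁)
    (hs₂ : 1 ≤ b₂ + c₂) (hs₃ : 1 ≤ b₃ + c₃) (ha₁ : 1 ≤ b₁ + c₁ + q₁) (ha₂ : 1 ≤ b₂ + c₂ + q₂)
    (ha₃ : 1 ≤ b₃ + c₃ + q₃) :
    1 - (1 - c₁) * (1 - c₂) * (1 - c₃) ≤
      (b₁ + c₁ + q₁) * (b₂ + c₂ + q₂) * (b₃ + c₃ + q₃) - q₁ * q₂ * q₃ - b₁ * b₂ * b₃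
        - (b₁ + c₁ + q₁) * b₃ * q₂ - (b₂ + c₂ + q₂) * b₁ * q₃ - (b₃ + c₃ + q₃) * b₂ * q₁ := by
  obtain ⟨g₁, rfl⟩ : ∃ g, c₁ = 1 - g := ⟨1 - c₁, by ring⟩
  obtain ⟨g₂, rfl⟩ : ∃ g, c₂ = 1 - g := ⟨1 - c₂, by ring⟩
  obtain ⟨g₃, rfl⟩ : ∃ g, c₃ = 1 - g := ⟨1 - c₃, by ring⟩
  obtain ⟨r₁, rfl⟩ : ∃ r, b₁ = g₁ + r := ⟨b₁ - g₁, by ring⟩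
  obtain ⟨r₂, rfl⟩ : ∃ r, b₂ = g₂ + r := ⟨b₂ - g₂, by ring⟩
  obtain ⟨r₃, rfl⟩ : ∃ r, b₃ = g₃ + r := ⟨b₃ - g₃, by ring⟩
  obtain ⟨t₁, rfl⟩ : ∃ t, q₁ = t - r₁ := ⟨q₁ + r₁, by ring⟩
  obtain ⟨t₂, rfl⟩ : ∃ t, q₂ = t - r₂ := ⟨q₂ + r₂, by ring⟩
  obtain ⟨t₃, rfl⟩ : ∃ t, q₃ = t - r₃ := ⟨q₃ + r₃, by ring⟩
  have G₁ : 0 ≤ g₁ := by linarith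
  have G₂ : 0 ≤ g₂ := by linarith
  have G₃ : 0 ≤ g₃ := by linarith
  have R₁ : 0 ≤ r₁ := by linarith
  have R₂ : 0 ≤ r₂ := by linarith
  have R₃ : 0 ≤ r₃ := by linarith
  have T₁ : 0 ≤ t₁ := by linarith
  have T₂ : 0 ≤ t₂ := by linarith
  have T₃ : 0 ≤ t₃ := by linarith
  have u₁ : 0 ≤ 1 - g₁ - r₁ := by linarith
  have u₂ : 0 ≤ 1 - g₂ - r₂ := by linarith
  have u₃ : 0 ≤ 1 - g₃ - r₃ := by linarith
  have v₁ : 0 ≤ 1 - g₁ := by linarith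
  have v₂ : 0 ≤ 1 - g₂ := by linarith
  have v₃ : 0 ≤ 1 - g₃ := by linarith
  have k₁ : 0 ≤ t₁ * (1 - g₂ - r₂ + g₃ * r₂) := by positivity
  have k₂ : 0 ≤ t₂ * (1 - g₃ - r₃ + g₁ * r₃) := by positivity
  have k₃ : 0 ≤ t₃ * (1 - g₁ - r₁ + g₂ * r₁) := by positivity
  have m₁ : 0 ≤ t₁ * t₂ * (1 - g₃) := by positivity
  have m₂ : 0 ≤ t₂ * t₃ * (1 - g₁) := by positivity
  have m₃ : 0 ≤ t₃ * t₁ * (1 - g₂) := by positivity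
  have n₁ : 0 ≤ g₁ * r₃ * (1 - g₂) := by positivity
  have n₂ : 0 ≤ g₂ * r₁ * (1 - g₃) := by positivity
  have n₃ : 0 ≤ g₃ * r₂ * (1 - g₁) := by positivity
  have o₁ : 0 ≤ r₁ * r₂ * (1 - g₃) := by positivity
  have o₂ : 0 ≤ r₂ * r₃ * (1 - g₁) := by positivity
  have o₃ : 0 ≤ r₃ * r₁ * (1 - g₂) := by positivity
  linarith

theorem mul_le_cube_mean {a b c : ℝ} (ha : 0 ≤ a) (hb : 0 ≤ b) (hc : 0 ≤ c) :
    a * b * c ≤ ((a + b + c) / 3) ^ 3 := by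
  have h₁ := mul_nonneg ha (sq_nonneg (b - c))
  have h₂ := mul_nonneg hb (sq_nonneg (c - a))
  have h₃ := mul_nonneg hc (sq_nonneg (a - b))
  have h₄ := mul_nonneg (add_nonneg (add_nonneg ha hb) hc)
    (add_nonneg (add_nonneg (sq_nonneg (a - b)) (sq_nonneg (b - c))) (sq_nonneg (c - a)))
  linarith

/-- The `3 × 3` minor with columns `p, q, r` of the matrix with rows `x, y, z`. -/
def minor (p q r : Fin 4) (x y z : Fin 4 → ℝ) : ℝ :=
  x p * (y q * z r - y r * z q) - x q * (y p * z r - y r * z p) + x r * (y p * z q - y q * z p)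

/-- The rows `x, y, z` span a lattice without nonzero points in the open unit cube, although all
its `3 × 3` minors are smaller than `19 / 27`. -/
structure IsBad (x y z : Fin 4 → ℝ) : Prop where
  adm : ∀ a b c : ℤ, (a ≠ 0 ∨ b ≠ 0 ∨ c ≠ 0) → ∃ p, 1 ≤ |a * x p + b * y p + c * z p|
  minor_lt : ∀ p q r, |minor p q r x y z| < 19 / 27

/-- Passing to another basis of the lattice. -/
theorem IsBad.of_unimodular {x y z : Fin 4 → ℝ} (h : IsBad x y z)
    (a₁ a₂ a₃ b₁ b₂ b₃ c₁ c₂ c₃ : ℤ)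
    (hdet : |a₁ * (b₂ * c₃ - b₃ * c₂) - a₂ * (b₁ * c₃ - b₃ * c₁) + a₃ * (b₁ * c₂ - b₂ * c₁)| = 1)
    {x' y' z' : Fin 4 → ℝ} (hx : ∀ p, x' p = a₁ * x p + a₂ * y p + a₃ * z p)
    (hy : ∀ p, y' p = b₁ * x p + b₂ * y p + b₃ * z p)
    (hz : ∀ p, z' p = c₁ * x p + c₂ * y p + c₃ * z p) : IsBad x' y' z' := by
  constructor
  · intro a b c habc
    obtain ⟨p, hp⟩ := h.adm (a * a₁ + b * b₁ + c * c₁) (a * a₂ + b * b₂ + c * c₂)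
      (a * a₃ + b * b₃ + c * c₃) (by
        by_contra! hcon
        obtain ⟨h₁, h₂, h₃⟩ := hcon
        set d := a₁ * (b₂ * c₃ - b₃ * c₂) - a₂ * (b₁ * c₃ - b₃ * c₁) + a₃ * (b₁ * c₂ - b₂ * c₁)
          with hd
        have d0 : d ≠ 0 := by
          intro h0
          rw [h0] at hdet
          simp at hdet
        have ea : a * d = 0 := by
          rw [hd]
          linear_combination (b₂ * c₃ - b₃ * c₂) * h₁ - (b₁ * c₃ - b₃ * c₁) * h₂
            + (b₁ * c₂ - b₂ * c₁) * h₃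
        have eb : b * d = 0 := by
          rw [hd]
          linear_combination (c₂ * a₃ - c₃ * a₂) * h₁ - (c₁ * a₃ - c₃ * a₁) * h₂
            + (c₁ * a₂ - c₂ * a₁) * h₃
        have ec : c * d = 0 := by
          rw [hd]
          linear_combination (a₂ * b₃ - a₃ * b₂) * h₁ - (a₁ * b₃ - a₃ * b₁) * h₂
            + (a₁ * b₂ - a₂ * b₁) * h₃
        simp only [mul_eq_zero, d0, or_false] at ea eb ec
        simp_all)
    refine ⟨p, hp.trans_eq ?_⟩
    rw [hx, hy, hz]
    push_cast
    congr 1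
    ring
  · intro p q r
    have e : minor p q r x' y' z' =
        ((a₁ * (b₂ * c₃ - b₃ * c₂) - a₂ * (b₁ * c₃ - b₃ * c₁) + a₃ * (b₁ * c₂ - b₂ * c₁) : ℤ) : ℝ)
          * minor p q r x y z := by
      simp only [minor, hx, hy, hz]
      push_cast
      ring
    rw [e, abs_mul, ← Int.cast_abs, hdet]
    simpa using h.minor_lt p q r

/-- Changing the signs of columns. -/
theorem IsBad.flip {x y z : Fin 4 → ℝ} (h : IsBad x y z) (s : Fin 4 → ℝ) (hs : ∀ p, |s p| = 1) :
    IsBad (fun p => s p * x p) (fun p => s p * y p) (fun p => s p * z p) := by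
  constructor
  · intro a b c habc
    obtain ⟨p, hp⟩ := h.adm a b c habc
    refine ⟨p, ?_⟩
    have : a * (s p * x p) + b * (s p * y p) + c * (s p * z p)
        = s p * (a * x p + b * y p + c * z p) := by ring
    rw [this, abs_mul, hs, one_mul]
    exact hp
  · intro p q r
    have : minor p q r (fun p => s p * x p) (fun p => s p * y p) (fun p => s p * z p)
        = s p * s q * s r * minor p q r x y z := by
      simp only [minor]
      ring
    rw [this, abs_mul, abs_mul, abs_mul, hs, hs, hs]
    simpa using h.minor_lt p q r

/-- Among the four pairs `(column, row)` the first three are arranged cyclically. -/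
theorem IsBad.cyclic_false {x y z : Fin 4 → ℝ} (h : IsBad x y z) {i j k l : Fin 4}
    (hx : 1 ≤ x i) (hy : 1 ≤ y j) (hz : 1 ≤ z k) (hl : 1 ≤ |x l + y l + z l|)
    (hxy : 1 ≤ x i + y i) (hyz : 1 ≤ y j + z j) (hzx : 1 ≤ z k + x k)
    (hzi : -1 < z i) (hxj : -1 ≤ x j) (hyk : -1 ≤ y k)
    (hi : x i + y i + z i ≤ 1) (hj : x j + y j + z j ≤ 1) (hk : x k + y k + z k ≤ 1) : False := by
  have key := @cyclic_det_lower (-z i) (-x j) (-y k) (x i + y i + z i) (x j + y j + z j)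
    (x k + y k + z k) (-y i) (-z j) (-x k) (by linarith) (by linarith) (by linarith)
    (by linarith) (by linarith) (by linarith) (by linarith) (by linarith) (by linarith)
    (by linarith) (by linarith) (by linarith)
  obtain ⟨c₁, hc₁⟩ : ∃ c, c = x i + y i + z i := ⟨_, rfl⟩
  rw [← hc₁] at key
  obtain ⟨c₂, hc₂⟩ : ∃ c, c = x j + y j + z j := ⟨_, rfl⟩
  rw [← hc₂] at key
  obtain ⟨c₃, hc₃⟩ : ∃ c, c = x k + y k + z k := ⟨_, rfl⟩
  rw [← hc₃] at key
  have p₁ : 0 < c₁ := by linarith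
  have p₂ : 0 ≤ c₂ := by linarith
  have p₃ : 0 ≤ c₃ := by linarith
  have hD : 1 - (1 - c₁) * (1 - c₂) * (1 - c₃) ≤ minor i j k x y z := by
    refine key.trans_eq ?_
    simp only [minor, hc₁, hc₂, hc₃]
    ring
  have hprod : (1 - c₁) * (1 - c₂) * (1 - c₃) ≤ (1 - (c₁ + c₂ + c₃) / 3) ^ 3 := by
    refine (mul_le_cube_mean (a := 1 - c₁) (b := 1 - c₂) (c := 1 - c₃) (by linarith) (by linarith)
      (by linarith)).trans_eq ?_
    ring
  obtain ⟨C, hC⟩ : ∃ C, C = (c₁ + c₂ + c₃) / 3 := ⟨_, rfl⟩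
  rw [← hC] at hprod
  have C0 : 0 < C := by linarith
  have hDlt := (abs_lt.1 (h.minor_lt i j k)).2
  have hC3 : C < 1 / 3 := by
    by_contra! hge
    have h1 : 1 - C ≤ 2 / 3 := by linarith
    have : C ≤ 1 := by linarith
    have : (1 - C) ^ 3 ≤ (2 / 3) ^ 3 := pow_le_pow_left₀ (by linarith) h1 3
    linarith
  have hrel : (x l + y l + z l) * minor i j k x y z = c₁ * minor l j k x y z
      + c₂ * minor i l k x y z + c₃ * minor i j l x y z := by
    simp only [minor, hc₁, hc₂, hc₃]
    ring
  have hDpos : 0 ≤ minor i j k x y z := by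
    refine le_trans ?_ hD
    have : (1 - C) ^ 3 ≤ 1 := pow_le_one₀ (by linarith) (by linarith)
    linarith
  have hDle : minor i j k x y z < (19 / 27) * (3 * C) := by
    calc minor i j k x y z ≤ |x l + y l + z l| * minor i j k x y z :=
          le_mul_of_one_le_left hDpos hl
      _ = |(x l + y l + z l) * minor i j k x y z| := by rw [abs_mul, abs_of_nonneg hDpos]
      _ = |c₁ * minor l j k x y z + c₂ * minor i l k x y z + c₃ * minor i j l x y z| := by
          rw [hrel]
      _ ≤ c₁ * |minor l j k x y z| + c₂ * |minor i l k x y z| + c₃ * |minor i j l x y z| := by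
          refine (abs_add_three _ _ _).trans_eq ?_
          rw [abs_mul, abs_mul, abs_mul, abs_of_pos p₁, abs_of_nonneg p₂, abs_of_nonneg p₃]
      _ < (19 / 27) * (3 * C) := by
          nlinarith [mul_lt_mul_of_pos_left (h.minor_lt l j k) p₁,
            mul_le_mul_of_nonneg_left (h.minor_lt i l k).le p₂,
            mul_le_mul_of_nonneg_left (h.minor_lt i j l).le p₃]
  nlinarith [mul_pos C0 C0, mul_pos C0 (sub_pos.2 hC3), mul_pos (mul_pos C0 C0) (sub_pos.2 hC3)]

theorem homogeneous_product_false {a₁ a₂ b₁ b₂ c₁ c₂ : ℝ} (ha₁ : 0 ≤ a₁) (ha₂ : 0 ≤ a₂)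
    (hb₁ : 0 ≤ b₁) (hb₂ : 0 ≤ b₂) (hc₁ : 0 ≤ c₁) (hc₂ : 0 ≤ c₂)
    (hab : 0 < (a₁ + a₂) * (b₁ + b₂)) (hc : 0 < c₁ + c₂)
    (h₁ : 8 / 27 * ((a₁ + a₂) * (b₁ + b₂)) < a₁ * b₂)
    (h₂ : 8 / 27 * ((b₁ + b₂) * (c₁ + c₂)) < b₁ * c₂)
    (h₃ : 8 / 27 * ((c₁ + c₂) * (a₁ + a₂)) < c₁ * a₂) : False := by
  have A : 0 < a₁ + a₂ := pos_of_mul_pos_left hab (add_nonneg hb₁ hb₂)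
  have B : 0 < b₁ + b₂ := pos_of_mul_pos_right hab (add_nonneg ha₁ ha₂)
  have ea : 1 - a₁ / (a₁ + a₂) = a₂ / (a₁ + a₂) := by field_simp; ring
  have eb : 1 - b₁ / (b₁ + b₂) = b₂ / (b₁ + b₂) := by field_simp; ring
  have ec : 1 - c₁ / (c₁ + c₂) = c₂ / (c₁ + c₂) := by field_simp; ring
  refine plane_product_false (x := a₁ / (a₁ + a₂)) (y := b₁ / (b₁ + b₂)) (z := c₁ / (c₁ + c₂))
    (by positivity) (by rw [div_le_one A]; linarith) (by positivity)
    (by rw [div_le_one B]; linarith) (by positivity) (by rw [div_le_one hc]; linarith) ?_ ?_ ?_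
  · rw [eb, div_mul_div_comm, lt_div_iff₀ (by positivity)]
    exact h₁
  · rw [ec, div_mul_div_comm, lt_div_iff₀ (by positivity)]
    exact h₂
  · rw [ea, div_mul_div_comm, lt_div_iff₀ (by positivity)]
    exact h₃

/-- Three lattice vectors which sum to a multiple of the lattice vector `w`: eliminating the
column `l` by means of `w` reduces the situation to the plane. -/
theorem IsBad.shear_false {e₁ e₂ w : Fin 4 → ℝ} (h : IsBad e₁ e₂ w) {e₃ : Fin 4 → ℝ} {t : ℝ}
    (hsum : ∀ p, e₁ p + e₂ p + e₃ p = t * w p) {i j k l : Fin 4} (hw : 0 < w l)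
    (hij : w l ≤ (w l * e₁ i - w i * e₁ l) * (w l * e₂ j - w j * e₂ l))
    (hjk : w l ≤ (w l * e₂ j - w j * e₂ l) * (w l * e₃ k - w k * e₃ l))
    (hki : w l ≤ (w l * e₃ k - w k * e₃ l) * (w l * e₁ i - w i * e₁ l))
    (hi₂ : w l * e₂ i - w i * e₂ l ≤ 0) (hi₃ : w l * e₃ i - w i * e₃ l ≤ 0)
    (hj₁ : w l * e₁ j - w j * e₁ l ≤ 0) (hj₃ : w l * e₃ j - w j * e₃ l ≤ 0)
    (hk₁ : w l * e₁ k - w k * e₁ l ≤ 0) (hk₂ : w l * e₂ k - w k * e₂ l ≤ 0) : False := by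
  have he₃ : ∀ p, e₃ p = t * w p - e₁ p - e₂ p := fun p => by linarith [hsum p]
  have si : w l * e₁ i - w i * e₁ l
      = -(w l * e₂ i - w i * e₂ l) + -(w l * e₃ i - w i * e₃ l) := by
    rw [he₃ i, he₃ l]; ring
  have sj : w l * e₂ j - w j * e₂ l
      = -(w l * e₃ j - w j * e₃ l) + -(w l * e₁ j - w j * e₁ l) := by
    rw [he₃ j, he₃ l]; ring
  have sk : w l * e₃ k - w k * e₃ l
      = -(w l * e₁ k - w k * e₁ l) + -(w l * e₂ k - w k * e₂ l) := by
    rw [he₃ k, he₃ l]; ring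
  have dij : w l * minor i j l e₁ e₂ w = (w l * e₁ i - w i * e₁ l) * (w l * e₂ j - w j * e₂ l)
      - (w l * e₂ i - w i * e₂ l) * (w l * e₁ j - w j * e₁ l) := by
    simp only [minor]; ring
  have djk : w l * minor j k l e₁ e₂ w = -((w l * e₂ j - w j * e₂ l) * (w l * e₃ k - w k * e₃ l)
      - (w l * e₃ j - w j * e₃ l) * (w l * e₂ k - w k * e₂ l)) * (-1) := by
    simp only [minor, he₃]; ring
  have dki : w l * minor k i l e₁ e₂ w = (w l * e₃ k - w k * e₃ l) * (w l * e₁ i - w i * e₁ l)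
      - (w l * e₁ k - w k * e₁ l) * (w l * e₃ i - w i * e₃ l) := by
    simp only [minor, he₃]; ring
  have bij := mul_lt_mul_of_pos_left (abs_lt.1 (h.minor_lt i j l)).2 hw
  have bjk := mul_lt_mul_of_pos_left (abs_lt.1 (h.minor_lt j k l)).2 hw
  have bki := mul_lt_mul_of_pos_left (abs_lt.1 (h.minor_lt k i l)).2 hw
  rw [dij] at bij
  rw [djk] at bjk
  rw [dki] at bki
  rw [si, sj] at hij bij
  rw [sj, sk] at hjk bjk
  rw [sk, si] at hki bki
  have hk0 : 0 < -(w l * e₁ k - w k * e₁ l) + -(w l * e₂ k - w k * e₂ l) := by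
    refine pos_of_mul_pos_right (hw.trans_le hjk) ?_
    linarith
  refine homogeneous_product_false (neg_nonneg.2 hi₂) (neg_nonneg.2 hi₃) (neg_nonneg.2 hj₃)
    (neg_nonneg.2 hj₁) (neg_nonneg.2 hk₁) (neg_nonneg.2 hk₂) (hw.trans_le hij) hk0 ?_ ?_ ?_
  · linarith
  · linarith
  · linarith

/-- The star-shaped configuration with centre `l` in which no row is paired with the centre in
both directions. -/
theorem IsBad.star_false {x y z : Fin 4 → ℝ} (h : IsBad x y z) {w : Fin 4 → ℝ}
    (hsum : ∀ p, x p + y p + z p + w p = 0) {i j k l : Fin 4}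
    (hx : x i = 1) (hy : y j = 1) (hz : z k = 1) (hw : w l = 1)
    (hxl : -1 ≤ x l) (hyl : -1 ≤ y l) (hzl : -1 ≤ z l)
    (hyi : -1 ≤ y i ∧ y i ≤ 0) (hzi : -1 ≤ z i ∧ z i ≤ 0) (hxj : -1 ≤ x j ∧ x j ≤ 0)
    (hzj : -1 ≤ z j ∧ z j ≤ 0) (hxk : -1 ≤ x k ∧ x k ≤ 0) (hyk : -1 ≤ y k ∧ y k ≤ 0)
    (hwi : 0 ≤ w i ∨ y l ≤ 0 ∧ z l ≤ 0) (hwj : 0 ≤ w j) (hwk : 0 ≤ w k)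
    (hi : w i * x l ≤ 0) (hj : w j * y l ≤ 0) (hk : w k * z l ≤ 0) : False := by
  have hbad : IsBad x y w := h.of_unimodular 1 0 0 0 1 0 (-1) (-1) (-1) (by norm_num)
    (fun p => by push_cast; ring) (fun p => by push_cast; ring)
    (fun p => by push_cast; linarith [hsum p])
  have one_le : ∀ {a b : ℝ}, a ≤ 0 → b ≤ 0 → 1 ≤ (1 - a) * (1 - b) := fun ha hb => by
    nlinarith [mul_nonneg_of_nonpos_of_nonpos ha hb]
  have off : ∀ {a b c q : ℝ}, 1 + a + b + c = 0 → -1 ≤ b → -1 ≤ q → 0 ≤ c → a - c * q ≤ 0 :=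
    fun h₁ h₂ h₃ h₄ => by nlinarith [mul_nonneg h₄ (neg_le_iff_add_nonneg.1 h₃)]
  have si := hsum i
  have sj := hsum j
  have sk := hsum k
  have offi : ∀ {a b q : ℝ}, 1 + a + b + w i = 0 → -1 ≤ b → -1 ≤ q → a ≤ 0 →
      (0 ≤ w i ∨ q ≤ 0) → a - w i * q ≤ 0 := fun h₁ h₂ h₃ h₄ h₅ => by
    rcases le_total 0 (w i) with h0 | h0
    · exact off h₁ h₂ h₃ h0
    · rcases h₅ with h₅ | h₅
      · exact off h₁ h₂ h₃ h₅
      · nlinarith [mul_nonneg_of_nonpos_of_nonpos h0 h₅]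
  rw [hx] at si
  rw [hy] at sj
  rw [hz] at sk
  refine hbad.shear_false (e₃ := z) (t := -1) (fun p => by linarith [hsum p])
    (i := i) (j := j) (k := k) (l := l) (by rw [hw]; exact one_pos) ?_ ?_ ?_ ?_ ?_ ?_ ?_ ?_ ?_
  all_goals simp only [hw, hx, hy, hz, one_mul]
  · exact one_le hi hj
  · exact one_le hj hk
  · exact one_le hk hi
  · exact offi si hzi.1 hyl hyi.2 (hwi.imp id And.left)
  · exact offi (by linarith) hyi.1 hzl hzi.2 (hwi.imp id And.right)
  · exact off (by linarith) hzj.1 hxl hwj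
  · exact off (by linarith) hxj.1 hzl hwj
  · exact off (by linarith) hyk.1 hxl hwk
  · exact off (by linarith) hxk.1 hyl hwk

theorem IsBad.dominant_false {v₁ v₂ v₄ : Fin 4 → ℝ} (h : IsBad v₁ v₂ v₄) {i j k l : Fin 4}
    {a c x y α β τ₂ τ₃ : ℝ} (ha : 0 ≤ a) (hc : 0 ≤ c) (hac : a + c ≤ 1) (hα : 0 ≤ α) (hβ : 0 ≤ β)
    (hαβ : α + β ≤ 1) (hx : 0 ≤ x) (hx1 : x ≤ 1) (hy : 0 ≤ y) (hy1 : y ≤ 1) (hτ₂ : x ≤ τ₂)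
    (hτ₃ : 0 ≤ τ₃) (hi : v₁ i = 1 ∧ v₂ i = -a ∧ v₄ i = -c)
    (hj : v₁ j = x - 1 ∧ v₂ j = 1 + τ₂ ∧ v₄ j = -τ₂)
    (hk : v₁ k = y - 1 ∧ v₂ k = -y ∧ v₄ k = -τ₃)
    (hl : v₁ l = -α ∧ v₂ l = -β ∧ v₄ l = 1) : False := by
  obtain ⟨T, rfl⟩ : ∃ T, τ₂ = x + T := ⟨τ₂ - x, by ring⟩
  obtain ⟨b, hb⟩ : ∃ b, b = 1 - a - c := ⟨_, rfl⟩
  obtain ⟨γ, hγ⟩ : ∃ γ, γ = 1 - α - β := ⟨_, rfl⟩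
  have hT : 0 ≤ T := by linarith
  have hb0 : 0 ≤ b := by linarith
  have hγ0 : 0 ≤ γ := by linarith
  have x1 : 0 ≤ 1 - x := by linarith
  have y1 : 0 ≤ 1 - y := by linarith
  obtain ⟨E, hE⟩ : ∃ E, E = (1 - y) * (b + c * γ) + c * α := ⟨_, rfl⟩
  have d₁ := (abs_lt.1 (h.minor_lt j k l)).2
  have e₁ : minor j k l v₁ v₂ v₄ = 1 - x * (y - α - γ * (1 - y)) + T * (α + γ * (1 - y))
      + τ₃ * ((1 + x + T) * α + β * (1 - x)) := by
    simp only [minor, hj, hk, hl, hγ]; ring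
  have d₂ := (abs_lt.1 (h.minor_lt i k l)).1
  have e₂ : minor i k l v₁ v₂ v₄ = -(1 - E + τ₃ * (α * a + β)) := by
    simp only [minor, hi, hk, hl, hE, hγ, hb]; ring
  have d₃ := (abs_lt.1 (h.minor_lt i j l)).2
  have e₃ : minor i j l v₁ v₂ v₄ = 1 - ((1 - x) * (a + β * c) + α * (c - x * b) - γ * x)
      + T * (α * b + γ) := by
    simp only [minor, hi, hj, hl, hγ, hb]; ring
  have d₄ := (abs_lt.1 (h.minor_lt i j k)).1
  have e₄ : minor i j k v₁ v₂ v₄ = -(1 - (a + b - x + c * x * y + b * x * (1 - y))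
      + T * (1 - b * (1 - y)) + τ₃ * (1 + x + T - a * (1 - x))) := by
    simp only [minor, hi, hj, hk, hb]; ring
  have by1 : 0 ≤ 1 - b * (1 - y) := by
    linarith [mul_le_one₀ (by linarith : b ≤ 1) y1 (by linarith)]
  have ax1 : 0 ≤ 1 + x + T - a * (1 - x) := by
    linarith [mul_le_one₀ (by linarith : a ≤ 1) x1 (by linarith)]
  rw [e₁] at d₁
  rw [e₂] at d₂
  rw [e₃] at d₃
  rw [e₄] at d₄
  have f₁ : 8 / 27 < x * (y - α) := by
    have : 0 ≤ x * (γ * (1 - y)) := by positivity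
    have : 0 ≤ T * (α + γ * (1 - y)) := by positivity
    have : 0 ≤ τ₃ * ((1 + x + T) * α + β * (1 - x)) := by positivity
    linarith
  have f₂ : 8 / 27 < E := by
    have : 0 ≤ τ₃ * (α * a + β) := by positivity
    linarith
  have f₃ : 8 / 27 < (1 - x) * (a + β * c) + α * (c - x * b) - γ * x := by
    have : 0 ≤ T * (α * b + γ) := by positivity
    linarith
  have f₄ : 8 / 27 < a + b - x + c * x * y + b * x * (1 - y) := by
    have : 0 ≤ T * (1 - b * (1 - y)) := by positivity
    have : 0 ≤ τ₃ * (1 + x + T - a * (1 - x)) := by positivity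
    linarith
  obtain ⟨u, hu⟩ : ∃ u, u = 1 - y + α := ⟨_, rfl⟩
  have hEu : E ≤ u := by
    rw [hE, hu]
    have h₁ : c * γ ≤ c := mul_le_of_le_one_right hc (by linarith)
    have h₂ : c * α ≤ α := mul_le_of_le_one_left hα (by linarith)
    have h₃ := mul_le_of_le_one_right y1 (by linarith : b + c * γ ≤ 1)
    linarith
  have hu0 : 0 < u := by linarith
  have hya : 0 < y - α := by
    by_contra! hcon
    linarith [mul_nonpos_of_nonneg_of_nonpos hx hcon]
  have f₅ : 8 / 27 * u < (1 - x) * (u - E) := by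
    have g₃ : 0 ≤ x * (1 - y) * γ := by positivity
    have key : (1 - y) * ((1 - x) * (a + β * c) + α * (c - x * b) - γ * x)
        + α * (a + b - x + c * x * y + b * x * (1 - y))
        = (1 - x) * (u - E) - x * (1 - y) * γ := by
      rw [hE, hu, hb, hγ]; ring
    have g₄ : 8 / 27 * u < (1 - y) * ((1 - x) * (a + β * c) + α * (c - x * b) - γ * x)
        + α * (a + b - x + c * x * y + b * x * (1 - y)) := by
      rw [hu]
      rcases y1.eq_or_lt with h0 | h0
      · have hα' : 0 < α := by linarith
        have g₂ := mul_lt_mul_of_pos_left f₄ hα'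
        rw [← h0] at g₂ ⊢
        linarith
      · have g₁ := mul_lt_mul_of_pos_left f₃ h0
        have g₂ := mul_le_mul_of_nonneg_left f₄.le hα
        linarith
    linarith
  have hdiv : u * (1 - E / u) = u - E := by field_simp
  refine plane_product_false (x := x) (y := u) (z := 1 - E / u) hx hx1 hu0.le (by linarith)
    (sub_nonneg.2 ((div_le_one hu0).2 hEu)) ?_ ?_ ?_ ?_
  · have : 0 ≤ E / u := by positivity
    linarith
  · rw [hu]; linarith
  · have : u * (1 - (1 - E / u)) = E := by field_simp; ring
    rw [this]; exact f₂
  · rw [← mul_lt_mul_iff_right₀ hu0, ← mul_assoc, hdiv]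
    linarith

/-- A bad lattice with a superbase `w` (four generating vectors which sum to zero), whose vectors
attain their norm `1` in different columns. -/
structure IsSuperbase (w : Fin 4 → Fin 4 → ℝ) : Prop where
  bad : IsBad (w 0) (w 1) (w 2)
  sum_eq : ∀ p, w 0 p + w 1 p + w 2 p + w 3 p = 0
  diag : ∀ p, w p p = 1
  abs_lt : ∀ i p, i ≠ p → |w i p| < 1

namespace IsSuperbase

variable {w : Fin 4 → Fin 4 → ℝ} {i j k l : Fin 4}

theorem isBad (h : IsSuperbase w) (hd : [i, j, k, l].Nodup) : IsBad (w i) (w j) (w k) := by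
  let C : Fin 4 → Fin 3 → ℤ := ![![1, 0, 0], ![0, 1, 0], ![0, 0, 1], ![-1, -1, -1]]
  have hC : ∀ m p, w m p = C m 0 * w 0 p + C m 1 * w 1 p + C m 2 * w 2 p := by
    intro m p
    have := h.sum_eq p
    fin_cases m <;> simp [C]
    linarith
  refine h.bad.of_unimodular (C i 0) (C i 1) (C i 2) (C j 0) (C j 1) (C j 2) (C k 0) (C k 1)
    (C k 2) ?_ (hC i) (hC j) (hC k)
  clear hC
  revert i j k l
  decide

theorem cover (hd : [i, j, k, l].Nodup) (p : Fin 4) : p = i ∨ p = j ∨ p = k ∨ p = l := by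
  revert i j k l p
  decide

theorem sum_of_nodup (h : IsSuperbase w) (hd : [i, j, k, l].Nodup) (p : Fin 4) :
    w i p + w j p + w k p + w l p = 0 := by
  rw [← h.sum_eq p]
  have e : ∀ f : Fin 4 → ℝ, f i + f j + f k + f l = ∑ m, f m := by
    intro f
    have hu : (Finset.univ : Finset (Fin 4)) = {i, j, k, l} := by
      ext p
      simpa using cover hd p
    simp only [List.nodup_cons, List.mem_cons, List.not_mem_nil, or_false, not_or] at hd
    rw [hu, Finset.sum_insert (by simp; tauto), Finset.sum_insert (by simp; tauto),
      Finset.sum_insert (by simp; tauto), Finset.sum_singleton]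
    ring
  rw [e fun m => w m p, Fin.sum_univ_four]

theorem neg_one_lt (h : IsSuperbase w) (i p : Fin 4) : -1 < w i p := by
  by_cases hip : i = p
  · rw [hip, h.diag]; norm_num
  · exact (_root_.abs_lt.1 (h.abs_lt i p hip)).1

theorem lt_one (h : IsSuperbase w) (hip : i ≠ j) : w i j < 1 :=
  (_root_.abs_lt.1 (h.abs_lt i j hip)).2

/-- In each column only one off-diagonal entry is nonnegative. -/
theorem neg_of_nonneg (h : IsSuperbase w) (hd : [i, j, k, l].Nodup) (hj : 0 ≤ w j i) :
    w k i < 0 ∧ w l i < 0 := by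
  have := h.sum_of_nodup hd i
  have h₁ := h.neg_one_lt k i
  have h₂ := h.neg_one_lt l i
  rw [h.diag] at this
  constructor <;> linarith

theorem cyclic_false (h : IsSuperbase w) (hd : [i, j, k, l].Nodup) (hi : 0 ≤ w j i)
    (hj : 0 ≤ w k j) (hk : 0 ≤ w i k) : False := by
  have s := h.sum_of_nodup hd
  have hc : ∀ p, w i p + w j p + w k p ≤ 1 := fun p => by
    linarith [s p, h.neg_one_lt l p]
  have hb := h.isBad hd
  have hl : w i l + w j l + w k l = -1 := by linarith [s l, h.diag l]
  refine hb.cyclic_false (i := i) (j := j) (k := k) (l := l) (h.diag i).ge (h.diag j).ge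
    (h.diag k).ge (by rw [hl]; norm_num) ?_ ?_ ?_ (h.neg_one_lt _ _) (h.neg_one_lt _ _).le
    (h.neg_one_lt _ _).le (hc i) (hc j) (hc k)
  · rw [h.diag]; linarith
  · rw [h.diag]; linarith
  · rw [h.diag]; linarith

theorem dominant_false (h : IsSuperbase w) (hd : [i, j, k, l].Nodup) (hi : 0 ≤ w l i)
    (hk : 0 ≤ w l k) (hl : 0 ≤ w i l) (hlj : 1 ≤ w l j - w i j) : False := by
  have s := h.sum_of_nodup hd
  have n := h.neg_one_lt
  have si := s i
  have sj := s j
  have sk := s k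
  have sl := s l
  rw [h.diag] at si sj sk sl
  have e : i ≠ j ∧ i ≠ k ∧ i ≠ l ∧ j ≠ k ∧ j ≠ l ∧ k ≠ l := by
    revert hd; clear * -; revert i j k l; decide
  obtain ⟨e₁, e₂, e₃, e₄, e₅, e₆⟩ := e
  have hd' : [i, k, l, j].Nodup := by
    revert hd; clear * -; revert i j k l; decide
  have hb := h.isBad hd'
  have hb' := (hb.of_unimodular (-1) 0 0 1 1 0 0 0 1 (by norm_num)
    (x' := fun p => -w i p) (y' := fun p => w k p + w i p) (z' := w l)
    (fun p => by push_cast; ring) (fun p => by push_cast; ring)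
    (fun p => by push_cast; ring)).flip (fun p => if p = l then 1 else -1)
    (fun p => by split_ifs <;> norm_num)
  have nij : w i j < 0 := by linarith [n i j, n k j]
  have ni : w j i < 0 := by linarith [n k i]
  have nl : w k l < 0 := by linarith [n j l]
  have nk : w i k < 0 := by linarith [n j k]
  refine hb'.dominant_false (i := i) (j := j) (k := k) (l := l) (a := 1 + w k i) (c := w l i)
    (x := 1 + w i j) (y := 1 + w i k) (α := w i l) (β := 1 + w j l) (τ₂ := w l j) (τ₃ := w l k)
    ?_ hi ?_ hl ?_ ?_ ?_ ?_ ?_ ?_ ?_ hk ?_ ?_ ?_ ?_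
  · linarith [n k i]
  · linarith [n j i]
  · linarith [n j l]
  · linarith [n k l]
  · linarith [n i j]
  · linarith
  · linarith [n i k]
  · linarith
  · linarith
  · simp only [e₃, if_false, h.diag]
    exact ⟨by ring, by ring, by ring⟩
  · simp only [e₅, if_false]
    exact ⟨by ring, by linarith, by ring⟩
  · simp only [e₆, if_false, h.diag]
    exact ⟨by ring, by ring, by ring⟩
  · simp only [if_true, h.diag]
    exact ⟨by ring, by linarith, by ring⟩

theorem mutual_false (h : IsSuperbase w) (hd : [i, j, k, l].Nodup) (hi : 0 < w l i)
    (hj : 0 ≤ w l j) (hk : 0 ≤ w l k) (hl : 0 < w i l) : False := by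
  have hd' : [i, l, j, k].Nodup := by
    revert hd; clear * -; revert i j k l; decide
  have hd₂ : [i, k, j, l].Nodup := by
    revert hd; clear * -; revert i j k l; decide
  have hd₃ : [j, l, i, k].Nodup := by
    revert hd; clear * -; revert i j k l; decide
  have hd₄ : [k, l, i, j].Nodup := by
    revert hd; clear * -; revert i j k l; decide
  have e : i ≠ j ∧ i ≠ k ∧ i ≠ l ∧ j ≠ k ∧ j ≠ l ∧ k ≠ l := by
    revert hd; clear * -; revert i j k l; decide
  obtain ⟨e₁, e₂, e₃, e₄, e₅, e₆⟩ := e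
  obtain ⟨p, hp⟩ := (h.isBad hd').adm (-1) 1 0 (by norm_num)
  push_cast at hp
  have hj' := h.neg_of_nonneg hd₃ hj
  have hk' := h.neg_of_nonneg hd₄ hk
  rcases cover hd p with rfl | rfl | rfl | rfl
  · rw [h.diag] at hp
    have := h.lt_one e₃.symm
    rw [abs_of_neg (by linarith)] at hp
    linarith
  · rw [abs_of_nonneg (by linarith)] at hp
    exact h.dominant_false hd hi.le hk hl.le (by linarith)
  · rw [abs_of_nonneg (by linarith)] at hp
    exact h.dominant_false hd₂ hi.le hj hl.le (by linarith)
  · rw [h.diag] at hp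
    have := h.lt_one e₃
    rw [abs_of_pos (by linarith)] at hp
    linarith

theorem star_false (h : IsSuperbase w) (hd : [i, j, k, l].Nodup) (hi : 0 ≤ w l i)
    (hj : 0 ≤ w l j) (hk : 0 ≤ w l k) : False := by
  have hd₁ : [i, l, j, k].Nodup := by
    revert hd; clear * -; revert i j k l; decide
  have hd₂ : [j, l, i, k].Nodup := by
    revert hd; clear * -; revert i j k l; decide
  have hd₃ : [k, l, i, j].Nodup := by
    revert hd; clear * -; revert i j k l; decide
  have hd₄ : [j, i, k, l].Nodup := by
    revert hd; clear * -; revert i j k l; decide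
  have hd₅ : [k, j, i, l].Nodup := by
    revert hd; clear * -; revert i j k l; decide
  by_cases h₁ : 0 < w l i ∧ 0 < w i l
  · exact h.mutual_false hd h₁.1 hj hk h₁.2
  by_cases h₂ : 0 < w l j ∧ 0 < w j l
  · exact h.mutual_false hd₄ h₂.1 hi hk h₂.2
  by_cases h₃ : 0 < w l k ∧ 0 < w k l
  · exact h.mutual_false hd₅ h₃.1 hj hi h₃.2
  have aux : ∀ {a b : ℝ}, 0 ≤ a → ¬ (0 < a ∧ 0 < b) → a * b ≤ 0 := fun {a b} h₁ h₂ => by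
    rcases h₁.eq_or_lt with rfl | h₁
    · simp
    · exact mul_nonpos_of_nonneg_of_nonpos h₁.le (not_lt.1 fun hb => h₂ ⟨h₁, hb⟩)
  have n := h.neg_one_lt
  have ni := h.neg_of_nonneg hd₁ hi
  have nj := h.neg_of_nonneg hd₂ hj
  have nk := h.neg_of_nonneg hd₃ hk
  exact (h.isBad hd).star_false (h.sum_of_nodup hd) (h.diag i) (h.diag j) (h.diag k) (h.diag l)
    (n _ _).le (n _ _).le (n _ _).le ⟨(n _ _).le, ni.1.le⟩ ⟨(n _ _).le, ni.2.le⟩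
    ⟨(n _ _).le, nj.1.le⟩ ⟨(n _ _).le, nj.2.le⟩ ⟨(n _ _).le, nk.1.le⟩ ⟨(n _ _).le, nk.2.le⟩
    (Or.inl hi) hj hk (aux hi h₁) (aux hj h₂) (aux hk h₃)

theorem reversed_star_false (h : IsSuperbase w) (hd : [i, j, k, l].Nodup) (hi : 0 ≤ w i l)
    (hj : 0 ≤ w l j) (hk : 0 ≤ w l k) : False := by
  rcases le_or_gt 0 (w l i) with h₀ | h₀
  · exact h.star_false hd h₀ hj hk
  have hd₁ : [l, i, j, k].Nodup := by
    revert hd; clear * -; revert i j k l; decide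
  have hd₂ : [j, l, i, k].Nodup := by
    revert hd; clear * -; revert i j k l; decide
  have hd₃ : [k, l, i, j].Nodup := by
    revert hd; clear * -; revert i j k l; decide
  have hd₄ : [l, i, k, j].Nodup := by
    revert hd; clear * -; revert i j k l; decide
  rcases le_or_gt 0 (w j i) with h₁ | h₁
  · exact h.cyclic_false hd₁ hi h₁ hj
  rcases le_or_gt 0 (w k i) with h₂ | h₂
  · exact h.cyclic_false hd₄ hi h₂ hk
  have n := h.neg_one_lt
  have nl := h.neg_of_nonneg hd₁ hi
  have nj := h.neg_of_nonneg hd₂ hj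
  have nk := h.neg_of_nonneg hd₃ hk
  exact (h.isBad hd).star_false (h.sum_of_nodup hd) (h.diag i) (h.diag j) (h.diag k) (h.diag l)
    (n _ _).le (n _ _).le (n _ _).le ⟨(n _ _).le, h₁.le⟩ ⟨(n _ _).le, h₂.le⟩
    ⟨(n _ _).le, nj.1.le⟩ ⟨(n _ _).le, nj.2.le⟩ ⟨(n _ _).le, nk.1.le⟩ ⟨(n _ _).le, nk.2.le⟩
    (Or.inr ⟨nl.1.le, nl.2.le⟩) hj hk (mul_nonpos_of_nonpos_of_nonneg h₀.le hi)
    (mul_nonpos_of_nonneg_of_nonpos hj nl.1.le) (mul_nonpos_of_nonneg_of_nonpos hk nl.2.le)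

/-- The sum of two vectors of a superbase has norm at least one. -/
theorem nonneg_of_pairing (h : IsSuperbase w) (hd : [i, j, k, l].Nodup) :
    0 ≤ w j i ∨ 0 ≤ w i j ∨ 0 ≤ w l k ∨ 0 ≤ w k l := by
  obtain ⟨p, hp⟩ := (h.isBad hd).adm 1 1 0 (by norm_num)
  push_cast at hp
  have s := h.sum_of_nodup hd p
  have n := h.neg_one_lt
  rcases cover hd p with rfl | rfl | rfl | rfl <;> rw [h.diag] at s
  · rw [h.diag, abs_of_pos (by linarith [n j p])] at hp
    left; linarith
  · rw [h.diag, abs_of_pos (by linarith [n i p])] at hp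
    right; left; linarith
  · rw [abs_of_neg (by linarith [n l p])] at hp
    right; right; left; linarith
  · rw [abs_of_neg (by linarith [n k p])] at hp
    right; right; right; linarith

theorem combinatorics (e : Fin 4 → Fin 4)
    (he₁ : e 0 = 1 ∨ e 1 = 0 ∨ e 2 = 3 ∨ e 3 = 2) (he₂ : e 0 = 2 ∨ e 2 = 0 ∨ e 1 = 3 ∨ e 3 = 1)
    (he₃ : e 0 = 3 ∨ e 3 = 0 ∨ e 1 = 2 ∨ e 2 = 1) :
    ∃ i j k l : Fin 4, [i, j, k, l].Nodup ∧ (e i = j ∧ e j = k ∧ e k = i ∨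
      (e i = l ∨ e l = i) ∧ e j = l ∧ e k = l) := by
  obtain ⟨a, ha⟩ : ∃ a, a = e 0 := ⟨_, rfl⟩
  obtain ⟨b, hb⟩ : ∃ b, b = e 1 := ⟨_, rfl⟩
  obtain ⟨c, hc⟩ : ∃ c, c = e 2 := ⟨_, rfl⟩
  obtain ⟨d, hdd⟩ : ∃ d, d = e 3 := ⟨_, rfl⟩
  have he : e = ![a, b, c, d] := by
    ext p; fin_cases p <;> simp [ha, hb, hc, hdd]
  clear ha hb hc hdd
  subst he
  revert a b c d
  decide

theorem false (h : IsSuperbase w) : False := by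
  have hex : ∀ i, ∃ j, (j ≠ i → 0 ≤ w j i) ∧ ∀ k, k ≠ i → 0 ≤ w k i → k = j := by
    intro i
    by_cases hc : ∃ j, j ≠ i ∧ 0 ≤ w j i
    · obtain ⟨j, hji, hj⟩ := hc
      refine ⟨j, fun _ => hj, fun k hki hk => ?_⟩
      by_contra hkj
      obtain ⟨l, hl⟩ : ∃ l, [i, j, k, l].Nodup := by
        revert hji hki hkj; clear * -; revert i j k; decide
      linarith [(h.neg_of_nonneg hl hj).1]
    · push Not at hc
      exact ⟨i, fun h => absurd rfl h, fun k hk h0 => absurd (hc k hk) h0.not_gt⟩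
  choose e he he' using hex
  have c : ∀ {i j k l : Fin 4}, [i, j, k, l].Nodup → e i = j ∨ e j = i ∨ e k = l ∨ e l = k := by
    intro i j k l hd
    have hne : j ≠ i ∧ l ≠ k := by
      revert hd; clear * -; revert i j k l; decide
    rcases h.nonneg_of_pairing hd with h | h | h | h
    · exact Or.inl (he' i j hne.1 h).symm
    · exact Or.inr (Or.inl (he' j i hne.1.symm h).symm)
    · exact Or.inr (Or.inr (Or.inl (he' k l hne.2 h).symm))
    · exact Or.inr (Or.inr (Or.inr (he' l k hne.2.symm h).symm))
  obtain ⟨i, j, k, l, hd, hc⟩ := combinatorics e (c (i := 0) (j := 1) (k := 2) (l := 3) (by decide))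
    (c (i := 0) (j := 2) (k := 1) (l := 3) (by decide))
    (c (i := 0) (j := 3) (k := 1) (l := 2) (by decide))
  have hne : i ≠ j ∧ i ≠ k ∧ i ≠ l ∧ j ≠ k ∧ j ≠ l ∧ k ≠ l := by
    revert hd; clear * -; revert i j k l; decide
  obtain ⟨e₁, e₂, e₃, e₄, e₅, e₆⟩ := hne
  have hw : ∀ {i j}, e i = j → j ≠ i → 0 ≤ w j i := fun {i j} h₁ h₂ => by
    subst h₁; exact he i h₂
  rcases hc with ⟨h₁, h₂, h₃⟩ | ⟨h₁ | h₁, h₂, h₃⟩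
  · exact h.cyclic_false hd (hw h₁ e₁.symm) (hw h₂ e₄.symm) (hw h₃ e₂)
  · exact h.star_false hd (hw h₁ e₃.symm) (hw h₂ e₅.symm) (hw h₃ e₆.symm)
  · exact h.reversed_star_false hd (hw h₁ e₃) (hw h₂ e₅.symm) (hw h₃ e₆.symm)

end IsSuperbase

/-- A bad lattice containing the half sum `z l` of three of its vectors, such that every two of
them together with `z l` form a basis, and the four vectors attain their norm `1` in different
columns. -/
structure IsHalfBase (z : Fin 4 → Fin 4 → ℝ) (l : Fin 4) : Prop where
  bad : ∀ i j k, [i, j, k, l].Nodup → IsBad (z i) (z j) (z l)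
  sum_eq : ∀ i j k p, [i, j, k, l].Nodup → z i p + z j p + z k p = 2 * z l p
  diag : ∀ p, z p p = 1
  abs_lt : ∀ i p, i ≠ p → |z i p| < 1

namespace IsHalfBase

variable {z : Fin 4 → Fin 4 → ℝ} {i j k l : Fin 4}

theorem nodup_swap (hd : [i, j, k, l].Nodup) :
    [j, i, k, l].Nodup ∧ [i, k, j, l].Nodup ∧ i ≠ j ∧ i ≠ k ∧ i ≠ l ∧ j ≠ k ∧ j ≠ l ∧ k ≠ l := by
  revert i j k l; decide

theorem bounds (h : IsHalfBase z l) (hij : i ≠ j) : -1 < z i j ∧ z i j < 1 :=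
  _root_.abs_lt.1 (h.abs_lt i j hij)

theorem pos (h : IsHalfBase z l) (hd : [i, j, k, l].Nodup) : 0 < z i l := by
  obtain ⟨-, -, e₁, e₂, e₃, e₄, e₅, e₆⟩ := nodup_swap hd
  have := h.sum_eq i j k l hd
  rw [h.diag] at this
  linarith [(h.bounds e₅).2, (h.bounds e₆).2]

theorem half_col (h : IsHalfBase z l) (hd : [i, j, k, l].Nodup) :
    z l i = (1 + z j i + z k i) / 2 := by
  have := h.sum_eq i j k i hd
  rw [h.diag] at this
  linarith

/-- The column in which `z l - z i` has an entry of absolute value at least one. -/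
theorem exists_column (h : IsHalfBase z l) (hd : [i, j, k, l].Nodup) :
    z j i + z k i ≤ -1 ∨ 1 ≤ z k j - z i j ∨ 1 ≤ z j k - z i k := by
  obtain ⟨hd₁, hd₂, e₁, e₂, e₃, e₄, e₅, e₆⟩ := nodup_swap hd
  obtain ⟨p, hp⟩ := (h.bad i j k hd).adm (-1) 0 1 (by norm_num)
  push_cast at hp
  rcases IsSuperbase.cover hd p with rfl | rfl | rfl | rfl
  · left
    have := h.half_col hd
    obtain ⟨b₁, b₁'⟩ := h.bounds e₁.symm
    obtain ⟨b₂, b₂'⟩ := h.bounds e₂.symm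
    rw [h.diag] at hp
    rcases le_abs.1 hp with hp | hp <;> linarith
  · right; left
    have := h.half_col hd₁
    obtain ⟨b₁, b₁'⟩ := h.bounds e₁
    obtain ⟨b₂, b₂'⟩ := h.bounds e₄.symm
    rcases le_abs.1 hp with hp | hp <;> linarith
  · right; right
    have := h.half_col (nodup_swap hd₂).1
    obtain ⟨b₁, b₁'⟩ := h.bounds e₂
    obtain ⟨b₂, b₂'⟩ := h.bounds e₄
    rcases le_abs.1 hp with hp | hp <;> linarith
  · have b₁ := h.pos hd
    obtain ⟨b₂, b₂'⟩ := h.bounds e₃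
    rw [h.diag] at hp
    rcases le_abs.1 hp with hp | hp <;> linarith

theorem fixed_false (h : IsHalfBase z l) (hd : [i, j, k, l].Nodup) (hi : z j i + z k i ≤ -1)
    (hj : z i j + z k j ≤ -1) (hk : z i k + z j k ≤ -1) : False := by
  obtain ⟨hd₁, hd₂, e₁, e₂, e₃, e₄, e₅, e₆⟩ := nodup_swap hd
  have hd₃ := (nodup_swap hd₂).1
  have hwi := h.half_col hd
  have hwj := h.half_col hd₁
  have hwk := h.half_col hd₃
  have qi := h.pos hd
  have qj := h.pos hd₁
  have qk := h.pos hd₃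
  have on : ∀ {a b q r : ℝ}, a ≤ 0 → b ≤ 0 → 0 < q → 0 < r → 1 ≤ (1 - a * q) * (1 - b * r) :=
    fun ha hb hq hr => by
      have h₁ := mul_nonpos_of_nonpos_of_nonneg ha hq.le
      have h₂ := mul_nonpos_of_nonpos_of_nonneg hb hr.le
      nlinarith [mul_nonneg_of_nonpos_of_nonpos h₁ h₂]
  have off : ∀ {a b w q : ℝ}, w = (1 + a + b) / 2 → a + b ≤ -1 → -1 < b → q < 1 →
      a - w * q ≤ 0 := fun {a b w q} h₁ h₂ h₃ h₄ => by
    linarith [mul_nonneg (by linarith : 0 ≤ -w) (sub_nonneg.2 h₄.le)]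
  refine (h.bad i j k hd).shear_false (e₃ := z k) (t := 2) (fun p => h.sum_eq i j k p hd)
    (i := i) (j := j) (k := k) (l := l) (by rw [h.diag]; exact one_pos) ?_ ?_ ?_ ?_ ?_ ?_ ?_ ?_ ?_
  all_goals simp only [h.diag, one_mul]
  · exact on (by linarith) (by linarith) qi qj
  · exact on (by linarith) (by linarith) qj qk
  · exact on (by linarith) (by linarith) qk qi
  · exact off hwi hi (h.bounds e₂.symm).1 (h.bounds e₅).2
  · exact off (hwi.trans (by ring)) (by linarith) (h.bounds e₁.symm).1 (h.bounds e₆).2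
  · exact off hwj hj (h.bounds e₄.symm).1 (h.bounds e₃).2
  · exact off (hwj.trans (by ring)) (by linarith) (h.bounds e₁).1 (h.bounds e₆).2
  · exact off hwk hk (h.bounds e₄).1 (h.bounds e₃).2
  · exact off (hwk.trans (by ring)) (by linarith) (h.bounds e₂).1 (h.bounds e₅).2

theorem rotation_false (h : IsHalfBase z l) (hd : [i, j, k, l].Nodup) (hi : 1 ≤ z j i - z k i)
    (hj : 1 ≤ z k j - z i j) (hk : 1 ≤ z i k - z j k) : False := by
  obtain ⟨hd₁, hd₂, e₁, e₂, e₃, e₄, e₅, e₆⟩ := nodup_swap hd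
  have hd₃ := (nodup_swap hd₂).1
  have hwi := h.half_col hd
  have hwj := h.half_col hd₁
  have hwk := h.half_col hd₃
  have hs := fun p => h.sum_eq i j k p hd
  have si := hs i
  have sj := hs j
  have sk := hs k
  have sl := hs l
  have b := fun {i j : Fin 4} (e : i ≠ j) => h.bounds e
  refine ((h.bad i j k hd).of_unimodular 1 1 (-1) 0 (-1) 1 (-1) 0 1 (by norm_num)
    (x' := fun p => z l p - z k p) (y' := fun p => z l p - z j p) (z' := fun p => z l p - z i p)
    (fun p => by push_cast; linarith [hs p]) (fun p => by push_cast; ring)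
    (fun p => by push_cast; ring)).cyclic_false (i := i) (j := k) (k := j) (l := l)
    ?_ ?_ ?_ ?_ ?_ ?_ ?_ ?_ ?_ ?_ ?_ ?_ ?_
  all_goals simp only [h.diag] at *
  · linarith
  · linarith
  · linarith
  · rw [show 1 - z k l + (1 - z j l) + (1 - z i l) = 1 by linarith]; norm_num
  · linarith
  · linarith
  · linarith
  · linarith [(b e₁.symm).1, (b e₁.symm).2, (b e₂.symm).1, (b e₂.symm).2]
  · linarith [(b e₂).1, (b e₂).2, (b e₄).1, (b e₄).2]
  · linarith [(b e₁).1, (b e₁).2, (b e₄.symm).1, (b e₄.symm).2]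
  · linarith [(b e₁.symm).1, (b e₁.symm).2, (b e₂.symm).1, (b e₂.symm).2]
  · linarith [(b e₂).1, (b e₂).2, (b e₄).1, (b e₄).2]
  · linarith [(b e₁).1, (b e₁).2, (b e₄.symm).1, (b e₄.symm).2]

theorem swap_false (h : IsHalfBase z l) (hd : [i, j, k, l].Nodup) (hi : 1 ≤ z k i - z j i)
    (hj : 1 ≤ z k j - z i j) (hk : z i k + z j k ≤ -1) : False := by
  obtain ⟨hd₁, hd₂, e₁, e₂, e₃, e₄, e₅, e₆⟩ := nodup_swap hd
  have hd₃ := (nodup_swap hd₂).1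
  have hwi := h.half_col hd
  have hwj := h.half_col hd₁
  have hwk := h.half_col hd₃
  have hs := fun p => h.sum_eq i j k p hd
  have si := hs i
  have sj := hs j
  have sk := hs k
  have sl := hs l
  have b := fun {i j : Fin 4} (e : i ≠ j) => h.bounds e
  obtain ⟨hb₁, hb₁'⟩ := b e₁
  obtain ⟨hb₂, hb₂'⟩ := b e₂
  obtain ⟨hb₃, hb₃'⟩ := b e₃
  obtain ⟨hb₄, hb₄'⟩ := b e₄
  obtain ⟨hb₅, hb₅'⟩ := b e₅
  obtain ⟨hb₆, hb₆'⟩ := b e₆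
  obtain ⟨hc₁, hc₁'⟩ := b e₁.symm
  obtain ⟨hc₂, hc₂'⟩ := b e₂.symm
  obtain ⟨hc₄, hc₄'⟩ := b e₄.symm
  have hq := h.pos hd₃
  have hb := ((h.bad i j k hd).of_unimodular (-1) 0 1 0 (-1) 1 1 1 (-1) (by norm_num)
    (x' := fun p => z l p - z i p) (y' := fun p => z l p - z j p) (z' := fun p => z l p - z k p)
    (fun p => by push_cast; ring) (fun p => by push_cast; ring)
    (fun p => by push_cast; linarith [hs p])).flip (fun p => if p = k ∨ p = l then -1 else 1)
    (fun p => by split_ifs <;> norm_num)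
  obtain ⟨A, hA⟩ : ∃ A, A = 1 - z l k := ⟨_, rfl⟩
  obtain ⟨B, hB⟩ : ∃ B, B = -(z l j - z k j) := ⟨_, rfl⟩
  obtain ⟨C, hC⟩ : ∃ C, C = -(z l i - z k i) := ⟨_, rfl⟩
  have A1 : 1 ≤ A := by linarith
  have B0 : 0 ≤ B := by linarith
  have C0 : 0 ≤ C := by linarith
  simp only [h.diag] at si sj sk sl
  have d₁ : A * (z l j - z i j) - (z l j - z k j) * -(z l k - z i k) = A + B * -z j k := by
    rw [show z l j - z i j = 1 + B by linarith, show z l j - z k j = -B by linarith,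
      show z l k - z i k = 1 - A - z i k by linarith, show z i k = 1 - 2 * A - z j k by linarith]
    ring
  have d₂ : A * (z l i - z j i) - (z l i - z k i) * -(z l k - z j k) = A + C * -z i k := by
    rw [show z l i - z j i = 1 + C by linarith, show z l i - z k i = -C by linarith,
      show z l k - z j k = 1 - A - z j k by linarith, show z j k = 1 - 2 * A - z i k by linarith]
    ring
  have d₃ : A * 1 - -(1 - z k l) * z l k = 1 + z k l * (A - 1) := by
    rw [hA]; ring
  have p₁ : 0 ≤ B * -z j k := mul_nonneg B0 (by linarith)
  have p₂ : 0 ≤ C * -z i k := mul_nonneg C0 (by linarith)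
  have p₃ : 0 ≤ z k l * (A - 1) := mul_nonneg hq.le (by linarith)
  have prod : ∀ {X Y : ℝ}, A ≤ X → 1 ≤ Y → A ≤ X * Y := fun hX hY =>
    hX.trans (le_mul_of_one_le_right (by linarith) hY)
  have hk' : -(z l k - 1) = A := by rw [hA]; ring
  refine hb.shear_false (e₃ := fun p => if p = k ∨ p = l then z l p else -z l p) (t := -1)
    (fun p => by split_ifs <;> linarith [hs p])
    (i := j) (j := i) (k := l) (l := k) ?_ ?_ ?_ ?_ ?_ ?_ ?_ ?_ ?_ ?_
  all_goals simp only [e₂, e₃, e₄, e₅, or_self, true_or, or_true, if_true, if_false, neg_one_mul,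
    one_mul, hk', h.diag]
  · linarith
  · rw [d₁, d₂]; exact prod (by linarith) (by linarith)
  · rw [d₂, d₃]; exact prod (by linarith) (by linarith)
  · rw [d₁, d₃, mul_comm]; exact prod (by linarith) (by linarith)
  · rw [show z l j - 1 = z k j - 1 - B by linarith, show z l j - z k j = -B by linarith,
      show z l k - z j k = 1 - A - z j k by linarith]
    linarith [mul_nonneg (by linarith : 0 ≤ A) (sub_nonneg.2 hc₄'.le),
      mul_nonneg B0 (sub_nonneg.2 hb₄'.le)]
  · rw [show z l j - z k j = -B by linarith, show z l j = z k j - B by linarith,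
      show z l k = 1 - A by linarith]
    linarith [mul_nonneg (sub_nonneg.2 A1) (by linarith : 0 ≤ z k j)]
  · rw [show z l i - 1 = z k i - 1 - C by linarith, show z l i - z k i = -C by linarith,
      show z l k - z i k = 1 - A - z i k by linarith]
    linarith [mul_nonneg (by linarith : 0 ≤ A) (sub_nonneg.2 hc₂'.le),
      mul_nonneg C0 (sub_nonneg.2 hb₂'.le)]
  · rw [show z l i - z k i = -C by linarith, show z l i = z k i - C by linarith,
      show z l k = 1 - A by linarith]
    linarith [mul_nonneg (sub_nonneg.2 A1) (by linarith : 0 ≤ z k i)]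
  · rw [show z l k - z i k = 1 - A - z i k by linarith]
    linarith [mul_nonneg (by linarith : 0 ≤ 1 - z i l) (by linarith : 0 ≤ A),
      mul_nonneg (by linarith : 0 ≤ 1 - z k l) (by linarith : 0 ≤ 1 - A - z i k)]
  · rw [show z l k - z j k = 1 - A - z j k by linarith]
    linarith [mul_nonneg (by linarith : 0 ≤ 1 - z j l) (by linarith : 0 ≤ A),
      mul_nonneg (by linarith : 0 ≤ 1 - z k l) (by linarith : 0 ≤ 1 - A - z j k)]

theorem false (h : IsHalfBase z l) (hd : [i, j, k, l].Nodup) : False := by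
  obtain ⟨hd₁, hd₂, e₁, e₂, e₃, e₄, e₅, e₆⟩ := nodup_swap hd
  have hd₃ := (nodup_swap hd₂).1
  have hd₄ := (nodup_swap hd₁).2.1
  have hd₅ := (nodup_swap hd₃).2.1
  have b := fun {i j : Fin 4} (e : i ≠ j) => h.bounds e
  obtain ⟨hb₁, hb₁'⟩ := b e₁
  obtain ⟨hb₂, hb₂'⟩ := b e₂
  obtain ⟨hb₄, hb₄'⟩ := b e₄
  obtain ⟨hc₁, hc₁'⟩ := b e₁.symm
  obtain ⟨hc₂, hc₂'⟩ := b e₂.symm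
  obtain ⟨hc₄, hc₄'⟩ := b e₄.symm
  rcases h.exists_column hd with h₁ | h₁ | h₁ <;>
  rcases h.exists_column hd₁ with h₂ | h₂ | h₂ <;>
  rcases h.exists_column hd₃ with h₃ | h₃ | h₃ <;> first
    | linarith
    | exact h.fixed_false hd (by linarith) (by linarith) (by linarith)
    | exact h.rotation_false hd (by linarith) (by linarith) (by linarith)
    | exact h.rotation_false hd₁ (by linarith) (by linarith) (by linarith)
    | exact h.swap_false hd (by linarith) (by linarith) (by linarith)
    | exact h.swap_false hd₂ (by linarith) (by linarith) (by linarith)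
    | exact h.swap_false hd₄ (by linarith) (by linarith) (by linarith)

end IsHalfBase

/-- The inequalities expressing that the minors are small for a lattice generated by three vectors
of sum zero and a fourth vector. -/
structure ZeroData (x y z τ s p q r : ℝ) : Prop where
  x_pos : 0 < x
  x_lt : x < 1
  y_pos : 0 < y
  y_lt : y < 1
  z_pos : 0 < z
  z_lt : z < 1
  p_lt : p < 1
  q_lt : q < 1
  r_gt : -1 < r
  add_lt : τ + s < 1
  dk : 8 / 27 < x * y - τ * ((1 - y) * p - (1 - x) * q) - s * (p + x * q)
  dj : 8 / 27 < (1 - x) * z - τ * (p + (1 - x) * r) - s * (p * (1 - z) - x * r)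
  di : 8 / 27 < (1 - y) * (1 - z) + τ * (q + (1 - y) * r) + s * (r + (1 - z) * q)
  dl : 8 / 27 < 1 - (y + z - y * z) * p - (1 - (1 - x) * z) * q - (1 - x * y) * r

/-- `plane_product_false` with a different arrangement of the factors. -/
theorem plane_product_false' {x y z : ℝ} (hx : 0 ≤ x) (hx1 : x ≤ 1) (hy : 0 ≤ y) (hy1 : y ≤ 1)
    (hz : 0 ≤ z) (hz1 : z ≤ 1) (h₁ : 8 / 27 < x * y) (h₂ : 8 / 27 < (1 - y) * (1 - z))
    (h₃ : 8 / 27 < (1 - x) * z) : False := by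
  refine plane_product_false (x := x) (y := 1 - y) (z := z) hx hx1 (sub_nonneg.2 hy1)
    (by linarith) hz hz1 ?_ h₂ ?_
  · linarith
  · linarith

theorem four_mul_one_sub_le (x : ℝ) : x * (1 - x) ≤ 1 / 4 := by
  nlinarith [sq_nonneg (x - 1 / 2)]

namespace ZeroData

variable {x y z τ s p q r : ℝ}

theorem false_of_zero (h : ZeroData x y z 0 0 p q r) : False := by
  obtain ⟨x0, x1, y0, y1, z0, z1, -, -, -, -, dk, dj, di, -⟩ := h
  exact plane_product_false' x0.le x1.le y0.le y1.le z0.le z1.le (by linarith) (by linarith)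
    (by linarith)

theorem false_of_nonpos (h : ZeroData x y z τ s p q r) (hτ : τ ≤ 0) (hs : 0 ≤ τ + s) (hp : 0 ≤ p)
    (hq : 0 ≤ q) (hr : r ≤ 0) : False := by
  obtain ⟨x0, x1, y0, y1, z0, z1, p1, q1, -, -, dk, dj, di, -⟩ := h
  obtain ⟨B, rfl⟩ : ∃ B, τ = -B := ⟨-τ, by ring⟩
  obtain ⟨A, rfl⟩ : ∃ A, s = A + B := ⟨s - B, by ring⟩
  have A0 : 0 ≤ A := by linarith
  have B0 : 0 ≤ B := by linarith
  have v0 : 0 ≤ -r := by linarith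
  have z1' : 0 ≤ 1 - z := by linarith
  have e₁ : 0 ≤ A * p := by positivity
  have e₂ : 0 ≤ B * q := by positivity
  have e₃ : 0 ≤ A * B * p * q := by positivity
  have e₄ : 0 ≤ B * p * y := by positivity
  have e₅ : 0 ≤ A * q * x := by positivity
  have e₆ : 0 ≤ A * p * (1 - z) := by positivity
  have e₇ : 0 ≤ A * -r * x := by positivity
  have e₈ : 0 ≤ B * -r := by positivity
  have e₉ : 0 ≤ B * q * z := by positivity
  have e₁₀ : 0 ≤ B * -r * y := by positivity
  have e₁₁ : 0 ≤ A * -r := by positivity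
  have e₁₂ : 0 ≤ B * p := by positivity
  have e₁₃ : 0 ≤ A * q := by positivity
  have x' : 0 ≤ x - B * p := by
    by_contra! hc
    linarith [mul_le_mul_of_nonneg_right hc.le y0.le]
  have y' : 0 ≤ y - A * q := by
    by_contra! hc
    linarith [mul_le_mul_of_nonneg_right hc.le x0.le]
  exact plane_product_false' x' (by linarith) y' (by linarith) z0.le z1.le
    (by linarith) (by linarith) (by linarith)

theorem false_of_le (h : ZeroData x y z τ s p q r) (hτ : 0 ≤ τ) (hs : 0 ≤ s) (hp : 1 - x ≤ p)
    (hq : 0 ≤ q) (hq' : q ≤ 1 - y) (hr : 1 - z ≤ -r) : False := by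
  obtain ⟨x0, x1, y0, y1, z0, z1, p1, q1, hr1, -, dk, dj, di, -⟩ := h
  have x1' : 0 ≤ 1 - x := by linarith
  have y1' : 0 ≤ 1 - y := by linarith
  have z1' : 0 ≤ 1 - z := by linarith
  have v0 : 0 ≤ -r := by linarith
  have p0 : 0 ≤ p := by linarith
  have f₁ : 0 ≤ τ * ((1 - y) * p - (1 - x) * q) := by
    refine mul_nonneg hτ ?_
    linarith [mul_le_mul_of_nonneg_left hp y1', mul_le_mul_of_nonneg_left hq' x1']
  have f₂ : 0 ≤ s * (p + x * q) := by positivity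
  have f₃ : 0 ≤ s * (p * (1 - z) + x * -r) := by positivity
  have f₄ := mul_le_mul_of_nonneg_left hp hτ
  have f₅ := mul_le_mul_of_nonneg_left hq' hτ
  have f₆ : 0 ≤ s * (-r - (1 - z) * q) := by
    refine mul_nonneg hs ?_
    linarith [mul_le_mul_of_nonneg_left q1.le z1']
  have z'1 : 0 ≤ τ * (1 + r) := mul_nonneg hτ (by linarith)
  have z'0 : 0 ≤ z - τ * (1 + r) := by
    by_contra! hc
    linarith [mul_nonpos_of_nonneg_of_nonpos x1' hc.le]
  exact plane_product_false' x0.le x1.le y0.le y1.le z'0 (by linarith)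
    (by linarith) (by linarith) (by linarith)

theorem false_of_two_le (h : ZeroData x y z τ s p q r) (hτ : 0 ≤ τ) (hs : 0 ≤ s)
    (hp : 2 * (1 - x) ≤ p) (hq : 0 ≤ q) (hr : 1 - z ≤ -r) : False := by
  obtain ⟨x0, x1, y0, y1, z0, z1, p1, q1, hr1, -, dk, dj, di, dl⟩ := h
  have x1' : 0 < 1 - x := by linarith
  have y1' : 0 < 1 - y := by linarith
  have z1' : 0 < 1 - z := by linarith
  have v0 : 0 ≤ -r := by linarith
  have p0 : 0 ≤ p := by linarith
  have f₂ : 0 ≤ s * (p + x * q) := by positivity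
  have f₃ : 0 ≤ s * (p * (1 - z) + x * -r) := by positivity
  have f₄ := mul_le_mul_of_nonneg_left hp hτ
  have f₆ : 0 ≤ s * (-r - (1 - z) * q) := by
    refine mul_nonneg hs ?_
    linarith [mul_le_mul_of_nonneg_left q1.le z1'.le]
  obtain ⟨w, hw⟩ : ∃ w, w = z - τ * (2 + r) := ⟨_, rfl⟩
  have z'1 : 0 ≤ τ * (2 + r) := mul_nonneg hτ (by linarith)
  have g₁ : 8 / 27 < (1 - x) * w := by rw [hw]; linarith
  have z'0 : 0 ≤ w := by
    by_contra! hc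
    linarith [mul_nonpos_of_nonneg_of_nonpos x1'.le hc.le]
  rcases le_total q (2 * (1 - y)) with hq' | hq'
  · have f₁ : 0 ≤ τ * ((1 - y) * p - (1 - x) * q) := by
      refine mul_nonneg hτ ?_
      linarith [mul_le_mul_of_nonneg_left hp y1'.le, mul_le_mul_of_nonneg_left hq' x1'.le]
    have f₅ := mul_le_mul_of_nonneg_left hq' hτ
    exact plane_product_false' x0.le x1.le y0.le y1.le z'0 (by linarith)
      (by linarith) (by rw [hw]; linarith) g₁
  · obtain ⟨Q, rfl⟩ : ∃ Q, q = 2 * (1 - y) + Q := ⟨q - 2 * (1 - y), by ring⟩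
    have Q0 : 0 ≤ Q := by linarith
    have xy : 0 < 1 - x * y := by
      have := mul_pos x0 y1'
      linarith
    have a₁ : 8 / 27 < x * y - x * Q := by
      have b₁ := mul_le_mul_of_nonneg_left hp (by nlinarith only [mul_pos y0 z1', z0] : 0 ≤ y + z - y * z)
      have b₂ := mul_nonneg xy.le (by linarith : 0 ≤ 1 + r)
      have b₃ : 0 ≤ (1 - x) * (1 - z) * Q := by positivity
      linarith
    have a₂ : 8 / 27 < (1 - y) * (1 - w) + τ * Q := by
      rw [hw]; linarith
    have a₃ : τ ≤ 1 - w := by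
      have : 0 ≤ τ * (1 + r) := mul_nonneg hτ (by linarith)
      rw [hw]; linarith
    have a₄ := mul_lt_mul_of_pos_left a₂ x0
    have a₅ := mul_le_mul_of_nonneg_left a₁.le hτ
    have a₆ : 0 < x * y - 8 / 27 := by
      have : 0 ≤ x * Q := by positivity
      linarith
    have a₇ := mul_le_mul_of_nonneg_right a₃ a₆.le
    have a₈ : x * (8 / 27) < (1 - w) * (x - 8 / 27) := by linarith
    have a₉ : 0 < x - 8 / 27 := by
      have := mul_pos x0 y1'
      linarith
    have a₁₀ := mul_lt_mul_of_pos_right g₁ a₉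
    have a₁₁ := mul_lt_mul_of_pos_left a₈ x1'
    linarith [four_mul_one_sub_le x]

theorem false_of_pos_of_le_half_aux {x t w : ℝ} (hx : 8 / 27 < x) (hx' : x ≤ 1 / 2) (ht : 0 ≤ t)
    (hw : 0 ≤ w) (hxt : x * t ≤ x - 8 / 27) (hxw : (1 - x) * w ≤ 1 - x - 8 / 27) :
    (x - 8 / 27 - x * t) * ((1 + w) * (19 / 27) - (x + (1 - x) * w) * (1 - t * w)) ≤
      (x + (1 - x) * w) * (8 / 27 - t * w) * (x + (1 - x) * t) := by
  have t1 : t ≤ 1 / 2 := by nlinarith only [hx, hx', ht, hxt]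
  have g₀ : 0 ≤ x * x * (8 / 27) - (x - 8 / 27) * (19 / 27 - x) := by
    nlinarith only [sq_nonneg (x - 2 / 5)]
  have g₁ : 0 ≤ w * (8 / 27 * (1 - x) * x - (x - 8 / 27) ^ 2) := by
    refine mul_nonneg hw ?_
    nlinarith only [hx, hx', mul_nonneg (sub_nonneg.2 hx.le) (sub_nonneg.2 hx')]
  have g₂ : 0 ≤ t * ((x + (1 - x) * w) * (8 / 27) * (1 - x) + x * (19 / 27 - x)
      + x * w * (x - 8 / 27) - (x + (1 - x) * w) * w * (2 * x - 8 / 27 + (1 - 2 * x) * t)) := by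
    refine mul_nonneg ht ?_
    have h₁ : (1 - 2 * x) * t ≤ (1 - 2 * x) * (1 / 2) :=
      mul_le_mul_of_nonneg_left t1 (by linarith)
    have h₂ : 0 ≤ (x + (1 - x) * w) * w := by
      have : 0 ≤ 1 - x := by linarith
      positivity
    have h₃ := mul_le_mul_of_nonneg_left h₁ h₂
    have h₄ : (x + (1 - x) * w) * (w * (x + 1 / 2 - 8 / 27)) ≤
        19 / 27 * (w * (x + 1 / 2 - 8 / 27)) :=
      mul_le_mul_of_nonneg_right (by linarith) (mul_nonneg hw (by linarith))
    have h₅ : 0 ≤ x * w * (x - 8 / 27) := mul_nonneg (by positivity) (by linarith)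
    have c₀ : 0 ≤ 19 / 27 * (x + 11 / 54) - (1 - x) ^ 2 * (8 / 27) := by
      clear * - hx hx'
      nlinarith
    have h₆ : (19 / 27 - x) * (19 / 27 * (x + 11 / 54) - (1 - x) ^ 2 * (8 / 27)) ≤
        (1 - x) * (x * (8 / 27) * (1 - x) + x * (19 / 27 - x)) := by
      clear * - hx hx'
      have := mul_nonneg (sub_nonneg.2 hx.le) (sub_nonneg.2 hx')
      nlinarith
    have h₇ := mul_le_mul_of_nonneg_right hxw c₀
    have h₈ : w * (19 / 27 * (x + 11 / 54) - (1 - x) ^ 2 * (8 / 27)) ≤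
        x * (8 / 27) * (1 - x) + x * (19 / 27 - x) := by
      have : 0 < 1 - x := by linarith
      refine le_of_mul_le_mul_left ?_ this
      linarith
    linarith
  linarith

theorem false_of_half_le_aux {x t w : ℝ} (hx : 1 / 2 ≤ x) (hx' : x ≤ 19 / 27)
    (hw : 0 ≤ w) (hxt : x * t ≤ x - 8 / 27) (hxw : (1 - x) * w ≤ 1 - x - 8 / 27) :
    (1 - x - 8 / 27 - (1 - x) * w) *
        ((x - 8 / 27) + w * (19 / 27 - x) + w * t * (1 - x + x * w)) ≤
      (x + (1 - x) * w) * (8 / 27 - t * w) * (1 - x + x * w) := by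
  have hxx := mul_nonneg (sub_nonneg.2 hx) (sub_nonneg.2 hx')
  have x1 : 0 < 1 - x := by linarith
  have w1 : w ≤ 1 / 2 := by
    by_contra! hc
    linarith [mul_lt_mul_of_pos_left hc x1]
  have c₀ : 0 ≤ x * (19 / 27 * (8 / 27 - x * (1 - x))) := by
    have := four_mul_one_sub_le x
    have h : 0 ≤ 8 / 27 - x * (1 - x) := by linarith
    positivity
  have c₁ : 0 ≤ x * (8 / 27) * ((1 - x) ^ 2 + x ^ 2) + x * (1 - x) * (x - 8 / 27)
      - x * (19 / 27 - x) ^ 2 - 19 / 27 * (x - 8 / 27) * (1 - x) := by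
    nlinarith only [hxx, hx, hx', mul_nonneg hxx (sub_nonneg.2 hx)]
  have c₂ : 0 ≤ (x * (8 / 27) * ((1 - x) ^ 2 + x ^ 2) + x * (1 - x) * (x - 8 / 27)
      - x * (19 / 27 - x) ^ 2 - 19 / 27 * (x - 8 / 27) * (1 - x)) +
      (x * (8 / 27) * (1 - x) * x + x * (1 - x) * (19 / 27 - x)
        - 19 / 27 * (x - 8 / 27) * x) * (1 / 2) := by
    nlinarith only [hxx, hx, hx', mul_nonneg hxx (sub_nonneg.2 hx)]
  have e₁ := mul_nonneg hw (mul_nonneg (sub_nonneg.2 w1) c₁)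
  have e₂ := mul_nonneg hw (mul_nonneg hw c₂)
  have h : 0 ≤ 19 / 27 * w * (1 - x + x * w) := by positivity
  have e₃ := mul_le_mul_of_nonneg_left hxt h
  have x0 : 0 < x := by linarith
  refine le_of_mul_le_mul_left ?_ x0
  linarith

theorem false_of_le_of_lt (h : ZeroData x y z τ s p q r) (hτ : 0 ≤ τ) (hs : τ ≤ s)
    (hp : 1 - x ≤ p) (hq : 1 - y < q) (hr : 1 - z ≤ -r) : False := by
  obtain ⟨x0, x1, y0, y1, z0, z1, p1, q1, hr1, -, dk, dj, di, dl⟩ := h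
  obtain ⟨v, rfl⟩ : ∃ v, r = -v := ⟨-r, by ring⟩
  rw [neg_neg] at hr
  obtain ⟨t, rfl⟩ : ∃ t, y = 1 - t := ⟨1 - y, by ring⟩
  obtain ⟨w, rfl⟩ : ∃ w, z = 1 - w := ⟨1 - z, by ring⟩
  rw [sub_sub_cancel] at hq hr
  have t0 : 0 < t := by linarith
  have w0 : 0 < w := by linarith
  have q0 : 0 < q := by linarith
  have x1' : 0 < 1 - x := by linarith
  have p0 : 0 < p := by linarith
  have v0 : 0 < v := by linarith
  obtain ⟨Q, rfl⟩ : ∃ Q, q = t + Q := ⟨q - t, by ring⟩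
  have Q0 : 0 < Q := by linarith
  have f₁ := mul_le_mul_of_nonneg_right hs (by positivity : 0 ≤ p + x * (t + Q))
  have f₂ := mul_le_mul_of_nonneg_left hp (by positivity : 0 ≤ τ * (1 + t))
  have dk' : 8 / 27 < x * (1 - t) - τ * (1 - x * (1 - t) + (2 * x - 1) * Q) := by linarith
  have f₃ := mul_le_mul_of_nonneg_right hs (by positivity : 0 ≤ p * w + x * v)
  have f₄ := mul_le_mul_of_nonneg_left hp (by positivity : 0 ≤ τ * (1 + w))
  have dj' : 8 / 27 < (1 - x) * (1 - w) - τ * ((1 - x) * (1 - v + w) + v * x) := by linarith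
  have f₅ : 0 ≤ v - w * (t + Q) := by
    have := mul_le_mul_of_nonneg_left q1.le w0.le
    linarith
  have f₆ := mul_le_mul_of_nonneg_right hs f₅
  have di' : 8 / 27 < t * w + τ * ((1 + w) * (t + Q) - (1 + t) * v) := by linarith
  have b0 : 0 < x + (1 - x) * w := by positivity
  have f₇ := mul_le_mul_of_nonneg_left hp
    (by nlinarith only [mul_pos (show 0 < 1 - t by linarith) (show 0 < 1 - w by linarith), t0, y0, z0, y1, z1, mul_pos y0 w0] : 0 ≤ 1 - t * w)
  have dl' : 8 / 27 < 1 - (1 - x * (1 - t)) * (1 - v) - (x + (1 - x) * w) * Q := by linarith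
  have e₁ := mul_lt_mul_of_pos_left di' b0
  have e₂ := mul_le_mul_of_nonneg_left dl'.le (by positivity : 0 ≤ τ * (1 + w))
  have a₁ : 0 < x * (1 - t) - 8 / 27 := by
    have := mul_nonneg hτ (by linarith [mul_pos x0 t0, mul_pos x0 Q0, mul_pos x1' (by linarith : 0 < 1 - Q)] : 0 ≤ 1 - x * (1 - t) + (2 * x - 1) * Q)
    linarith
  have a₂ : 0 < (1 - x) * (1 - w) - 8 / 27 := by
    have h : 0 < 1 - v + w := by linarith
    have : 0 ≤ τ * ((1 - x) * (1 - v + w) + v * x) := by positivity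
    linarith
  have a₃ : t * w ≤ 8 / 27 := by
    by_contra! hc
    refine plane_product_false' x0.le x1.le y0.le y1.le z0.le z1.le (by linarith) (by linarith)
      (by linarith)
  rcases le_total x (1 / 2) with hx | hx
  · have g₁ : (x + (1 - x) * w) * (8 / 27 - t * w) <
        τ * ((1 + w) * (19 / 27) - (x + (1 - x) * w) * (1 - t * w)) := by
      have : 0 ≤ τ * ((1 - 2 * x) * (1 - t * w) * (1 - v)) := by
        have h₁ : 0 ≤ 1 - 2 * x := by linarith
        have h₂ : 0 ≤ 1 - t * w := by linarith
        have h₃ : 0 ≤ 1 - v := by linarith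
        positivity
      linarith
    have g₂ : τ * (x + (1 - x) * t) < x - 8 / 27 - x * t := by
      have : 0 ≤ τ * ((1 - 2 * x) * (1 - (t + Q))) := by
        have h₁ : 0 ≤ 1 - 2 * x := by linarith
        have h₂ : 0 ≤ 1 - (t + Q) := by linarith
        positivity
      linarith
    have g₃ := false_of_pos_of_le_half_aux (x := x) (t := t) (w := w)
      (by nlinarith only [a₁, mul_pos x0 t0]) hx t0.le w0.le (by linarith) (by linarith)
    have d0 : 0 < x + (1 - x) * t := by positivity
    have B0 : 0 < (1 + w) * (19 / 27) - (x + (1 - x) * w) * (1 - t * w) := by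
      by_contra! hc
      have h₁ := mul_nonpos_of_nonneg_of_nonpos hτ hc
      have h₂ := mul_nonneg b0.le (sub_nonneg.2 a₃)
      linarith
    have h₁ := mul_lt_mul_of_pos_right g₁ d0
    have h₂ := mul_lt_mul_of_pos_right g₂ B0
    linarith
  · have hvw : 0 ≤ τ * ((2 * x - 1) * (1 - t * w) * (v - w)) := by
      have h₁ : 0 ≤ 2 * x - 1 := by linarith
      have h₂ : 0 ≤ 1 - t * w := by linarith
      have h₃ : 0 ≤ v - w := by linarith
      positivity
    have g₁ : (x + (1 - x) * w) * (8 / 27 - t * w) <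
        τ * ((x - 8 / 27) + w * (19 / 27 - x) + w * t * (1 - x + x * w)) := by
      linarith
    have g₂ : τ * (1 - x + x * w) < 1 - x - 8 / 27 - (1 - x) * w := by
      have : 0 ≤ τ * ((2 * x - 1) * (v - w)) := by
        have h₁ : 0 ≤ 2 * x - 1 := by linarith
        have h₃ : 0 ≤ v - w := by linarith
        positivity
      linarith
    have hxw := mul_pos x1' w0
    have g₃ := false_of_half_le_aux (x := x) (t := t) (w := w) hx
      (by linarith) w0.le (by linarith) (by linarith)
    have d0 : 0 < 1 - x + x * w := by positivity
    have B0 : 0 < (x - 8 / 27) + w * (19 / 27 - x) + w * t * (1 - x + x * w) := by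
      have h₁ : 0 < x - 8 / 27 := by linarith
      have h₂ : 0 ≤ 19 / 27 - x := by linarith
      positivity
    have h₁ := mul_lt_mul_of_pos_right g₁ d0
    have h₂ := mul_lt_mul_of_pos_right g₂ B0
    linarith

theorem swap (h : ZeroData x y z τ s p q r) (hq : -1 < q) (hr : r < 1) :
    ZeroData (1 - x) z y s τ p r q := by
  obtain ⟨x0, x1, y0, y1, z0, z1, p1, q1, hr1, hτ, dk, dj, di, dl⟩ := h
  constructor <;> linarith

theorem false_of_shear (h : ZeroData x y z τ s p q r) (hτ : 0 ≤ τ) (hs : 0 ≤ s) (hp : 0 ≤ p)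
    (hq : y ≤ q) (hr : z ≤ r) (hτs : s * x ≤ τ * (1 - x)) : False := by
  obtain ⟨x0, x1, y0, y1, z0, z1, p1, q1, hr1, -, dk, dj, di, dl⟩ := h
  obtain ⟨d, hd⟩ : ∃ d, d = τ * (1 - x) - s * x := ⟨_, rfl⟩
  have d0 : 0 ≤ d := by linarith
  have y1' : 0 ≤ 1 - y := by linarith
  have z1' : 0 ≤ 1 - z := by linarith
  have x1' : 0 ≤ 1 - x := by linarith
  have e₁ : 0 ≤ p * (τ + s * (1 - z)) := by positivity
  have e₂ : 0 ≤ p * (τ * (1 - y) + s) := by positivity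
  have e₃ := mul_le_mul_of_nonneg_left hr d0
  have e₄ := mul_le_mul_of_nonneg_left hq x0.le
  have hj : 8 / 27 < (1 - (x + d)) * z := by
    rw [hd] at e₃ ⊢
    linarith
  have hk : 8 / 27 < (x + d) * q := by
    rw [hd]
    linarith
  have xy : 0 ≤ 1 - x * y := by
    have := mul_nonneg x0.le y1'
    linarith
  have hl : 8 / 27 < (1 - q) * (1 - z) := by
    have f₁ := mul_le_mul_of_nonneg_left hr xy
    have f₂ := mul_le_mul_of_nonneg_left hq (mul_nonneg x0.le z0.le)
    have f₃ : 0 ≤ (y + z - y * z) * p := by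
      have := mul_nonneg y1' z1'
      refine mul_nonneg ?_ hp
      have := mul_nonneg y0.le z1'
      linarith
    linarith
  have xd : x + d ≤ 1 := by
    by_contra! hc
    have := mul_nonpos_of_nonpos_of_nonneg (sub_nonpos.2 hc.le) z0.le
    linarith
  exact plane_product_false' (by linarith) xd (by linarith) q1.le z0.le z1.le hk hl hj

theorem false_of_le_of_le (h : ZeroData x y z τ s p q r) (hτ : 0 ≤ τ) (hs : 0 ≤ s) (hp : 0 ≤ p)
    (hq : y ≤ q) (hr : z ≤ r) (hr1 : r < 1) : False := by
  rcases le_total (s * x) (τ * (1 - x)) with hc | hc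
  · exact h.false_of_shear hτ hs hp hq hr hc
  · exact (h.swap (by linarith [h.y_pos]) hr1).false_of_shear hs hτ hp hr hq (by linarith)

theorem false_of_balanced (h : ZeroData x y z τ s p q r) (hτ : 0 ≤ τ) (hs : 0 ≤ s) (hpx : x ≤ p)
    (hp : 1 - x ≤ p) (hq : 0 ≤ q) (hr : 0 ≤ r) (hx : x ≤ 1 / 2) : False := by
  obtain ⟨x0, x1, y0, y1, z0, z1, p1, q1, hr1, -, dk, dj, di, dl⟩ := h
  have y1' : 0 < 1 - y := by linarith
  have z1' : 0 < 1 - z := by linarith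
  have x1' : 0 < 1 - x := by linarith
  have p0 : 0 < p := by linarith
  have hyz : 0 ≤ y + z - y * z := by
    have := mul_nonneg y0.le z1'.le
    linarith
  have hxy : 0 ≤ 1 - x * y := by
    have := mul_nonneg x0.le y1'.le
    linarith
  have hxz : 0 ≤ 1 - (1 - x) * z := by
    have := mul_nonneg x1'.le z1'.le
    linarith
  have hj : 8 / 27 < (1 - x) * z := by
    rcases le_total r (1 - z) with hc | hc
    · have e₁ : 0 ≤ τ * (p + (1 - x) * r) := by positivity
      have e₂ : 0 ≤ s * (p * (1 - z) - x * r) := by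
        refine mul_nonneg hs ?_
        linarith [mul_le_mul_of_nonneg_right hpx z1'.le, mul_le_mul_of_nonneg_left hc x0.le]
      linarith
    · linarith [mul_le_mul_of_nonneg_left hpx hyz, mul_le_mul_of_nonneg_left hc hxy,
        mul_nonneg hxz hq]
  have hk : 8 / 27 < x * y := by
    rcases le_total q (1 - y) with hc | hc
    · have e₁ : 0 ≤ s * (p + x * q) := by positivity
      have e₂ : 0 ≤ τ * ((1 - y) * p - (1 - x) * q) := by
        refine mul_nonneg hτ ?_
        linarith [mul_le_mul_of_nonneg_left hp y1'.le, mul_le_mul_of_nonneg_left hc x1'.le]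
      linarith
    · linarith [mul_le_mul_of_nonneg_left hp hyz, mul_le_mul_of_nonneg_left hc hxz,
        mul_nonneg hxy hr]
  have hi : (1 - y) * (1 - z) ≤ 8 / 27 := by
    by_contra! hc
    exact plane_product_false' x0.le x1.le y0.le y1.le z0.le z1.le hk hc hj
  have hS : p * (8 / 27 - (1 - y) * (1 - z)) < q * ((1 - x) * z - 8 / 27) +
      r * (x * y - 8 / 27) := by
    linarith [mul_lt_mul_of_pos_left di p0, mul_le_mul_of_nonneg_left dj.le hq,
      mul_le_mul_of_nonneg_left dk.le hr]
  have hL : 0 ≤ (1 - x) * (8 / 27 - (1 - y) * (1 - z)) := mul_nonneg x1'.le (by linarith)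
  have hS' : (1 - x) * (8 / 27 - (1 - y) * (1 - z)) < q * ((1 - x) * z - 8 / 27) +
      r * (x * y - 8 / 27) := by
    linarith [mul_le_mul_of_nonneg_right hp (sub_nonneg.2 hi)]
  have hT : q * (1 - (1 - x) * z) + r * (1 - x * y) <
      19 / 27 - (1 - x) + (1 - x) * ((1 - y) * (1 - z)) := by
    linarith [mul_le_mul_of_nonneg_left hp hyz]
  have hK : 0 < 19 / 27 - (1 - x) + (1 - x) * ((1 - y) * (1 - z)) :=
    lt_of_le_of_lt (by positivity) hT
  have hx4 := four_mul_one_sub_le x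
  have hj' : (1 - x) * (x * z + (1 - y) * (1 - z)) ≤ 8 / 27 := by
    refine le_of_mul_le_mul_left ?_ x0
    have e₁ := mul_nonneg z0.le (mul_nonneg x0.le (by linarith : 0 ≤ 8 / 27 - x * (1 - x)))
    have e₂ := mul_nonneg z1'.le (by linarith : 0 ≤ 8 / 27 - x * (1 - x))
    have e₃ := mul_le_mul_of_nonneg_left hk.le (mul_nonneg x1'.le z1'.le)
    linarith
  have hk' : x * x * y + (1 - x) * ((1 - y) * (1 - z)) ≤ 8 / 27 := by
    have e₁ := mul_le_mul_of_nonneg_left hj.le y1'.le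
    have e₂ : x * x * y + (1 - y) * (19 / 27 - x) ≤ 8 / 27 := by
      rcases le_total (x * x) (19 / 27 - x) with hc | hc
      · refine le_of_mul_le_mul_left ?_ x0
        have f₁ := mul_nonneg (sub_nonneg.2 hc) (sub_nonneg.2 hk.le)
        nlinarith
      · have f₁ := mul_nonneg (sub_nonneg.2 hc) y1'.le
        have f₂ := mul_nonneg x0.le (sub_nonneg.2 hx)
        linarith
    linarith
  have hjK : ((1 - x) * z - 8 / 27) * (19 / 27 - (1 - x) + (1 - x) * ((1 - y) * (1 - z))) ≤
      (1 - (1 - x) * z) * ((1 - x) * (8 / 27 - (1 - y) * (1 - z))) := by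
    linarith
  have hkK : (x * y - 8 / 27) * (19 / 27 - (1 - x) + (1 - x) * ((1 - y) * (1 - z))) ≤
      (1 - x * y) * ((1 - x) * (8 / 27 - (1 - y) * (1 - z))) := by
    linarith
  linarith [mul_lt_mul_of_pos_right hS' hK, mul_le_mul_of_nonneg_left hT.le hL,
    mul_le_mul_of_nonneg_left hjK hq, mul_le_mul_of_nonneg_left hkK hr]

theorem false_of_le_left (h : ZeroData x y z τ s p q r) (hτ : 0 ≤ τ) (hs : 0 ≤ s) (hpx : x ≤ p)
    (hp : 1 - x ≤ p) (hq : 0 ≤ q) (hr : 0 ≤ r) (hr1 : r < 1) : False := by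
  rcases le_total x (1 / 2) with hx | hx
  · exact h.false_of_balanced hτ hs hpx hp hq hr hx
  · exact (h.swap (by linarith) hr1).false_of_balanced hs hτ hp (by linarith) hr hq (by linarith)

theorem false_of_one_sub_le (h : ZeroData x y z τ s p q r) (hτ : 0 ≤ τ) (hs : 0 ≤ s)
    (hp : 1 - x ≤ p) (hq : y ≤ q) (hr : 0 ≤ r) : False := by
  obtain ⟨x0, x1, y0, y1, z0, z1, p1, q1, hr1, hτs, dk, dj, di, dl⟩ := h
  have y1' : 0 < 1 - y := by linarith
  have z1' : 0 < 1 - z := by linarith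
  have x1' : 0 < 1 - x := by linarith
  have p0 : 0 < p := by linarith
  have q0 : 0 < q := by linarith
  obtain ⟨T, rfl⟩ : ∃ T, s = 1 - T := ⟨1 - s, by ring⟩
  have hyz : 0 ≤ y + z - y * z := by
    have := mul_nonneg y0.le z1'.le
    linarith
  have hxy : 0 ≤ 1 - x * y := by
    have := mul_nonneg x0.le y1'.le
    linarith
  have T0 : 0 ≤ T := by linarith
  obtain ⟨g, rfl⟩ : ∃ g, q = 1 - y + g := ⟨q - (1 - y), by ring⟩
  have h₁ : 8 / 27 * (1 - x * T) <
      (1 - y) * (1 - x * T - 8 / 27) + (1 - x) * T * τ * g := by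
    have e₁ := mul_le_mul_of_nonneg_left dl.le hs
    have e₂ := mul_le_mul_of_nonneg_left di.le (mul_nonneg x1'.le T0)
    have e₃ := mul_lt_mul_of_pos_left dj y1'
    have e₄ : 0 ≤ (1 - T) * r * ((1 - x) * τ * (1 - y) + (1 - x) * (1 - T)) := by positivity
    have e₅ := mul_le_mul_of_nonneg_left hp (by positivity : 0 ≤ 1 - T + (1 - y) * τ)
    have e₆ : 0 ≤ x + (1 - x) * (1 - z) * (1 - T) := by positivity
    have e₇ := mul_nonneg hs (mul_nonneg (sub_nonneg.2 hq) e₆)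
    have e₈ : 0 ≤ (1 - T) * (y * ((1 - x) * (1 - z) * (1 - T)) +
      (1 - x) * (1 - y) * (1 - z) + (1 - y) * τ * (1 - x)) := by positivity
    linarith
  have h₂ : 8 / 27 < y * (x * T) + τ * (1 - x) * g := by
    have e₁ := mul_le_mul_of_nonneg_left hp (by positivity : 0 ≤ τ * (1 - y) + (1 - T))
    have e₂ := mul_nonneg hs (mul_nonneg x0.le (sub_nonneg.2 hq))
    have e₃ := mul_nonneg hs x1'.le
    linarith
  have hm4 := four_mul_one_sub_le (x * T)
  rcases le_total g 0 with hg | hg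
  · have e₁ := mul_nonpos_of_nonneg_of_nonpos (by positivity : 0 ≤ τ * (1 - x)) hg
    have e₂ := mul_nonpos_of_nonneg_of_nonpos (by positivity : 0 ≤ (1 - x) * T * τ) hg
    have e₃ : 0 < 1 - x * T - 8 / 27 := by
      by_contra! hc
      have f₁ := mul_nonpos_of_nonneg_of_nonpos y1'.le hc
      have f₂ := mul_le_mul_of_nonneg_right x1.le T0
      linarith
    have e₄ : 0 ≤ x * T := by positivity
    linarith [mul_le_mul_of_nonneg_right h₂.le e₃.le, mul_le_mul_of_nonneg_right h₁.le e₄,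
      mul_lt_mul_of_pos_right (show 8 / 27 < y * (x * T) by linarith) e₃,
      mul_nonpos_of_nonneg_of_nonpos e₄ e₂]
  · have h₃ : 8 / 27 < x * (y - g) := by
      linarith [mul_le_mul_of_nonneg_left hp hyz, mul_nonneg hxy hr,
        mul_nonneg (mul_nonneg x1'.le z1'.le) hg]
    have h₄ : x * g < x - 16 / 27 := by
      linarith [mul_le_mul_of_nonneg_left hq x0.le]
    have h₅ : (1 - x) * (x - 16 / 27) ≤ 121 / 1728 * (x * x) := by
      linarith [mul_self_nonneg (43 / 27 * x - 32 / 27)]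
    have h₆ := mul_lt_mul_of_pos_left h₄ x1'
    have hX : 0 ≤ (1 - x) * T * g := by positivity
    have h₇ := mul_le_mul_of_nonneg_left (show τ ≤ T by linarith) hX
    have T1 : T ≤ 1 := by linarith
    rcases le_total (1 - x * T) (8 / 27) with hY | hY
    · have e₁ : (1 - x) * g < 121 / 1728 := by
        refine lt_of_mul_lt_mul_left ?_ x0.le
        linarith [mul_nonneg x0.le x1'.le]
      have e₂ : 8 / 27 ≤ 1 - y := by
        have : x * (8 / 27) < x * (1 - y) := by
          linarith [mul_le_mul_of_nonneg_left hq x0.le]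
        exact (lt_of_mul_lt_mul_left this x0.le).le
      have e₃ := mul_le_mul_of_nonneg_right e₂ (sub_nonneg.2 hY)
      have e₄ : (1 - x) * T * g * T ≤ (1 - x) * g := by
        have := mul_le_one₀ T1 T0 T1
        have := mul_le_mul_of_nonneg_left this (mul_nonneg x1'.le hg)
        linarith
      linarith
    · obtain ⟨m, hm⟩ : ∃ m, m = x * T := ⟨_, rfl⟩
      have m0 : 0 ≤ m := by rw [hm]; positivity
      rw [← hm] at h₁ h₂ hY
      have Y0 : 0 ≤ 1 - m - 8 / 27 := by linarith
      have e₁ := mul_le_mul_of_nonneg_right h₁.le m0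
      have e₂ := mul_le_mul_of_nonneg_right h₂.le Y0
      have e₃ := mul_le_mul_of_nonneg_left (show τ ≤ T by linarith) (mul_nonneg x1'.le hg)
      have e₄ := mul_le_mul_of_nonneg_right e₃ (by positivity : 0 ≤ T * m + (1 - m - 8 / 27))
      have e₅ := mul_le_mul_of_nonneg_left (mul_le_mul_of_nonneg_right T1 m0)
        (by positivity : 0 ≤ (1 - x) * g * T)
      have e₆ : 8 / 27 - m + m * m ≤ (1 - x) * g * T := by linarith
      have e₇ := mul_le_mul_of_nonneg_left e₆ (mul_nonneg x0.le x0.le)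
      have e₈ : x * x * ((1 - x) * g * T) ≤ m * (121 / 1728 * (x * x)) := by
        have := mul_le_mul_of_nonneg_left (h₆.le.trans h₅) m0
        rw [hm] at this ⊢
        linarith
      have e₉ : 0 < 8 / 27 - m + m * m - 121 / 1728 * m := by
        linarith [mul_self_nonneg (m - 1849 / 3456)]
      linarith [mul_pos (mul_pos x0 x0) e₉]

end ZeroData

/-- A bad lattice generated by three vectors of sum zero together with a fourth vector `e l`, where
the four vectors attain their norm `1` in different columns. -/
structure IsZeroBase (e : Fin 4 → Fin 4 → ℝ) (l : Fin 4) : Prop where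
  bad : ∀ i j k, [i, j, k, l].Nodup → IsBad (e i) (e j) (e l)
  sum_eq : ∀ i j k p, [i, j, k, l].Nodup → e i p + e j p + e k p = 0
  diag : ∀ p, e p p = 1
  abs_lt : ∀ i p, i ≠ p → |e i p| < 1

namespace IsZeroBase

open IsHalfBase (nodup_swap)

variable {e : Fin 4 → Fin 4 → ℝ} {i j k l : Fin 4}

theorem bounds (h : IsZeroBase e l) (hij : i ≠ j) : -1 < e i j ∧ e i j < 1 :=
  _root_.abs_lt.1 (h.abs_lt i j hij)

theorem add_eq (h : IsZeroBase e l) (hd : [i, j, k, l].Nodup) : e j i + e k i = -1 := by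
  have := h.sum_eq i j k i hd
  rw [h.diag] at this
  linarith

theorem neg (h : IsZeroBase e l) (hd : [i, j, k, l].Nodup) (p : Fin 4) (hp : p ≠ i) (hpl : p ≠ l) :
    e p i < 0 := by
  obtain ⟨-, -, e₁, e₂, e₃, e₄, e₅, e₆⟩ := nodup_swap hd
  have := h.add_eq hd
  have h₁ := h.bounds e₁.symm
  have h₂ := h.bounds e₂.symm
  rcases IsSuperbase.cover hd p with rfl | rfl | rfl | rfl
  · exact absurd rfl hp
  · linarith
  · linarith
  · exact absurd rfl hpl

theorem zeroData (h : IsZeroBase e l) (hd : [i, j, k, l].Nodup) :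
    ZeroData (-e j i) (-e i j) (-e i k) (e j l) (e k l) (e l i) (e l j) (e l k) := by
  obtain ⟨hd₁, hd₂, e₁, e₂, e₃, e₄, e₅, e₆⟩ := nodup_swap hd
  have si := h.add_eq hd
  have sj := h.add_eq hd₁
  have sk := h.add_eq (nodup_swap hd₂).1
  have sl := h.sum_eq i j k l hd
  have hjk : e j k = -1 - e i k := by linarith
  have hil : e i l = -e j l - e k l := by linarith
  have m := (h.bad i j k hd).minor_lt
  have h₁ := _root_.abs_lt.1 (m i j l)
  have h₂ := _root_.abs_lt.1 (m i k l)
  have h₃ := _root_.abs_lt.1 (m j k l)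
  have h₄ := _root_.abs_lt.1 (m i j k)
  simp only [minor, h.diag, hjk, hil] at h₁ h₂ h₃ h₄
  constructor
  · linarith [h.bounds e₂.symm]
  · linarith [h.bounds e₁.symm]
  · linarith [h.bounds e₄.symm]
  · linarith [h.bounds e₁]
  · linarith [h.bounds e₄]
  · linarith [h.bounds e₂]
  · linarith [h.bounds e₃.symm]
  · linarith [h.bounds e₅.symm]
  · linarith [h.bounds e₆.symm]
  · linarith [h.bounds e₃]
  · linarith
  · linarith
  · linarith
  · linarith

theorem negate (h : IsZeroBase e l) :
    IsZeroBase (fun i p => if i = l ↔ p = l then e i p else -e i p) l := by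
  constructor
  · intro i j k hd
    obtain ⟨-, -, e₁, e₂, e₃, e₄, e₅, e₆⟩ := nodup_swap hd
    have hb := ((h.bad i j k hd).of_unimodular 1 0 0 0 1 0 0 0 (-1) (by norm_num)
      (x' := e i) (y' := e j) (z' := fun p => -e l p)
      (fun p => by push_cast; ring) (fun p => by push_cast; ring)
      (fun p => by push_cast; ring)).flip (fun p => if p = l then -1 else 1)
      (fun p => by split_ifs <;> norm_num)
    have hf : ∀ m, m ≠ l → (fun p => if m = l ↔ p = l then e m p else -e m p) =
        fun p => (if p = l then -1 else 1) * e m p := by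
      intro m hm
      funext p
      by_cases hp : p = l <;> simp [hp, hm]
    have hl : (fun p => if l = l ↔ p = l then e l p else -e l p) =
        fun p => (if p = l then -1 else 1) * -e l p := by
      funext p
      by_cases hp : p = l <;> simp [hp]
    rw [hf i e₃, hf j e₅, hl]
    exact hb
  · intro i j k p hd
    obtain ⟨-, -, e₁, e₂, e₃, e₄, e₅, e₆⟩ := nodup_swap hd
    have := h.sum_eq i j k p hd
    by_cases hp : p = l
    · simp only [e₃, e₅, e₆, hp, iff_true, if_false] at this ⊢
      linarith
    · simpa only [e₃, e₅, e₆, hp, iff_false, if_true] using this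
  · intro p
    simpa using h.diag p
  · intro i p hip
    have := h.abs_lt i p hip
    split_ifs
    · exact this
    · rwa [abs_neg]

theorem pos_cond (h : IsZeroBase e l) (hd : [i, j, k, l].Nodup) (hi : 0 < e i l) :
    e l i ≤ 0 ∨ 1 + e i j ≤ e l j ∨ 1 + e i k ≤ e l k := by
  obtain ⟨hd₁, hd₂, e₁, e₂, e₃, e₄, e₅, e₆⟩ := nodup_swap hd
  obtain ⟨p, hp⟩ := (h.bad i j k hd).adm (-1) 0 1 (by norm_num)
  push_cast at hp
  have n₁ := h.neg hd₁ i e₁ e₃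
  have n₂ := h.neg (nodup_swap hd₂).1 i e₂ e₃
  rcases IsSuperbase.cover hd p with rfl | rfl | rfl | rfl
  · left
    rw [h.diag] at hp
    rcases le_abs.1 hp with hp | hp <;> linarith [h.bounds e₃.symm]
  · right; left
    rcases le_abs.1 hp with hp | hp <;> linarith [h.bounds e₅.symm]
  · right; right
    rcases le_abs.1 hp with hp | hp <;> linarith [h.bounds e₆.symm]
  · rw [h.diag] at hp
    rcases le_abs.1 hp with hp | hp <;> linarith [h.bounds e₃]

theorem neg_cond (h : IsZeroBase e l) (hd : [i, j, k, l].Nodup) (hi : e i l < 0) :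
    0 ≤ e l i ∨ e l j ≤ -1 - e i j ∨ e l k ≤ -1 - e i k := by
  obtain ⟨-, -, e₁, e₂, e₃, e₄, e₅, e₆⟩ := nodup_swap hd
  have := h.negate.pos_cond hd
  simp only [e₃, e₅, e₆, iff_false, iff_true, not_true_eq_false, if_true, if_false] at this
  rcases this (by linarith) with h | h | h
  · left; linarith
  · right; left; linarith
  · right; right; linarith

theorem false_of_zero (h : IsZeroBase e l) (hd : [i, j, k, l].Nodup) (hj : e j l = 0)
    (hk : e k l = 0) : False := by
  have := h.zeroData hd
  rw [hj, hk] at this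
  exact this.false_of_zero

theorem false_of_nonpos (h : IsZeroBase e l) (hd : [i, j, k, l].Nodup) (hi : e i l ≤ 0)
    (hj : e j l ≤ 0) (hui : 0 ≤ e l i) (huj : 0 ≤ e l j) (huk : e l k ≤ 0) : False :=
  (h.zeroData hd).false_of_nonpos hj (by linarith [h.sum_eq i j k l hd]) hui huj huk

theorem false_of_neg_le (h : IsZeroBase e l) (hd : [i, j, k, l].Nodup) (hi : e i l ≤ 0)
    (hj : e j l ≤ 0) (hui : -e j i ≤ e l i) (huj : 0 ≤ e l j) : False := by
  obtain ⟨hd₁, hd₂, e₁, e₂, e₃, e₄, e₅, e₆⟩ := nodup_swap hd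
  have hb := ((h.bad i j k hd).of_unimodular 0 (-1) (-1) 0 0 1 (-1) 0 0 (by norm_num)
    (x' := fun p => -(e l p + e j p)) (y' := e l) (z' := fun p => -e i p)
    (fun p => by push_cast; ring) (fun p => by push_cast; ring)
    (fun p => by push_cast; ring)).flip (fun p => if p = l then 1 else -1)
    (fun p => by split_ifs <;> norm_num)
  have si := h.sum_eq i j k i hd
  have sj := h.sum_eq i j k j hd
  have sk := h.sum_eq i j k k hd
  have sl := h.sum_eq i j k l hd
  rw [h.diag] at si sj sk
  have n₁ := h.neg hd₁ i e₁ e₃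
  have n₂ := h.neg hd j e₁.symm e₅
  have b := fun {i j : Fin 4} (e : i ≠ j) => h.bounds e
  refine hb.cyclic_false (i := j) (j := l) (k := i) (l := k) ?_ ?_ ?_ ?_ ?_ ?_ ?_ ?_ ?_ ?_ ?_ ?_ ?_
  all_goals simp only [e₃, e₅, e₆, if_true, if_false, h.diag]
  · linarith
  · norm_num
  · norm_num
  · refine le_abs.2 (Or.inr ?_)
    linarith
  · linarith
  · linarith
  · linarith
  · linarith [b e₁]
  · linarith
  · linarith [b e₃.symm]
  · linarith
  · linarith [b e₆]
  · linarith

theorem false_of_left_le (h : IsZeroBase e l) (hd : [i, j, k, l].Nodup) (hj : 0 ≤ e j l)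
    (hk : 0 ≤ e k l) (hui : -e k i ≤ e l i) (huj : 0 ≤ e l j) (huk : e l k ≤ 0) : False := by
  obtain ⟨hd₁, hd₂, e₁, e₂, e₃, e₄, e₅, e₆⟩ := nodup_swap hd
  have hz := h.zeroData hd
  have si := h.sum_eq i j k i hd
  have sj := h.sum_eq i j k j hd
  have sk := h.sum_eq i j k k hd
  have sl := h.sum_eq i j k l hd
  rw [h.diag] at si sj sk
  have b := fun {i j : Fin 4} (e : i ≠ j) => h.bounds e
  rcases lt_or_ge (1 + e i k) (-e l k) with hc | hc
  · rcases le_or_gt (e l j) (1 + e i j) with hq | hq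
    · exact hz.false_of_le hj hk (by linarith) huj (by linarith) (by linarith)
    · obtain ⟨p, hp⟩ := (h.bad i j k hd).adm (-1) (-2) 1 (by norm_num)
      push_cast at hp
      rcases IsSuperbase.cover hd p with rfl | rfl | rfl | rfl
      · refine hz.false_of_two_le hj hk ?_ huj (by linarith)
        rw [h.diag] at hp
        rcases le_abs.1 hp with hp | hp <;> linarith [b e₁.symm, b e₂.symm]
      · rw [h.diag] at hp
        rcases le_abs.1 hp with hp | hp <;> linarith [b e₁, b e₄.symm, b e₅.symm]
      · rcases le_abs.1 hp with hp | hp <;> linarith [b e₂, b e₄, b e₆.symm]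
      · refine hz.false_of_le_of_lt hj ?_ (by linarith) (by linarith) (by linarith)
        rw [h.diag] at hp
        rcases le_abs.1 hp with hp | hp <;> linarith [b e₅, b e₆]
  · have hb := ((h.bad i j k hd).of_unimodular 0 1 (-1) (-1) (-1) 1 1 1 0 (by norm_num)
      (x' := fun p => e j p - e l p) (y' := fun p => e l p + e k p) (z' := fun p => -e k p)
      (fun p => by push_cast; ring) (fun p => by push_cast; linarith [h.sum_eq i j k p hd])
      (fun p => by push_cast; linarith [h.sum_eq i j k p hd])).flip
      (fun p => if p = l then 1 else -1) (fun p => by split_ifs <;> norm_num)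
    refine hb.cyclic_false (i := i) (j := l) (k := k) (l := j) ?_ ?_ ?_ ?_ ?_ ?_ ?_ ?_ ?_ ?_ ?_ ?_ ?_
    all_goals simp only [e₃, e₅, e₆, if_true, if_false, h.diag]
    · linarith
    · linarith
    · norm_num
    · refine le_abs.2 (Or.inr ?_)
      linarith
    · linarith
    · linarith
    · linarith
    · linarith [b e₂.symm]
    · linarith
    · linarith
    · linarith [b e₁.symm]
    · linarith [b e₅]
    · linarith [b e₄]

theorem false_of_pos (h : IsZeroBase e l) (hd : [i, j, k, l].Nodup) (hj : 0 < e j l)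
    (hk : 0 < e k l) (hui : 0 ≤ e l i) (huj : 0 < e l j) (huk : 0 < e l k) : False := by
  obtain ⟨hd₁, hd₂, e₁, e₂, e₃, e₄, e₅, e₆⟩ := nodup_swap hd
  have hz := h.zeroData hd
  have hr := (h.bounds e₆.symm).2
  have hq : -1 < e l j := by linarith
  have hz' := hz.swap hq hr
  have si := h.add_eq hd
  have sj := h.add_eq hd₁
  have sk := h.add_eq (nodup_swap hd₂).1
  rcases h.pos_cond hd₁ hj with c | c | c
  · linarith
  · rcases h.pos_cond (nodup_swap hd₂).1 hk with d | d | d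
    · linarith
    · exact hz.false_of_le_left hj.le hk.le (by linarith) (by linarith) huj.le huk.le hr
    · exact hz.false_of_one_sub_le hj.le hk.le (by linarith) (by linarith) huk.le
  · rcases h.pos_cond (nodup_swap hd₂).1 hk with d | d | d
    · linarith
    · exact hz'.false_of_one_sub_le hk.le hj.le (by linarith) (by linarith) huj.le
    · exact hz.false_of_le_of_le hj.le hk.le hui (by linarith) (by linarith) hr

theorem false_of_nonneg (h : IsZeroBase e l) (hd : [i, j, k, l].Nodup) (hi : 0 ≤ e i l)
    (hj : 0 ≤ e j l) (hui : e l i ≤ 0) (huj : e l j ≤ 0) (huk : 0 ≤ e l k) : False := by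
  obtain ⟨-, -, e₁, e₂, e₃, e₄, e₅, e₆⟩ := nodup_swap hd
  have := h.negate.false_of_nonpos hd
  simp only [e₃, e₅, e₆, iff_false, iff_true, not_true_eq_false, if_false] at this
  exact this (by linarith) (by linarith) (by linarith) (by linarith) (by linarith)

theorem false_of_le_apply (h : IsZeroBase e l) (hd : [i, j, k, l].Nodup) (hi : 0 ≤ e i l)
    (hj : 0 ≤ e j l) (hui : e l i ≤ e j i) (huj : e l j ≤ 0) : False := by
  obtain ⟨-, -, e₁, e₂, e₃, e₄, e₅, e₆⟩ := nodup_swap hd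
  have := h.negate.false_of_neg_le hd
  simp only [e₃, e₅, iff_false, iff_true, not_true_eq_false, if_true,
    if_false] at this
  exact this (by linarith) (by linarith) (by linarith) (by linarith)

theorem false_of_left_le_apply (h : IsZeroBase e l) (hd : [i, j, k, l].Nodup) (hj : e j l ≤ 0)
    (hk : e k l ≤ 0) (hui : e l i ≤ e k i) (huj : e l j ≤ 0) (huk : 0 ≤ e l k) : False := by
  obtain ⟨-, -, e₁, e₂, e₃, e₄, e₅, e₆⟩ := nodup_swap hd
  have := h.negate.false_of_left_le hd
  simp only [e₃, e₅, e₆, iff_false, iff_true, not_true_eq_false, if_true,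
    if_false] at this
  exact this (by linarith) (by linarith) (by linarith) (by linarith) (by linarith)

theorem false_of_mixed (h : IsZeroBase e l) (hd : [i, j, k, l].Nodup) (hj : 0 ≤ e j l)
    (hk : 0 ≤ e k l) (hui : 0 ≤ e l i) (huj : e l j ≤ 0) : False := by
  obtain ⟨hd₁, hd₂, e₁, e₂, e₃, e₄, e₅, e₆⟩ := nodup_swap hd
  have sl := h.sum_eq i j k l hd
  have si := h.add_eq hd
  rcases le_or_gt (e l k) 0 with huk | huk
  · exact h.false_of_nonneg (nodup_swap hd₁).2.1 hj hk huj huk hui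
  · rcases hk.eq_or_lt with hk0 | hk0
    · exact h.false_of_nonpos hd₂ (by linarith) hk0.ge hui huk.le huj
    · rcases h.pos_cond (nodup_swap hd₂).1 hk0 with c | c | c
      · linarith
      · exact h.false_of_left_le hd₂ hk hj (by linarith) huk.le huj
      · linarith [h.bounds e₄.symm]

theorem false_of_neg (h : IsZeroBase e l) (hd : [i, j, k, l].Nodup) (hj : 0 ≤ e j l)
    (hk : 0 ≤ e k l) (hui : e l i < 0) (huj : e l j ≤ -1 - e i j) : False := by
  obtain ⟨hd₁, hd₂, e₁, e₂, e₃, e₄, e₅, e₆⟩ := nodup_swap hd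
  have sj := h.add_eq hd₁
  have b := h.bounds e₁
  have sl := h.sum_eq i j k l hd
  rcases le_or_gt (e l k) 0 with huk | huk
  · exact h.false_of_le_apply (nodup_swap hd₁).2.1 hj hk (by linarith) huk
  · rcases hk.eq_or_lt with hk0 | hk0
    · exact h.false_of_left_le_apply hd₁ (by linarith) hk0.ge (by linarith) hui.le huk.le
    · rcases h.pos_cond (nodup_swap hd₂).1 hk0 with c | c | c
      · linarith
      · linarith [h.bounds e₂.symm]
      · linarith [h.bounds e₄.symm]

theorem false_of_eq_zero (h : IsZeroBase e l) (hd : [i, j, k, l].Nodup) (hj : e j l = 0)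
    (hk : 0 ≤ e k l) (hui : 0 ≤ e l i) (huj : 0 ≤ e l j) (huk : 0 < e l k) : False := by
  obtain ⟨hd₁, hd₂, e₁, e₂, e₃, e₄, e₅, e₆⟩ := nodup_swap hd
  have si := h.add_eq hd
  have sj := h.add_eq hd₁
  have sl := h.sum_eq i j k l hd
  rcases hk.eq_or_lt with hk0 | hk0
  · exact h.false_of_zero hd hj hk0.symm
  · rcases h.pos_cond (nodup_swap hd₂).1 hk0 with c | c | c
    · linarith
    · exact h.false_of_neg_le hd (by linarith) hj.le (by linarith) huj
    · exact h.false_of_neg_le hd₁ hj.le (by linarith) (by linarith) hui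

theorem false_of_two_nonneg (h : IsZeroBase e l) (hd : [i, j, k, l].Nodup) (hj : 0 ≤ e j l)
    (hk : 0 ≤ e k l) : False := by
  obtain ⟨hd₁, hd₂, -⟩ := nodup_swap hd
  have sl := h.sum_eq i j k l hd
  rcases le_or_gt 0 (e l i) with hui | hui
  · rcases le_or_gt (e l j) 0 with huj | huj
    · exact h.false_of_mixed hd hj hk hui huj
    rcases le_or_gt (e l k) 0 with huk | huk
    · exact h.false_of_mixed hd₂ hk hj hui huk
    rcases hj.eq_or_lt with hj0 | hj0
    · exact h.false_of_eq_zero hd hj0.symm hk hui huj.le huk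
    rcases hk.eq_or_lt with hk0 | hk0
    · exact h.false_of_eq_zero hd₂ hk0.symm hj hui huk.le huj
    exact h.false_of_pos hd hj0 hk0 hui huj huk
  · rcases (show e i l ≤ 0 by linarith).eq_or_lt with hi0 | hi0
    · exact h.false_of_zero hd (by linarith) (by linarith)
    rcases h.neg_cond hd hi0 with c | c | c
    · linarith
    · exact h.false_of_neg hd hj hk hui c
    · exact h.false_of_neg hd₂ hk hj hui c

theorem false_of_two_nonpos (h : IsZeroBase e l) (hd : [i, j, k, l].Nodup) (hj : e j l ≤ 0)
    (hk : e k l ≤ 0) : False := by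
  obtain ⟨-, -, e₁, e₂, e₃, e₄, e₅, e₆⟩ := nodup_swap hd
  have := h.negate.false_of_two_nonneg hd
  simp only [e₅, e₆, iff_true, if_false] at this
  exact this (by linarith) (by linarith)

protected theorem false (h : IsZeroBase e l) (hd : [i, j, k, l].Nodup) : False := by
  obtain ⟨hd₁, hd₂, -⟩ := nodup_swap hd
  rcases le_total 0 (e j l) with hj | hj <;> rcases le_total 0 (e k l) with hk | hk
  · exact h.false_of_two_nonneg hd hj hk
  · rcases le_total 0 (e i l) with hi | hi
    · exact h.false_of_two_nonneg (nodup_swap hd₂).1 hi hj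
    · exact h.false_of_two_nonpos hd₁ hi hk
  · rcases le_total 0 (e i l) with hi | hi
    · exact h.false_of_two_nonneg hd₁ hi hk
    · exact h.false_of_two_nonpos (nodup_swap hd₂).1 hi hj
  · exact h.false_of_two_nonpos hd hj hk

end IsZeroBase

/-- The integer combination of three vectors with coefficients `v`. -/
def latticeVector (x y z : Fin 4 → ℝ) (v : Fin 3 → ℤ) (p : Fin 4) : ℝ :=
  v 0 * x p + v 1 * y p + v 2 * z p

/-- A bad lattice with four vectors which attain their norm `1` in different columns. -/
structure IsDiagonal (x y z : Fin 4 → ℝ) (c : Fin 4 → Fin 3 → ℤ) : Prop where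
  bad : IsBad x y z
  diag : ∀ p, latticeVector x y z (c p) p = 1
  abs_lt : ∀ i p, i ≠ p → |latticeVector x y z (c i) p| < 1

section

variable {x y z : Fin 4 → ℝ}

@[simp]
theorem latticeVector_add (v w : Fin 3 → ℤ) (p : Fin 4) :
    latticeVector x y z (v + w) p = latticeVector x y z v p + latticeVector x y z w p := by
  simp only [latticeVector, Pi.add_apply]; push_cast; ring

@[simp]
theorem latticeVector_neg (v : Fin 3 → ℤ) (p : Fin 4) :
    latticeVector x y z (-v) p = -latticeVector x y z v p := by
  simp only [latticeVector, Pi.neg_apply]; push_cast; ring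

@[simp]
theorem latticeVector_sub (v w : Fin 3 → ℤ) (p : Fin 4) :
    latticeVector x y z (v - w) p = latticeVector x y z v p - latticeVector x y z w p := by
  rw [sub_eq_add_neg, latticeVector_add, latticeVector_neg, sub_eq_add_neg]

@[simp]
theorem latticeVector_smul (n : ℤ) (v : Fin 3 → ℤ) (p : Fin 4) :
    latticeVector x y z (n • v) p = n * latticeVector x y z v p := by
  simp only [latticeVector, Pi.smul_apply, smul_eq_mul]; push_cast; ring

theorem IsBad.eq_zero (h : IsBad x y z) {v : Fin 3 → ℤ}
    (hv : ∀ p, |latticeVector x y z v p| < 1) : v = 0 := by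
  by_contra h0
  have : v 0 ≠ 0 ∨ v 1 ≠ 0 ∨ v 2 ≠ 0 := by
    by_contra! hc
    refine h0 (funext fun m => ?_)
    fin_cases m
    · exact hc.1
    · exact hc.2.1
    · exact hc.2.2
  obtain ⟨p, hp⟩ := h.adm _ _ _ this
  exact absurd (hv p) (not_lt.2 hp)

end

namespace IsDiagonal

open IsHalfBase (nodup_swap)

variable {x y z : Fin 4 → ℝ} {c : Fin 4 → Fin 3 → ℤ} {i j k l : Fin 4}

theorem abs_le (h : IsDiagonal x y z c) (i p : Fin 4) : |latticeVector x y z (c i) p| ≤ 1 := by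
  by_cases hip : i = p
  · rw [hip, h.diag, abs_one]
  · exact (h.abs_lt i p hip).le

theorem eq_zero_of_small (h : IsDiagonal x y z c) (hd : [i, j, k, l].Nodup) {v : Fin 3 → ℤ}
    {a b d : ℝ} (hv : ∀ p, latticeVector x y z v p = a * latticeVector x y z (c i) p +
      b * latticeVector x y z (c j) p + d * latticeVector x y z (c k) p)
    (ha : |a| < 1) (hb : |b| < 1) (hc : |d| < 1) (hs : |a| + |b| + |d| ≤ 1) : v = 0 := by
  obtain ⟨-, -, e₁, e₂, e₃, e₄, e₅, e₆⟩ := nodup_swap hd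
  refine h.bad.eq_zero fun p => ?_
  rw [hv]
  have key : ∀ {a b d f g e : ℝ}, |a| < 1 → |a| + |b| + |d| ≤ 1 → |f| ≤ 1 → |g| < 1 → |e| < 1 →
      |a * f + b * g + d * e| < 1 := by
    intro a b d f g e ha hs hf hg he
    have h₁ : |a * f + b * g + d * e| ≤ |a| * |f| + |b| * |g| + |d| * |e| := by
      rw [← abs_mul, ← abs_mul, ← abs_mul]
      exact abs_add_three _ _ _
    have h₂ := mul_le_mul_of_nonneg_left hf (abs_nonneg a)
    rcases eq_or_ne b 0 with hb | hb
    · rcases eq_or_ne d 0 with hd | hd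
      · subst hb hd
        simp only [abs_zero, zero_mul, add_zero] at h₁ hs ⊢
        linarith
      · have h₃ := mul_lt_mul_of_pos_left he (abs_pos.2 hd)
        have h₄ := mul_le_mul_of_nonneg_left hg.le (abs_nonneg b)
        linarith
    · have h₃ := mul_lt_mul_of_pos_left hg (abs_pos.2 hb)
      have h₄ := mul_le_mul_of_nonneg_left he.le (abs_nonneg d)
      linarith
  have hp := h.abs_le i p
  rcases IsSuperbase.cover hd p with rfl | rfl | rfl | rfl
  · exact key ha hs hp (h.abs_lt _ _ e₁.symm) (h.abs_lt _ _ e₂.symm)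
  · have := key (f := latticeVector x y z (c p) p) hb (by linarith : |b| + |a| + |d| ≤ 1)
      (h.abs_le p p) (h.abs_lt _ _ e₁) (h.abs_lt _ _ e₄.symm)
    rwa [add_comm (a * _)]
  · have := key (f := latticeVector x y z (c p) p) hc (by linarith : |d| + |a| + |b| ≤ 1)
      (h.abs_le p p) (h.abs_lt _ _ e₂) (h.abs_lt _ _ e₄)
    rwa [add_comm, ← add_assoc]
  · exact key ha hs hp (h.abs_lt _ _ e₅) (h.abs_lt _ _ e₆)

/-- A lattice vector in the rational span of two of the vectors is an integer combination. -/
theorem combination (h : IsDiagonal x y z c) (hd : [i, j, k, l].Nodup) {v : Fin 3 → ℤ}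
    {N n₁ n₂ : ℤ} (hN : N ≠ 0) (hv : N • v = n₁ • c i + n₂ • c j) :
    ∃ a b : ℤ, v = a • c i + b • c j := by
  have hN' : (N : ℝ) ≠ 0 := by exact_mod_cast hN
  have r₁ := abs_sub_round ((n₁ : ℝ) / N)
  have r₂ := abs_sub_round ((n₂ : ℝ) / N)
  refine ⟨round ((n₁ : ℝ) / N), round ((n₂ : ℝ) / N), sub_eq_zero.1 (h.eq_zero_of_small hd
    (a := n₁ / N - round ((n₁ : ℝ) / N)) (b := n₂ / N - round ((n₂ : ℝ) / N)) (d := 0)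
    (fun p => ?_) (by linarith) (by linarith) (by simp) (by rw [abs_zero]; linarith))⟩
  have := congrArg (fun w => latticeVector x y z w p) hv
  simp only [latticeVector_add, latticeVector_sub, latticeVector_smul] at this ⊢
  field_simp
  linarith

/-- A lattice vector in the rational span of three of the vectors is an integer combination of
them, or half of a combination with odd coefficients. -/
theorem combination_or_half (h : IsDiagonal x y z c) (hd : [i, j, k, l].Nodup) {v : Fin 3 → ℤ}
    {N n₁ n₂ n₃ : ℤ} (hN : N ≠ 0) (hv : N • v = n₁ • c i + n₂ • c j + n₃ • c k) :
    (∃ a b d : ℤ, v = a • c i + b • c j + d • c k) ∨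
      ∃ a b d : ℤ, Odd a ∧ Odd b ∧ Odd d ∧ (2 : ℤ) • v = a • c i + b • c j + d • c k := by
  have hN' : (N : ℝ) ≠ 0 := by exact_mod_cast hN
  have hL : ∀ p, latticeVector x y z v p = n₁ / N * latticeVector x y z (c i) p +
      n₂ / N * latticeVector x y z (c j) p + n₃ / N * latticeVector x y z (c k) p := by
    intro p
    have := congrArg (fun w => latticeVector x y z w p) hv
    simp only [latticeVector_add, latticeVector_smul] at this
    field_simp
    linarith
  have hr : ∀ n : ℤ, ∃ m e : ℤ, ∃ r : ℝ, (n : ℝ) / N = m + r ∧ |r| ≤ 1 / 2 ∧ Odd e ∧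
      |2 * r - e| = 1 - 2 * |r| := by
    intro n
    have hr := abs_sub_round ((n : ℝ) / N)
    rcases le_total 0 ((n : ℝ) / N - round ((n : ℝ) / N)) with h0 | h0
    · refine ⟨round ((n : ℝ) / N), 1, (n : ℝ) / N - round ((n : ℝ) / N), by ring, hr, odd_one, ?_⟩
      rw [abs_of_nonneg h0] at hr ⊢
      rw [abs_of_nonpos (by push_cast; linarith)]
      push_cast; ring
    · refine ⟨round ((n : ℝ) / N), -1, (n : ℝ) / N - round ((n : ℝ) / N), by ring, hr,
        odd_neg_one, ?_⟩
      rw [abs_of_nonpos h0] at hr ⊢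
      rw [abs_of_nonneg (by push_cast; linarith)]
      push_cast; ring
  obtain ⟨m₁, e₁, r₁, h₁, hr₁, ho₁, he₁⟩ := hr n₁
  obtain ⟨m₂, e₂, r₂, h₂, hr₂, ho₂, he₂⟩ := hr n₂
  obtain ⟨m₃, e₃, r₃, h₃, hr₃, ho₃, he₃⟩ := hr n₃
  rw [h₁, h₂, h₃] at hL
  rcases le_or_gt (|r₁| + |r₂| + |r₃|) 1 with hs | hs
  · left
    refine ⟨m₁, m₂, m₃, sub_eq_zero.1 (h.eq_zero_of_small hd (a := r₁) (b := r₂) (d := r₃)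
      (fun p => ?_) (by linarith) (by linarith) (by linarith) hs)⟩
    simp only [latticeVector_add, latticeVector_sub, latticeVector_smul, hL]
    ring
  · right
    refine ⟨2 * m₁ + e₁, 2 * m₂ + e₂, 2 * m₃ + e₃, (even_two_mul _).add_odd ho₁,
      (even_two_mul _).add_odd ho₂, (even_two_mul _).add_odd ho₃,
      sub_eq_zero.1 (h.eq_zero_of_small hd (a := 2 * r₁ - e₁) (b := 2 * r₂ - e₂)
        (d := 2 * r₃ - e₃) (fun p => ?_) ?_ ?_ ?_ ?_)⟩
    · simp only [latticeVector_add, latticeVector_sub, latticeVector_smul, hL]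
      push_cast
      ring
    all_goals linarith [abs_nonneg r₁, abs_nonneg r₂, abs_nonneg r₃]

theorem ne_two_smul (h : IsDiagonal x y z c) (i : Fin 4) (v : Fin 3 → ℤ) : c i ≠ (2 : ℤ) • v := by
  intro hv
  have hL : ∀ p, latticeVector x y z (c i) p = 2 * latticeVector x y z v p := by
    intro p
    rw [hv, latticeVector_smul]; norm_num
  have h0 : v = 0 := h.bad.eq_zero fun p => by
    have := h.abs_le i p
    rw [hL, abs_mul, abs_two] at this
    linarith
  have := h.diag i
  rw [hL, h0] at this
  simp [latticeVector] at this

theorem add_ne_two_smul (h : IsDiagonal x y z c) (hij : i ≠ j) (v : Fin 3 → ℤ) :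
    c i + c j ≠ (2 : ℤ) • v := by
  intro hv
  have hL : ∀ p, latticeVector x y z (c i) p + latticeVector x y z (c j) p =
      2 * latticeVector x y z v p := by
    intro p
    rw [← latticeVector_add, hv, latticeVector_smul]; norm_num
  have h0 : v = 0 := h.bad.eq_zero fun p => by
    have h₁ : |2 * latticeVector x y z v p| < 2 := by
      rw [← hL]
      refine (abs_add_le _ _).trans_lt ?_
      by_cases hip : i = p
      · linarith [h.abs_le i p, h.abs_lt j p (by rintro rfl; exact hij hip)]
      · linarith [h.abs_lt i p hip, h.abs_le j p]
    rw [abs_mul, abs_two] at h₁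
    linarith
  have := hL i
  rw [h0, h.diag] at this
  have h₁ := h.abs_lt j i hij.symm
  have h₂ : latticeVector x y z (c j) i = -1 := by
    simp [latticeVector] at this ⊢
    linarith
  rw [h₂] at h₁
  norm_num at h₁

theorem eq_zero_of_smul_eq (h : IsDiagonal x y z c) (hij : i ≠ j) {m n : ℤ}
    (hmn : m • c i = n • c j) : m = 0 ∧ n = 0 := by
  have hL : ∀ p, m * latticeVector x y z (c i) p = n * latticeVector x y z (c j) p := by
    intro p
    rw [← latticeVector_smul, hmn, latticeVector_smul]
  have h₁ : |(m : ℝ)| = |(n : ℝ)| * |latticeVector x y z (c j) i| := by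
    rw [← abs_mul, ← hL, h.diag, mul_one]
  have h₂ : |(n : ℝ)| = |(m : ℝ)| * |latticeVector x y z (c i) j| := by
    rw [← abs_mul, hL, h.diag, mul_one]
  have l₁ := h.abs_lt j i hij.symm
  have l₂ := h.abs_lt i j hij
  have hm : m = 0 := by
    by_contra h0
    have hm : 0 < |(m : ℝ)| := abs_pos.2 (by exact_mod_cast h0)
    have := mul_lt_mul_of_pos_left l₂ hm
    have := mul_le_mul_of_nonneg_left l₁.le (abs_nonneg (n : ℝ))
    linarith
  refine ⟨hm, ?_⟩
  rw [hm] at h₂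
  have : (n : ℝ) = 0 := abs_eq_zero.1 (by simpa using h₂)
  exact_mod_cast this

end IsDiagonal

/-- The determinant of three integer vectors. -/
def intDet (u v w : Fin 3 → ℤ) : ℤ :=
  u 0 * (v 1 * w 2 - v 2 * w 1) - u 1 * (v 0 * w 2 - v 2 * w 0) + u 2 * (v 0 * w 1 - v 1 * w 0)

theorem intDet_smul_eq (u v w t : Fin 3 → ℤ) :
    intDet u v w • t = intDet t v w • u + intDet u t w • v + intDet u v t • w := by
  funext m
  fin_cases m <;> simp [intDet] <;> ring

theorem eq_zero_of_intDet_ne_zero {u v w : Fin 3 → ℤ} (hD : intDet u v w ≠ 0) {a b d : ℤ}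
    (h : a • u + b • v + d • w = 0) : a = 0 ∧ b = 0 ∧ d = 0 := by
  have h0 := congrFun h 0
  have h1 := congrFun h 1
  have h2 := congrFun h 2
  simp only [Pi.add_apply, Pi.smul_apply, smul_eq_mul, Pi.zero_apply] at h0 h1 h2
  refine ⟨?_, ?_, ?_⟩ <;> refine (mul_eq_zero.1 ?_).resolve_right hD <;> unfold intDet
  · linear_combination (v 1 * w 2 - v 2 * w 1) * h0 - (v 0 * w 2 - v 2 * w 0) * h1 +
      (v 0 * w 1 - v 1 * w 0) * h2
  · linear_combination (w 1 * u 2 - w 2 * u 1) * h0 - (w 0 * u 2 - w 2 * u 0) * h1 +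
      (w 0 * u 1 - w 1 * u 0) * h2
  · linear_combination (u 1 * v 2 - u 2 * v 1) * h0 - (u 0 * v 2 - u 2 * v 0) * h1 +
      (u 0 * v 1 - u 1 * v 0) * h2

theorem exists_relation_of_intDet_eq_zero {u v w : Fin 3 → ℤ} (hD : intDet u v w = 0) :
    ∃ a b d : ℤ, (a ≠ 0 ∨ b ≠ 0 ∨ d ≠ 0) ∧ a • u + b • v + d • w = 0 := by
  obtain ⟨t, ht, hM⟩ := (Matrix.exists_vecMul_eq_zero_iff (M := Matrix.of ![u, v, w])).2 (by
    rw [Matrix.det_fin_three]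
    simp only [Matrix.of_apply, Matrix.cons_val]
    unfold intDet at hD
    linear_combination hD)
  refine ⟨t 0, t 1, t 2, ?_, ?_⟩
  · by_contra! hc
    refine ht (funext fun m => ?_)
    fin_cases m
    · exact hc.1
    · exact hc.2.1
    · exact hc.2.2
  · funext m
    have := congrFun hM m
    simpa [Matrix.vecMul, dotProduct, Fin.sum_univ_three] using this

theorem abs_intDet_eq_one {u v w : Fin 3 → ℤ}
    (h : ∀ t : Fin 3 → ℤ, ∃ a b d : ℤ, t = a • u + b • v + d • w) : |intDet u v w| = 1 := by
  obtain ⟨a₁, a₂, a₃, ha⟩ := h ![1, 0, 0]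
  obtain ⟨b₁, b₂, b₃, hb⟩ := h ![0, 1, 0]
  obtain ⟨d₁, d₂, d₃, hd⟩ := h ![0, 0, 1]
  have hmul : intDet ![1, 0, 0] ![0, 1, 0] ![0, 0, 1] =
      (a₁ * (b₂ * d₃ - b₃ * d₂) - a₂ * (b₁ * d₃ - b₃ * d₁) + a₃ * (b₁ * d₂ - b₂ * d₁)) *
        intDet u v w := by
    rw [ha, hb, hd]
    simp only [intDet, Pi.add_apply, Pi.smul_apply, smul_eq_mul]
    ring
  have h1 : intDet ![1, 0, 0] ![0, 1, 0] ![0, 0, 1] = 1 := by decide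
  rw [h1] at hmul
  exact Int.isUnit_iff_abs_eq.1 (IsUnit.of_mul_eq_one_right _ hmul.symm)

theorem IsBad.of_intDet {x y z : Fin 4 → ℝ} (h : IsBad x y z) {u v w : Fin 3 → ℤ}
    (hD : |intDet u v w| = 1) :
    IsBad (latticeVector x y z u) (latticeVector x y z v) (latticeVector x y z w) :=
  h.of_unimodular _ _ _ _ _ _ _ _ _ hD (fun _ => rfl) (fun _ => rfl) fun _ => rfl

namespace IsDiagonal

open IsHalfBase (nodup_swap)

variable {x y z : Fin 4 → ℝ} {c : Fin 4 → Fin 3 → ℤ} {i j k l : Fin 4}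

theorem comp (h : IsDiagonal x y z c) {s : Fin 4 → Fin 4} (hs : s.Injective) :
    IsDiagonal (x ∘ s) (y ∘ s) (z ∘ s) (c ∘ s) := by
  refine ⟨⟨fun a b d habd => ?_, fun p q r => h.bad.minor_lt (s p) (s q) (s r)⟩,
    fun p => h.diag (s p), fun i p hip => h.abs_lt _ _ (hs.ne hip)⟩
  obtain ⟨p, hp⟩ := h.bad.adm a b d habd
  obtain ⟨q, rfl⟩ := (Finite.injective_iff_surjective.1 hs) p
  exact ⟨q, hp⟩

theorem exists_reindex (h : IsDiagonal x y z c) (hd : [i, j, k, l].Nodup) :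
    ∃ x' y' z' : Fin 4 → ℝ, IsDiagonal x' y' z' ![c i, c j, c k, c l] := by
  have hs : Function.Injective ![i, j, k, l] := by
    revert i j k l; decide
  have hc : c ∘ ![i, j, k, l] = ![c i, c j, c k, c l] := by
    funext m
    fin_cases m <;> rfl
  exact ⟨_, _, _, hc ▸ h.comp hs⟩

/-- The vectors of a diagonal system after changing signs so that the diagonal is unchanged. -/
theorem signed (h : IsDiagonal x y z c) {e : Fin 4 → ℤ} (he : ∀ p, |e p| = 1) :
    (∀ p, e p * latticeVector x y z (e p • c p) p = 1) ∧
      (∀ i p, i ≠ p → |e p * latticeVector x y z (e i • c i) p| < 1) ∧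
      ∀ i j k, |intDet (c i) (c j) (c k)| = 1 →
        IsBad (fun p => e p * latticeVector x y z (e i • c i) p)
          (fun p => e p * latticeVector x y z (e j • c j) p)
          fun p => e p * latticeVector x y z (e k • c k) p := by
  have he' : ∀ p, |(e p : ℝ)| = 1 := fun p => by exact_mod_cast he p
  refine ⟨fun p => ?_, fun i p hip => ?_, fun i j k hD => ?_⟩
  · rw [latticeVector_smul, h.diag, mul_one, ← abs_mul_abs_self, he', one_mul]
  · rw [latticeVector_smul, abs_mul, abs_mul, he', he', one_mul, one_mul]
    exact h.abs_lt i p hip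
  · refine (h.bad.of_intDet (u := e i • c i) (v := e j • c j) (w := e k • c k) ?_).flip _ he'
    have : intDet (e i • c i) (e j • c j) (e k • c k) = e i * e j * e k *
        intDet (c i) (c j) (c k) := by
      simp only [intDet, Pi.smul_apply, smul_eq_mul]
      ring
    rw [this, abs_mul, abs_mul, abs_mul, he, he, he, hD]
    norm_num

theorem latticeVector_relation {e : Fin 4 → ℤ} {t : Fin 3 → ℤ} {u : Fin 4 → Fin 3 → ℤ} {a : ℤ}
    (ht : e 0 • u 0 + e 1 • u 1 + e 2 • u 2 = a • t) (p : Fin 4) :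
    latticeVector x y z (e 0 • u 0) p + latticeVector x y z (e 1 • u 1) p +
      latticeVector x y z (e 2 • u 2) p = a * latticeVector x y z t p := by
  rw [← latticeVector_add, ← latticeVector_add, ht, latticeVector_smul]

/-- Superbases. -/
theorem false_of_sum (h : IsDiagonal x y z c) (hD : |intDet (c 0) (c 1) (c 2)| = 1)
    {a b d : ℤ} (ha : |a| = 1) (hb : |b| = 1) (hd : |d| = 1)
    (hc : c 3 = a • c 0 + b • c 1 + d • c 2) : False := by
  have he : ∀ p, |(![a, b, d, -1] : Fin 4 → ℤ) p| = 1 := by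
    intro p
    fin_cases p <;> simp [ha, hb, hd]
  obtain ⟨h₁, h₂, h₃⟩ := h.signed he
  refine IsSuperbase.false (w := fun i p => (![a, b, d, -1] : Fin 4 → ℤ) p *
    latticeVector x y z ((![a, b, d, -1] : Fin 4 → ℤ) i • c i) p) ⟨h₃ 0 1 2 hD, fun p => ?_, h₁, h₂⟩
  have := latticeVector_relation (x := x) (y := y) (z := z) (e := ![a, b, d, -1]) (u := c)
    (t := c 3) (a := 1) (by simp [hc]) p
  have h3 : latticeVector x y z ((![a, b, d, -1] : Fin 4 → ℤ) 3 • c 3) p =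
    -latticeVector x y z (c 3) p := by simp
  rw [h3]
  linear_combination ((![a, b, d, -1] : Fin 4 → ℤ) p : ℝ) * this

/-- Three of the vectors are dependent. -/
theorem false_of_zero (h : IsDiagonal x y z c) (hD : |intDet (c 0) (c 1) (c 3)| = 1)
    {a b : ℤ} (ha : |a| = 1) (hb : |b| = 1) (hc : c 2 = a • c 0 + b • c 1) : False := by
  have he : ∀ p, |(![a, b, -1, 1] : Fin 4 → ℤ) p| = 1 := by
    intro p
    fin_cases p <;> simp [ha, hb]
  obtain ⟨h₁, h₂, h₃⟩ := h.signed he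
  set w : Fin 4 → Fin 4 → ℝ := fun i p => (![a, b, -1, 1] : Fin 4 → ℤ) p *
    latticeVector x y z ((![a, b, -1, 1] : Fin 4 → ℤ) i • c i) p with hw
  have hs : ∀ p, w 0 p + w 1 p + w 2 p = 0 := by
    intro p
    have := latticeVector_relation (x := x) (y := y) (z := z) (e := ![a, b, -1, 1]) (u := c)
      (t := c 3) (a := 0)
      (show a • c 0 + b • c 1 + (-1 : ℤ) • c 2 = (0 : ℤ) • c 3 by rw [hc]; module) p
    linear_combination ((![a, b, -1, 1] : Fin 4 → ℤ) p : ℝ) * this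
  have hb := h₃ 0 1 3 hD
  refine IsZeroBase.false (e := w) (l := 3) (i := 0) (j := 1) (k := 2) ⟨?_, ?_, h₁, h₂⟩ (by decide)
  · intro i j k hd
    let C : Fin 4 → Fin 3 → ℤ := ![![1, 0, 0], ![0, 1, 0], ![-1, -1, 0], ![0, 0, 1]]
    have hC : ∀ m p, w m p = C m 0 * w 0 p + C m 1 * w 1 p + C m 2 * w 3 p := by
      intro m p
      have := hs p
      fin_cases m <;> simp [C]
      linarith
    refine hb.of_unimodular _ _ _ _ _ _ _ _ _ ?_ (hC i) (hC j) (hC 3)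
    revert hd; clear * -; revert i j k; decide
  · intro i j k p hd
    have := hs p
    have hk := IsSuperbase.cover hd
    revert hd hk
    clear * - this
    generalize w = w at *
    fin_cases i <;> fin_cases j <;> fin_cases k <;> simp <;>
      first | linarith | exact fun _ => by linarith

/-- One vector is half the sum of the others. -/
theorem false_of_half (h : IsDiagonal x y z c) (hD : |intDet (c 0) (c 1) (c 3)| = 1)
    {a b d : ℤ} (ha : |a| = 1) (hb : |b| = 1) (hd : |d| = 1)
    (hc : (2 : ℤ) • c 3 = a • c 0 + b • c 1 + d • c 2) : False := by
  have he : ∀ p, |(![a, b, d, 1] : Fin 4 → ℤ) p| = 1 := by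
    intro p
    fin_cases p <;> simp [ha, hb, hd]
  obtain ⟨h₁, h₂, h₃⟩ := h.signed he
  set w : Fin 4 → Fin 4 → ℝ := fun i p => (![a, b, d, 1] : Fin 4 → ℤ) p *
    latticeVector x y z ((![a, b, d, 1] : Fin 4 → ℤ) i • c i) p with hw
  have hs : ∀ p, w 0 p + w 1 p + w 2 p = 2 * w 3 p := by
    intro p
    have := latticeVector_relation (x := x) (y := y) (z := z) (e := ![a, b, d, 1]) (u := c)
      (t := c 3) (a := 2) (by simp [hc]) p
    have h3 : (![a, b, d, 1] : Fin 4 → ℤ) 3 • c 3 = c 3 := by simp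
    simp only [hw, h3]
    rw [Int.cast_ofNat] at this
    linear_combination ((![a, b, d, 1] : Fin 4 → ℤ) p : ℝ) * this
  have hb := h₃ 0 1 3 hD
  refine IsHalfBase.false (z := w) (l := 3) (i := 0) (j := 1) (k := 2) ⟨?_, ?_, h₁, h₂⟩ (by decide)
  · intro i j k hd
    let C : Fin 4 → Fin 3 → ℤ := ![![1, 0, 0], ![0, 1, 0], ![-1, -1, 2], ![0, 0, 1]]
    have hC : ∀ m p, w m p = C m 0 * w 0 p + C m 1 * w 1 p + C m 2 * w 3 p := by
      intro m p
      have := hs p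
      fin_cases m <;> simp [C]
      linarith
    refine hb.of_unimodular _ _ _ _ _ _ _ _ _ ?_ (hC i) (hC j) (hC 3)
    revert hd; clear * -; revert i j k; decide
  · intro i j k p hd
    have := hs p
    revert hd
    clear * - this
    generalize w = w at *
    fin_cases i <;> fin_cases j <;> fin_cases k <;> simp <;> linarith

theorem odd_combination_of_dependent (h : IsDiagonal x y z c) (hd : [i, j, k, l].Nodup)
    (hD : intDet (c i) (c j) (c k) = 0) :
    ∃ m n : ℤ, Odd m ∧ Odd n ∧ c k = m • c i + n • c j := by
  obtain ⟨-, -, hij, hik, hil, hjk, hjl, hkl⟩ := nodup_swap hd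
  obtain ⟨a, b, d, habd, hrel⟩ := exists_relation_of_intDet_eq_zero hD
  have hd0 : d ≠ 0 := by
    rintro rfl
    have := h.eq_zero_of_smul_eq hij (m := a) (n := -b) (by
      rw [neg_smul, eq_neg_iff_add_eq_zero, ← hrel, zero_smul, add_zero])
    simp [this.1, neg_eq_zero.1 this.2] at habd
  obtain ⟨m, n, hmn⟩ := h.combination hd (v := c k) (N := d) (n₁ := -a) (n₂ := -b) hd0 (by
    linear_combination hrel)
  refine ⟨m, n, ?_⟩
  rcases Int.even_or_odd' m with ⟨m', rfl | rfl⟩ <;> rcases Int.even_or_odd' n with ⟨n', rfl | rfl⟩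
  · exact absurd (by rw [hmn]; module) (h.ne_two_smul k (m' • c i + n' • c j))
  · exact absurd (by rw [hmn]; module) (h.add_ne_two_smul hjk (m' • c i + (n' + 1) • c j))
  · exact absurd (by rw [hmn]; module) (h.add_ne_two_smul hik ((m' + 1) • c i + n' • c j))
  · exact ⟨⟨m', rfl⟩, ⟨n', rfl⟩, hmn⟩

theorem exists_independent (h : IsDiagonal x y z c) :
    ∃ i j k l : Fin 4, [i, j, k, l].Nodup ∧ intDet (c i) (c j) (c k) ≠ 0 := by
  by_contra! hcon
  obtain ⟨m, n, ⟨m₁, rfl⟩, ⟨n₁, rfl⟩, h₁⟩ := h.odd_combination_of_dependent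
    (i := 0) (j := 1) (k := 2) (l := 3) (by decide) (hcon _ _ _ 3 (by decide))
  obtain ⟨m, n, ⟨m₂, rfl⟩, ⟨n₂, rfl⟩, h₂⟩ := h.odd_combination_of_dependent
    (i := 0) (j := 1) (k := 3) (l := 2) (by decide) (hcon _ _ _ 2 (by decide))
  exact h.add_ne_two_smul (i := 2) (j := 3) (by decide)
    ((m₁ + m₂ + 1) • c 0 + (n₁ + n₂ + 1) • c 1) (by rw [h₁, h₂]; module)

theorem coefficients_eq {u v w : Fin 3 → ℤ} (hD : intDet u v w ≠ 0) {a b d a' b' d' : ℤ}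
    (h : a • u + b • v + d • w = a' • u + b' • v + d' • w) : a = a' ∧ b = b' ∧ d = d' := by
  have := eq_zero_of_intDet_ne_zero hD (a := a - a') (b := b - b') (d := d - d') (by
    linear_combination h)
  omega

theorem coefficient_bound (h : IsDiagonal x y z c) (hd : [i, j, k, l].Nodup)
    (hD : intDet (c i) (c j) (c k) ≠ 0) {a b d : ℤ} (hc : c l = a • c i + b • c j + d • c k) :
    a = 0 ∨ |a| = 1 ∨ |a| = 2 ∧ Odd b ∧ Odd d := by
  rcases eq_or_ne a 0 with ha | ha
  · exact Or.inl ha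
  right
  have hd' : [l, j, k, i].Nodup := by
    revert hd; clear * -; revert i j k l; decide
  rcases h.combination_or_half hd' (v := c i) (n₁ := 1) (n₂ := -b) (n₃ := -d) ha (by
    rw [hc]; module) with ⟨a', b', d', hv⟩ | ⟨a', b', d', hoa, hob, hod, hv⟩
  · left
    have := (coefficients_eq hD (a := 1) (b := 0) (d := 0) (a' := a' * a) (b' := a' * b + b')
      (d' := a' * d + d') (by linear_combination hv + a' • hc)).1
    exact Int.isUnit_iff_abs_eq.1 (IsUnit.of_mul_eq_one_right _ this.symm)
  · right
    obtain ⟨h₁, h₂, h₃⟩ := coefficients_eq hD (a := 2) (b := 0) (d := 0) (a' := a' * a)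
      (b' := a' * b + b') (d' := a' * d + d') (by linear_combination hv + a' • hc)
    refine ⟨?_, ?_, ?_⟩
    · obtain ⟨m, rfl⟩ : (2 : ℤ) ∣ a :=
        ((Int.even_mul.1 (h₁ ▸ even_two)).resolve_left (Int.not_even_iff_odd.2 hoa)).two_dvd
      have : a' * m = 1 := by linarith
      rw [abs_mul, Int.isUnit_iff_abs_eq.1 (IsUnit.of_mul_eq_one_right _ this)]
      norm_num
    · have : Odd (a' * b) := by
        rw [show a' * b = -b' by linarith]
        exact hob.neg
      exact (Int.odd_mul.1 this).2
    · have : Odd (a' * d) := by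
        rw [show a' * d = -d' by linarith]
        exact hod.neg
      exact (Int.odd_mul.1 this).2

/-- At least two coefficients are odd. -/
theorem parity (h : IsDiagonal x y z c) (hd : [i, j, k, l].Nodup)
    {a b d : ℤ} (hc : c l = a • c i + b • c j + d • c k) :
    Odd a ∧ Odd b ∧ Odd d ∨ Odd a ∧ Odd b ∧ Even d ∨ Odd a ∧ Even b ∧ Odd d ∨
      Even a ∧ Odd b ∧ Odd d := by
  obtain ⟨-, -, hij, hik, hil, hjk, hjl, hkl⟩ := nodup_swap hd
  rcases Int.even_or_odd' a with ⟨a', rfl | rfl⟩ <;>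
    rcases Int.even_or_odd' b with ⟨b', rfl | rfl⟩ <;>
    rcases Int.even_or_odd' d with ⟨d', rfl | rfl⟩
  · exact absurd (by rw [hc]; module) (h.ne_two_smul l (a' • c i + b' • c j + d' • c k))
  · exact absurd (by rw [hc]; module)
      (h.add_ne_two_smul hkl (a' • c i + b' • c j + (d' + 1) • c k))
  · exact absurd (by rw [hc]; module)
      (h.add_ne_two_smul hjl (a' • c i + (b' + 1) • c j + d' • c k))
  · simp
  · exact absurd (by rw [hc]; module)
      (h.add_ne_two_smul hil ((a' + 1) • c i + b' • c j + d' • c k))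
  all_goals simp

/-- The last coefficient of an integral relation is even and the other ones are odd. -/
theorem false_of_even (h : IsDiagonal x y z c) (hd : [i, j, k, l].Nodup)
    (hD : |intDet (c i) (c j) (c k)| = 1) {a b d : ℤ} (ha : |a| = 1) (hb : |b| = 1)
    (hd' : d = 0 ∨ |d| = 2) (hc : c l = a • c i + b • c j + d • c k) : False := by
  obtain ⟨x', y', z', h'⟩ := h.exists_reindex (i := i) (j := j) (k := l) (l := k) (by
    revert hd; clear * -; revert i j k l; decide)
  rcases hd' with rfl | hd'
  · exact h'.false_of_zero hD ha hb (by simpa using hc)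
  · obtain ⟨e, rfl, he⟩ : ∃ e, d = 2 * e ∧ |e| = 1 := by
      rcases (abs_eq zero_le_two).1 hd' with rfl | rfl
      · exact ⟨1, rfl, rfl⟩
      · exact ⟨-1, rfl, rfl⟩
    refine h'.false_of_half hD (a := -e * a) (b := -e * b) (d := e) ?_ ?_ he ?_
    · rw [abs_mul, abs_neg, he, ha, one_mul]
    · rw [abs_mul, abs_neg, he, hb, one_mul]
    · have he2 : e * e = 1 := by rw [← abs_mul_abs_self, he, one_mul]
      change (2 : ℤ) • c k = (-e * a) • c i + (-e * b) • c j + e • c l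
      have : (2 : ℤ) • c k = (2 * (e * e)) • c k := by rw [he2, mul_one]
      rw [this]
      linear_combination -e • hc

/-- The first three vectors generate the lattice. -/
theorem false_of_generating (h : IsDiagonal x y z c) (hd : [i, j, k, l].Nodup)
    (hG : ∀ v, ∃ a b d : ℤ, v = a • c i + b • c j + d • c k) : False := by
  have hD := abs_intDet_eq_one hG
  have hD0 : intDet (c i) (c j) (c k) ≠ 0 := by
    intro h0
    rw [h0] at hD
    norm_num at hD
  obtain ⟨a, b, d, hc⟩ := hG (c l)
  have hd₁ : [i, k, j, l].Nodup := by
    revert hd; clear * -; revert i j k l; decide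
  have hd₂ : [j, k, i, l].Nodup := by
    revert hd; clear * -; revert i j k l; decide
  have hd₃ : [j, i, k, l].Nodup := by
    revert hd; clear * -; revert i j k l; decide
  have hd₄ : [k, i, j, l].Nodup := by
    revert hd; clear * -; revert i j k l; decide
  have swap₁ : intDet (c i) (c k) (c j) = -intDet (c i) (c j) (c k) := by unfold intDet; ring
  have swap₂ : intDet (c j) (c k) (c i) = intDet (c i) (c j) (c k) := by unfold intDet; ring
  have swap₃ : intDet (c j) (c i) (c k) = -intDet (c i) (c j) (c k) := by unfold intDet; ring
  have swap₄ : intDet (c k) (c i) (c j) = intDet (c i) (c j) (c k) := by unfold intDet; ring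
  have ba := h.coefficient_bound hd hD0 hc
  have bb := h.coefficient_bound hd₃ (a := b) (b := a) (d := d) (by rwa [swap₃, neg_ne_zero])
    (by rw [hc]; module)
  have bd := h.coefficient_bound hd₄ (a := d) (b := a) (d := b) (by rwa [swap₄])
    (by rw [hc]; module)
  have odd_bound : ∀ {a : ℤ} {P : Prop}, Odd a → (a = 0 ∨ |a| = 1 ∨ |a| = 2 ∧ P) → |a| = 1 := by
    rintro a P ho (rfl | h1 | ⟨h2, -⟩)
    · simp at ho
    · exact h1
    · rw [← odd_abs, h2] at ho
      exact absurd ho (by decide)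
  have even_bound : ∀ {a : ℤ} {P : Prop}, Even a → (a = 0 ∨ |a| = 1 ∨ |a| = 2 ∧ P) →
      a = 0 ∨ |a| = 2 := by
    rintro a P he (h0 | h1 | ⟨h2, -⟩)
    · exact Or.inl h0
    · rw [← even_abs, h1] at he
      exact absurd he (by decide)
    · exact Or.inr h2
  rcases h.parity hd hc with ⟨ha, hb, hd'⟩ | ⟨ha, hb, hd'⟩ | ⟨ha, hb, hd'⟩ | ⟨ha, hb, hd'⟩
  · obtain ⟨x', y', z', h'⟩ := h.exists_reindex hd
    exact h'.false_of_sum hD (odd_bound ha ba) (odd_bound hb bb) (odd_bound hd' bd) hc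
  · exact h.false_of_even hd hD (odd_bound ha ba) (odd_bound hb bb) (even_bound hd' bd) hc
  · exact h.false_of_even hd₁ (by rwa [swap₁, abs_neg]) (odd_bound ha ba) (odd_bound hd' bd)
      (even_bound hb bb) (by rw [hc]; module)
  · exact h.false_of_even hd₂ (by rwa [swap₂]) (odd_bound hb bb) (odd_bound hd' bd)
      (even_bound ha ba) (by rw [hc]; module)

theorem coefficient_of_half (h : IsDiagonal x y z c) (hd : [i, j, k, l].Nodup)
    (hD : intDet (c i) (c j) (c k) ≠ 0) {a b d : ℤ} (ha : Odd a)
    (hc : (2 : ℤ) • c l = a • c i + b • c j + d • c k) : |a| = 1 := by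
  have hd' : [l, j, k, i].Nodup := by
    revert hd; clear * -; revert i j k l; decide
  have ha0 : a ≠ 0 := by
    rintro rfl
    simp at ha
  rcases h.combination_or_half hd' (v := c i) (n₁ := 2) (n₂ := -b) (n₃ := -d) ha0 (by
    rw [hc]; module) with ⟨a', b', d', hv⟩ | ⟨a', b', d', hoa, -, -, hv⟩
  · have h₁ := (coefficients_eq hD (a := 2) (b := 0) (d := 0) (a' := a' * a)
      (b' := a' * b + 2 * b') (d' := a' * d + 2 * d') (by
        linear_combination (2 : ℤ) • hv + a' • hc)).1
    obtain ⟨m, rfl⟩ : (2 : ℤ) ∣ a' := by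
      rw [← even_iff_two_dvd]
      by_contra hodd
      have := (Int.not_even_iff_odd.1 hodd).mul ha
      rw [← h₁] at this
      exact absurd this (by decide)
    exact Int.isUnit_iff_abs_eq.1 (IsUnit.of_mul_eq_one_right m (by linarith))
  · have h₁ := (coefficients_eq hD (a := 4) (b := 0) (d := 0) (a' := a' * a)
      (b' := a' * b + 2 * b') (d' := a' * d + 2 * d') (by
        linear_combination (2 : ℤ) • hv + a' • hc)).1
    have := hoa.mul ha
    rw [← h₁] at this
    exact absurd this (by decide)

protected theorem false (h : IsDiagonal x y z c) : False := by
  obtain ⟨i, j, k, l, hd, hD⟩ := h.exists_independent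
  by_cases hG : ∀ v, ∃ a b d : ℤ, v = a • c i + b • c j + d • c k
  · exact h.false_of_generating hd hG
  have hall := fun v => h.combination_or_half hd hD (intDet_smul_eq (c i) (c j) (c k) v)
  obtain ⟨u, hu⟩ := not_forall.1 hG
  obtain ⟨_, _, _, ⟨p, rfl⟩, ⟨q, rfl⟩, ⟨r, rfl⟩, hu⟩ := (hall u).resolve_left hu
  obtain ⟨-, -, hij, hik, hil, hjk, hjl, hkl⟩ := nodup_swap hd
  rcases hall (c l) with ⟨a, b, d, hc⟩ | ⟨a, b, d, ha, hb, hd', hc⟩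
  · rcases h.parity hd hc with ⟨ha, hb, hd'⟩ | ⟨ha, hb, hd'⟩ | ⟨ha, hb, hd'⟩ | ⟨ha, hb, hd'⟩ <;>
      obtain ⟨a', rfl⟩ := ha <;> obtain ⟨b', rfl⟩ := hb <;> obtain ⟨d', rfl⟩ := hd'
    · refine h.ne_two_smul l (u + (a' - p) • c i + (b' - q) • c j + (d' - r) • c k) ?_
      linear_combination hc - hu
    · refine h.add_ne_two_smul hkl (u + (a' - p) • c i + (b' - q) • c j + (d' - r) • c k) ?_
      linear_combination hc - hu
    · refine h.add_ne_two_smul hjl (u + (a' - p) • c i + (b' - q) • c j + (d' - r) • c k) ?_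
      linear_combination hc - hu
    · refine h.add_ne_two_smul hil (u + (a' - p) • c i + (b' - q) • c j + (d' - r) • c k) ?_
      linear_combination hc - hu
  · have hd₃ : [j, i, k, l].Nodup := by
      revert hd; clear * -; revert i j k l; decide
    have hd₄ : [k, i, j, l].Nodup := by
      revert hd; clear * -; revert i j k l; decide
    have ha1 := h.coefficient_of_half hd hD ha hc
    have hb1 := h.coefficient_of_half hd₃ (a := b) (b := a) (d := d) (by
      rwa [show intDet (c j) (c i) (c k) = -intDet (c i) (c j) (c k) by unfold intDet; ring,
        neg_ne_zero]) hb (by rw [hc]; module)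
    have hd1 := h.coefficient_of_half hd₄ (a := d) (b := a) (d := b) (by
      rwa [show intDet (c k) (c i) (c j) = intDet (c i) (c j) (c k) by unfold intDet; ring]) hd'
      (by rw [hc]; module)
    obtain ⟨x', y', z', h'⟩ := h.exists_reindex hd
    refine h'.false_of_half (abs_intDet_eq_one fun v => ?_) ha1 hb1 hd1 hc
    change ∃ a b d : ℤ, v = a • c i + b • c j + d • c l
    have hk : c k = (2 * d) • c l - (d * a) • c i - (d * b) • c j := by
      have hd2 : d * d = 1 := by rw [← abs_mul_abs_self, hd1, one_mul]
      have : c k = (d * d) • c k := by rw [hd2, one_smul]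
      rw [this]
      linear_combination -d • hc
    rcases hall v with ⟨a', b', d', hv⟩ | ⟨_, _, _, ⟨a', rfl⟩, ⟨b', rfl⟩, ⟨d', rfl⟩, hv⟩
    · exact ⟨a' - d' * d * a, b' - d' * d * b, d' * 2 * d, by rw [hv, hk]; module⟩
    · obtain ⟨a₀, ha⟩ := ha
      obtain ⟨b₀, hb⟩ := hb
      obtain ⟨d₀, hd'⟩ := hd'
      have hv' : v = c l + (a' - a₀) • c i + (b' - b₀) • c j + (d' - d₀) • c k := by
        refine smul_right_injective _ (two_ne_zero (α := ℤ)) ?_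
        change (2 : ℤ) • v = (2 : ℤ) • _
        rw [ha, hb, hd'] at hc
        linear_combination hv - hc
      refine ⟨a' - a₀ - (d' - d₀) * d * a, b' - b₀ - (d' - d₀) * d * b,
        1 + (d' - d₀) * (2 * d), ?_⟩
      linear_combination hv' + (d' - d₀) • hk

end IsDiagonal

section

open MeasureTheory Module

variable {ι : Type*} [Fintype ι]

/-- Minkowski's theorem on linear forms, for a nonzero determinant. -/
theorem exists_int_abs_mulVec_lt_one_of_det_ne_zero [DecidableEq ι] (M : Matrix ι ι ℝ)
    (h0 : M.det ≠ 0) (h1 : |M.det| < 1) :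
    ∃ v : ι → ℤ, v ≠ 0 ∧ ∀ i, |M.mulVec (fun m => (v m : ℝ)) i| < 1 := by
  have hdet : LinearMap.det (Matrix.toLin' M) ≠ 0 := by rwa [LinearMap.det_toLin']
  have : Countable (Submodule.span ℤ (Set.range (Pi.basisFun ℝ ι))).toAddSubgroup :=
    inferInstanceAs (Countable (Submodule.span ℤ (Set.range (Pi.basisFun ℝ ι))))
  obtain ⟨⟨t, ht⟩, ht0, hts⟩ := exists_ne_zero_mem_lattice_of_measure_mul_two_pow_lt_measure
    (μ := (volume : Measure (ι → ℝ))) (s := Matrix.toLin' M ⁻¹' Metric.ball 0 1)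
    (ZSpan.isAddFundamentalDomain' (Pi.basisFun ℝ ι) volume)
    (fun x hx => by simpa [map_neg] using hx)
    ((convex_ball (0 : ι → ℝ) 1).linear_preimage _) (by
      rw [Measure.addHaar_preimage_linearMap _ hdet, Real.volume_pi_ball _ one_pos,
        LinearMap.det_toLin', ZSpan.fundamentalDomain_pi_basisFun, volume_pi_pi]
      simp only [Real.volume_Ico, sub_zero, ENNReal.ofReal_one, Finset.prod_const_one, one_mul,
        finrank_fintype_fun_eq_card, mul_one]
      rw [ENNReal.ofReal_pow zero_le_two, ENNReal.ofReal_ofNat]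
      refine (one_mul ((2 : ENNReal) ^ Fintype.card ι)).symm.trans_lt
        (ENNReal.mul_lt_mul_left (by simp) (by simp) ?_)
      rw [← ENNReal.ofReal_one, ENNReal.ofReal_lt_ofReal_iff (abs_pos.2 (inv_ne_zero h0)), abs_inv]
      exact (one_lt_inv₀ (abs_pos.2 h0)).2 h1)
  have hr := (Basis.mem_span_iff_repr_mem ℤ (Pi.basisFun ℝ ι) t).1 ht
  choose v hv using hr
  have hvt : (fun m => (v m : ℝ)) = t := by
    funext m
    simpa using hv m
  refine ⟨v, ?_, ?_⟩
  · rintro rfl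
    refine ht0 (Subtype.ext (hvt.symm.trans ?_))
    funext m
    simp
  · rw [hvt]
    intro i
    have : ‖Matrix.toLin' M t‖ < 1 := by simpa using hts
    rw [Matrix.toLin'_apply] at this
    exact (norm_le_pi_norm (M.mulVec t) i).trans_lt this

/-- Some multiple of a real vector with a coordinate outside the open unit interval is close to
a nonzero integer vector. -/
theorem exists_int_near_smul (t : ι → ℝ) {d : ℝ} (hd : 0 < d) {i : ι} (hi : 1 ≤ |t i|) :
    ∃ (n : ℝ) (v : ι → ℤ), v ≠ 0 ∧ ‖(fun m => (v m : ℝ)) - n • t‖ < d := by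
  obtain ⟨a, -, s, hs, hlim⟩ := (isCompact_Icc (a := (0 : ι → ℝ)) (b := 1)).tendsto_subseq
    (x := fun n : ℕ => fun m => Int.fract (n * t m))
    fun n => ⟨fun m => Int.fract_nonneg _, fun m => (Int.fract_lt_one _).le⟩
  obtain ⟨N, hN⟩ := Metric.cauchySeq_iff.1 hlim.cauchySeq (min d 1) (lt_min hd one_pos)
  have hlt := hN (N + 1) (Nat.le_succ N) N le_rfl
  have hsN : s N < s (N + 1) := hs (Nat.lt_succ_self N)
  set n : ℝ := (s (N + 1) : ℝ) - s N with hn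
  have hn1 : 1 ≤ n := by
    have : (s N : ℝ) + 1 ≤ s (N + 1) := by exact_mod_cast hsN
    linarith
  set v : ι → ℤ := fun m => ⌊s (N + 1) * t m⌋ - ⌊s N * t m⌋ with hv
  have hdist : ‖(fun m => (v m : ℝ)) - n • t‖ < min d 1 := by
    rw [dist_comm, dist_eq_norm] at hlt
    refine (congrArg norm ?_).trans_lt hlt
    funext m
    simp only [Pi.sub_apply, Pi.smul_apply, smul_eq_mul, Function.comp, hv, hn, Int.fract]
    push_cast
    ring
  refine ⟨n, v, fun h0 => ?_, hdist.trans_le (min_le_left _ _)⟩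
  have h₁ := (norm_le_pi_norm ((fun m => (v m : ℝ)) - n • t) i).trans_lt
    (hdist.trans_le (min_le_right _ _))
  simp only [h0, Pi.sub_apply, Pi.zero_apply, Int.cast_zero, zero_sub, norm_neg, Pi.smul_apply,
    smul_eq_mul, Real.norm_eq_abs, abs_mul] at h₁
  rw [abs_of_pos (by linarith : 0 < n)] at h₁
  nlinarith

theorem exists_int_abs_mulVec_lt_one [DecidableEq ι] (M : Matrix ι ι ℝ) (h1 : |M.det| < 1) :
    ∃ v : ι → ℤ, v ≠ 0 ∧ ∀ i, |M.mulVec (fun m => (v m : ℝ)) i| < 1 := by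
  by_cases h0 : M.det = 0
  · obtain ⟨t, ht, hMt⟩ := Matrix.exists_mulVec_eq_zero_iff.2 h0
    obtain ⟨i, hi⟩ := Function.ne_iff.1 ht
    obtain ⟨C, hC, hM⟩ := (Matrix.toLin' M).toContinuousLinearMap.bound
    obtain ⟨n, v, hv, hlt⟩ := exists_int_near_smul ((t i)⁻¹ • t) (d := C⁻¹) (inv_pos.2 hC) (i := i)
      (by rw [Pi.smul_apply, smul_eq_mul, inv_mul_cancel₀ hi, abs_one])
    refine ⟨v, hv, fun i' => ?_⟩
    have h₁ := hM ((fun m => (v m : ℝ)) - n • (t i)⁻¹ • t)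
    have h₂ : (Matrix.toLin' M).toContinuousLinearMap ((fun m => (v m : ℝ)) - n • (t i)⁻¹ • t) =
        M.mulVec (fun m => (v m : ℝ)) := by
      simp [Matrix.mulVec_sub, Matrix.mulVec_smul, hMt]
    rw [h₂] at h₁
    refine (norm_le_pi_norm (M.mulVec fun m => (v m : ℝ)) i').trans_lt (h₁.trans_lt ?_)
    rw [← mul_inv_cancel₀ hC.ne']
    exact mul_lt_mul_of_pos_left hlt hC
  · exact exists_int_abs_mulVec_lt_one_of_det_ne_zero M h0 h1

end

section

variable {x y z : Fin 4 → ℝ} {p q r : Fin 4}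

theorem exists_latticeVector_abs_lt_one (h : |minor p q r x y z| < 1) :
    ∃ v : Fin 3 → ℤ, v ≠ 0 ∧ |latticeVector x y z v p| < 1 ∧ |latticeVector x y z v q| < 1 ∧
      |latticeVector x y z v r| < 1 := by
  obtain ⟨v, hv, hlt⟩ := exists_int_abs_mulVec_lt_one
    (Matrix.of ![![x p, y p, z p], ![x q, y q, z q], ![x r, y r, z r]]) (by
      convert h using 2
      rw [Matrix.det_fin_three]
      simp [minor]
      ring)
  have e : ∀ a b d : ℝ, ![a, b, d] ⬝ᵥ (fun m => (v m : ℝ)) = v 0 * a + v 1 * b + v 2 * d := by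
    intro a b d
    simp [dotProduct, Fin.sum_univ_three, mul_comm]
  have h0 := hlt 0
  have h1 := hlt 1
  have h2 := hlt 2
  simp [Matrix.mulVec, e] at h0 h1 h2
  exact ⟨v, hv, h0, h1, h2⟩

/-- A lattice of rank three has only finitely many points in a bounded region. -/
theorem finite_latticeVector_le (h : minor p q r x y z ≠ 0) (R : ℝ) :
    {v : Fin 3 → ℤ | ∀ p, |latticeVector x y z v p| ≤ R}.Finite := by
  have hD := abs_pos.2 h
  obtain ⟨K, hK⟩ : ∃ K : ℝ, ∀ p, |x p| ≤ K ∧ |y p| ≤ K ∧ |z p| ≤ K := by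
    refine ⟨‖x‖ + ‖y‖ + ‖z‖, fun p => ⟨?_, ?_, ?_⟩⟩
    · exact (norm_le_pi_norm x p).trans (by linarith [norm_nonneg y, norm_nonneg z])
    · exact (norm_le_pi_norm y p).trans (by linarith [norm_nonneg x, norm_nonneg z])
    · exact (norm_le_pi_norm z p).trans (by linarith [norm_nonneg x, norm_nonneg y])
  have hK0 : 0 ≤ K := (abs_nonneg _).trans (hK 0).1
  set C : ℝ := 6 * (K * K * R) / |minor p q r x y z| with hC
  refine (Set.finite_Icc (fun _ : Fin 3 => -⌈C⌉) (fun _ => ⌈C⌉)).subset fun v hv => ?_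
  have hR : 0 ≤ R := (abs_nonneg _).trans (hv 0)
  have key : ∀ {a b d e f g u w t : ℝ}, |a| ≤ K → |b| ≤ K → |d| ≤ K → |e| ≤ K → |f| ≤ K → |g| ≤ K →
      |u| ≤ R → |w| ≤ R → |t| ≤ R →
      |u * (a * b - d * e) - w * (f * b - d * g) + t * (f * e - a * g)| ≤ 6 * (K * K * R) := by
    intro a b d e f g u w t ha hb hd he hf hg hu hw ht
    have hp : ∀ {a b u : ℝ}, |a| ≤ K → |b| ≤ K → |u| ≤ R → |u * (a * b)| ≤ K * K * R := by
      intro a b u ha hb hu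
      rw [abs_mul, abs_mul, mul_comm]
      exact mul_le_mul (mul_le_mul ha hb (abs_nonneg _) hK0) hu (abs_nonneg _) (by positivity)
    have h₁ := abs_le.1 (hp ha hb hu)
    have h₂ := abs_le.1 (hp hd he hu)
    have h₃ := abs_le.1 (hp hf hb hw)
    have h₄ := abs_le.1 (hp hd hg hw)
    have h₅ := abs_le.1 (hp hf he ht)
    have h₆ := abs_le.1 (hp ha hg ht)
    rw [abs_le]
    constructor <;> linarith [h₁.1, h₁.2, h₂.1, h₂.2, h₃.1, h₃.2, h₄.1, h₄.2, h₅.1, h₅.2, h₆.1, h₆.2]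
  have hb : ∀ m, |(v m : ℝ)| ≤ C := by
    intro m
    rw [hC, le_div_iff₀ hD, ← abs_mul]
    obtain ⟨px, py, pz⟩ := hK p
    obtain ⟨qx, qy, qz⟩ := hK q
    obtain ⟨rx, ry, rz⟩ := hK r
    have k₁ := key qy rz ry qz py pz (hv p) (hv q) (hv r)
    have k₂ := key qz rx rz qx pz px (hv p) (hv q) (hv r)
    have k₃ := key qx ry rx qy px py (hv p) (hv q) (hv r)
    fin_cases m
    · refine (congrArg abs ?_).trans_le k₁
      simp only [minor, latticeVector, Fin.zero_eta]
      ring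
    · refine (congrArg abs ?_).trans_le k₂
      simp only [minor, latticeVector, Fin.mk_one]
      ring
    · refine (congrArg abs ?_).trans_le k₃
      simp only [minor, latticeVector, Fin.reduceFinMk]
      ring
  simp only [Set.mem_Icc, Pi.le_def]
  refine ⟨fun m => ?_, fun m => ?_⟩
  · have : (-⌈C⌉ : ℝ) ≤ v m := by linarith [(abs_le.1 (hb m)).1, Int.le_ceil C]
    exact_mod_cast this
  · have : (v m : ℝ) ≤ ⌈C⌉ := by linarith [(abs_le.1 (hb m)).2, Int.le_ceil C]
    exact_mod_cast this

/-- Shrinking one column until some lattice point attains its norm `1` only there. -/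
theorem IsBad.exists_shrink (h : IsBad x y z) (hm : minor p q r x y z ≠ 0) (j : Fin 4) :
    ∃ s : Fin 4 → ℝ, s j ≤ 1 ∧ 0 < s j ∧ (∀ i, i ≠ j → s i = 1) ∧
      IsBad (fun p => s p * x p) (fun p => s p * y p) (fun p => s p * z p) ∧
      ∃ v, |s j * latticeVector x y z v j| = 1 ∧ ∀ i, i ≠ j → |latticeVector x y z v i| < 1 := by
  have hlt1 : ∀ p q r, |minor p q r x y z| < 1 := fun p q r => (h.minor_lt p q r).trans (by norm_num)
  obtain ⟨u, hu0, hu⟩ : ∃ u : Fin 3 → ℤ, u ≠ 0 ∧ ∀ i, i ≠ j → |latticeVector x y z u i| < 1 := by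
    obtain ⟨k, l, m, hd⟩ : ∃ k l m, [k, l, m, j].Nodup := by revert j; decide
    obtain ⟨u, hu0, h₁, h₂, h₃⟩ := exists_latticeVector_abs_lt_one (hlt1 k l m)
    refine ⟨u, hu0, fun i hij => ?_⟩
    rcases IsSuperbase.cover hd i with rfl | rfl | rfl | rfl
    exacts [h₁, h₂, h₃, absurd rfl hij]
  set S : Set (Fin 3 → ℤ) := {v | v ≠ 0 ∧ (∀ i, i ≠ j → |latticeVector x y z v i| < 1) ∧
    |latticeVector x y z v j| ≤ |latticeVector x y z u j|} with hS
  have hfin : S.Finite := by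
    refine (finite_latticeVector_le hm (max 1 |latticeVector x y z u j|)).subset fun v hv i => ?_
    by_cases hij : i = j
    · rw [hij]
      exact hv.2.2.trans (le_max_right _ _)
    · exact (hv.2.1 i hij).le.trans (le_max_left _ _)
  obtain ⟨v, ⟨hv0, hv, hvu⟩, hmin⟩ := Set.exists_min_image S (fun v => |latticeVector x y z v j|)
    hfin ⟨u, hu0, hu, le_rfl⟩
  have hone : ∀ t : Fin 3 → ℤ, t ≠ 0 → (∀ i, i ≠ j → |latticeVector x y z t i| < 1) →
      1 ≤ |latticeVector x y z t j| := by
    intro t ht0 ht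
    by_contra! hlt
    exact ht0 (h.eq_zero fun i => if hij : i = j then hij ▸ hlt else ht i hij)
  have hv1 := hone v hv0 hv
  set m : ℝ := |latticeVector x y z v j| with hm
  have hm0 : 0 < m := one_pos.trans_le hv1
  refine ⟨Function.update 1 j m⁻¹, ?_, ?_, fun i hij => by simp [hij], ⟨?_, ?_⟩, v, ?_, hv⟩
  · simpa using inv_le_one_of_one_le₀ hv1
  · simpa using hm0
  · intro a b d habd
    have ht0 : ![a, b, d] ≠ 0 := by
      intro h0
      have h₁ := congrFun h0 0
      have h₂ := congrFun h0 1
      have h₃ := congrFun h0 2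
      simp at h₁ h₂ h₃
      simp [h₁, h₂, h₃] at habd
    have hval : ∀ s : Fin 4 → ℝ, ∀ i, a * (s i * x i) + b * (s i * y i) + d * (s i * z i) =
        s i * latticeVector x y z ![a, b, d] i := by
      intro s i
      simp [latticeVector]
      ring
    by_cases ht : ∀ i, i ≠ j → |latticeVector x y z ![a, b, d] i| < 1
    · refine ⟨j, ?_⟩
      rw [hval, Function.update_self, abs_mul, abs_of_pos (inv_pos.2 hm0), ← div_eq_inv_mul,
        one_le_div hm0]
      rcases le_or_gt |latticeVector x y z ![a, b, d] j| |latticeVector x y z u j| with hle | hlt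
      · exact hmin _ ⟨ht0, ht, hle⟩
      · exact hvu.trans hlt.le
    · push Not at ht
      obtain ⟨i, hij, hi⟩ := ht
      refine ⟨i, ?_⟩
      rwa [hval, Function.update_of_ne hij, Pi.one_apply, one_mul]
  · intro p q r
    set s : Fin 4 → ℝ := Function.update 1 j m⁻¹ with hs
    have hs1 : ∀ i, |s i| ≤ 1 := by
      intro i
      by_cases hij : i = j
      · rw [hij, hs, Function.update_self, abs_of_pos (inv_pos.2 hm0)]
        exact inv_le_one_of_one_le₀ hv1
      · simp [hs, hij]
    have : minor p q r (fun p => s p * x p) (fun p => s p * y p) (fun p => s p * z p)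
        = s p * s q * s r * minor p q r x y z := by
      simp only [minor]
      ring
    rw [this, abs_mul, abs_mul, abs_mul]
    refine (mul_le_of_le_one_left (abs_nonneg _) ?_).trans_lt (h.minor_lt p q r)
    exact mul_le_one₀ (mul_le_one₀ (hs1 p) (abs_nonneg _) (hs1 q)) (abs_nonneg _) (hs1 r)
  · rw [Function.update_self, abs_mul, abs_of_pos (inv_pos.2 hm0), inv_mul_cancel₀ hm0.ne']

/-- All minors of a bad lattice vanish. -/
theorem IsBad.minor_eq_zero (h : IsBad x y z) (p q r : Fin 4) : minor p q r x y z = 0 := by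
  by_contra hm
  have key : ∀ S : Finset (Fin 4), ∃ x y z : Fin 4 → ℝ, IsBad x y z ∧ minor p q r x y z ≠ 0 ∧
      ∀ j ∈ S, ∃ v, |latticeVector x y z v j| = 1 ∧
        ∀ i, i ≠ j → |latticeVector x y z v i| < 1 := by
    intro S
    induction S using Finset.induction_on with
    | empty => exact ⟨x, y, z, h, hm, by simp⟩
    | insert j S hj ih =>
      obtain ⟨x, y, z, h, hm, hS⟩ := ih
      obtain ⟨s, hs1, hs0, hsi, hbad, v, hvj, hv⟩ := h.exists_shrink hm j
      have hval : ∀ v i, latticeVector (fun p => s p * x p) (fun p => s p * y p)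
          (fun p => s p * z p) v i = s i * latticeVector x y z v i := by
        intro v i
        simp only [latticeVector]
        ring
      have hs : ∀ i, 0 < s i ∧ s i ≤ 1 := fun i =>
        if hij : i = j then hij ▸ ⟨hs0, hs1⟩ else by simp [hsi i hij]
      refine ⟨_, _, _, hbad, ?_, fun k hk => ?_⟩
      · have : minor p q r (fun p => s p * x p) (fun p => s p * y p) (fun p => s p * z p)
            = s p * s q * s r * minor p q r x y z := by
          simp only [minor]
          ring
        rw [this]
        exact mul_ne_zero (mul_pos (mul_pos (hs p).1 (hs q).1) (hs r).1).ne' hm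
      · rcases eq_or_ne k j with rfl | hkj
        · refine ⟨v, by rw [hval, hvj], fun i hij => ?_⟩
          rw [hval, hsi i hij, one_mul]
          exact hv i hij
        · obtain ⟨w, hwk, hw⟩ := hS k (Finset.mem_of_mem_insert_of_ne hk hkj)
          refine ⟨w, by rw [hval, hsi k hkj, one_mul, hwk], fun i hik => ?_⟩
          rw [hval, abs_mul, abs_of_pos (hs i).1]
          exact (mul_le_of_le_one_left (abs_nonneg _) (hs i).2).trans_lt (hw i hik)
  obtain ⟨x, y, z, h, -, hS⟩ := key Finset.univ
  have hc : ∀ j, ∃ v, latticeVector x y z v j = 1 ∧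
      ∀ i, i ≠ j → |latticeVector x y z v i| < 1 := by
    intro j
    obtain ⟨v, hvj, hv⟩ := hS j (Finset.mem_univ j)
    rcases (abs_eq zero_le_one).1 hvj with h1 | h1
    · exact ⟨v, h1, hv⟩
    · refine ⟨-v, by rw [latticeVector_neg, h1, neg_neg], fun i hij => ?_⟩
      rw [latticeVector_neg, abs_neg]
      exact hv i hij
  choose c hc₁ hc₂ using hc
  exact IsDiagonal.false ⟨h, hc₁, fun i p hip => hc₂ i p hip.symm⟩

end

theorem exists_min_norm_add_smul {E : Type*} [NormedAddCommGroup E] [NormedSpace ℝ E]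
    [ProperSpace E] (e f g : E) :
    ∃ α β : ℝ, ∀ a b : ℝ, ‖g + α • e + β • f‖ ≤ ‖g + a • e + b • f‖ := by
  set S : Submodule ℝ E := Submodule.span ℝ {e, f} with hS
  have : FiniteDimensional ℝ S := FiniteDimensional.span_of_finite ℝ (Set.toFinite _)
  obtain ⟨w, hw, hd⟩ := S.closed_of_finiteDimensional.exists_infDist_eq_dist ⟨0, S.zero_mem⟩ g
  obtain ⟨α, β, rfl⟩ := Submodule.mem_span_pair.1 hw
  refine ⟨-α, -β, fun a b => ?_⟩
  have h₁ : (-a) • e + (-b) • f ∈ (S : Set E) := Submodule.mem_span_pair.2 ⟨_, _, rfl⟩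
  have h₂ := Metric.infDist_le_dist_of_mem (x := g) h₁
  rw [hd, dist_eq_norm, dist_eq_norm] at h₂
  rwa [show g + -α • e + -β • f = g - (α • e + β • f) by module,
    show g + a • e + b • f = g - (-a • e + -b • f) by module]

/-- The determinant of a matrix transformed by a homothety plus a matrix of rank one. -/
theorem minor_rank_one (x y z p : Fin 4 → ℝ) (s t f₀ f₁ f₂ g₀ g₁ g₂ : ℝ)
    (hp : ∀ i, p i = g₀ * x i + g₁ * y i + g₂ * z i) (i j k : Fin 4) :
    minor i j k (fun i => s * x i + t * f₀ * p i) (fun i => s * y i + t * f₁ * p i)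
      (fun i => s * z i + t * f₂ * p i) =
      s ^ 2 * (s + t * (f₀ * g₀ + f₁ * g₁ + f₂ * g₂)) * minor i j k x y z := by
  simp only [minor, hp]
  ring

theorem intDet_comm (u v w : Fin 3 → ℤ) : intDet u w v = -intDet u v w := by
  unfold intDet; ring

section

variable {x y z : Fin 4 → ℝ} {p q r : Fin 4}

theorem norm_latticeVector_pos (h : minor p q r x y z ≠ 0) {v : Fin 3 → ℤ} (hv : v ≠ 0) :
    0 < ‖latticeVector x y z v‖ := by
  rw [norm_pos_iff]
  intro h0
  refine Set.infinite_of_injective_forall_mem (f := fun n : ℤ => n • v) (smul_left_injective ℤ hv)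
    (fun n => ?_) (finite_latticeVector_le h 0)
  intro p
  rw [latticeVector_smul, congrFun h0 p]
  simp

theorem exists_min_norm_latticeVector (h : minor p q r x y z ≠ 0) {P : Set (Fin 3 → ℤ)}
    (hP : P.Nonempty) :
    ∃ v ∈ P, ∀ w ∈ P, ‖latticeVector x y z v‖ ≤ ‖latticeVector x y z w‖ := by
  obtain ⟨u, hu⟩ := hP
  have hfin : {w ∈ P | ‖latticeVector x y z w‖ ≤ ‖latticeVector x y z u‖}.Finite :=
    (finite_latticeVector_le h ‖latticeVector x y z u‖).subset fun w hw i =>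
      (norm_le_pi_norm (latticeVector x y z w) i).trans hw.2
  obtain ⟨v, ⟨hvP, hvu⟩, hv⟩ := Set.exists_min_image _ (fun w => ‖latticeVector x y z w‖) hfin
    ⟨u, hu, le_rfl⟩
  refine ⟨v, hvP, fun w hw => ?_⟩
  rcases le_total ‖latticeVector x y z w‖ ‖latticeVector x y z u‖ with hle | hle
  · exact hv w ⟨hw, hle⟩
  · exact hvu.trans hle

theorem smul_eq_smul_of_intDet_eq_zero {u v : Fin 3 → ℤ} (h : ∀ w, intDet u v w = 0) (i : Fin 3) :
    u i • v = v i • u := by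
  have h0 := h ![1, 0, 0]
  have h1 := h ![0, 1, 0]
  have h2 := h ![0, 0, 1]
  simp [intDet] at h0 h1 h2
  funext j
  fin_cases i <;> fin_cases j <;> simp <;> linarith

theorem exists_intDet_ne_zero {u : Fin 3 → ℤ} (hu : u ≠ 0) : ∃ v w, intDet u v w ≠ 0 := by
  by_contra! h
  have h0 := h ![0, 1, 0] ![0, 0, 1]
  have h1 := h ![0, 0, 1] ![1, 0, 0]
  have h2 := h ![1, 0, 0] ![0, 1, 0]
  simp [intDet] at h0 h1 h2
  refine hu (funext fun i => ?_)
  fin_cases i <;> simp [h0, h1, h2]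

/-- Vectors attaining the successive minima of a lattice with respect to the maximum norm. -/
theorem exists_successive_minima (h : minor p q r x y z ≠ 0) :
    ∃ u v w : Fin 3 → ℤ, intDet u v w ≠ 0 ∧
      (∀ t, t ≠ 0 → ‖latticeVector x y z u‖ ≤ ‖latticeVector x y z t‖) ∧
      (∀ t t', intDet u t t' ≠ 0 → ‖latticeVector x y z v‖ ≤ ‖latticeVector x y z t‖) ∧
      ∀ t, intDet u v t ≠ 0 → ‖latticeVector x y z w‖ ≤ ‖latticeVector x y z t‖ := by
  obtain ⟨u, hu, hmu⟩ := exists_min_norm_latticeVector h (P := {t | t ≠ 0})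
    ⟨fun _ => 1, fun h0 => one_ne_zero (congrFun h0 0)⟩
  obtain ⟨v, ⟨w, hw⟩, hmv⟩ := exists_min_norm_latticeVector h (P := {t | ∃ t', intDet u t t' ≠ 0})
    (exists_intDet_ne_zero hu)
  obtain ⟨w, hw, hmw⟩ := exists_min_norm_latticeVector h (P := {t | intDet u v t ≠ 0}) ⟨w, hw⟩
  exact ⟨u, v, w, hw, hmu, fun t t' ht => hmv t ⟨t', ht⟩, hmw⟩

theorem smul_latticeVector_eq (u v w t : Fin 3 → ℤ) (i : Fin 4) :
    intDet u v w * latticeVector x y z t i = intDet t v w * latticeVector x y z u i +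
      intDet u t w * latticeVector x y z v i + intDet u v t * latticeVector x y z w i := by
  rw [← latticeVector_smul, ← latticeVector_smul, ← latticeVector_smul, ← latticeVector_smul,
    ← latticeVector_add, ← latticeVector_add, intDet_smul_eq]

/-- Stretching the plane of the first two minima makes the last two minima equal. -/
theorem exists_stretch {u v w : Fin 3 → ℤ} (hD : intDet u v w ≠ 0)
    (hw : ∀ t, intDet u v t ≠ 0 → ‖latticeVector x y z w‖ ≤ ‖latticeVector x y z t‖)
    {s : ℝ} (hs : 1 ≤ s) :
    ∃ x' y' z' : Fin 4 → ℝ, (∀ i j k, minor i j k x' y' z' = s ^ 2 * minor i j k x y z) ∧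
      (∀ t, intDet u v t = 0 → latticeVector x' y' z' t = s • latticeVector x y z t) ∧
      ∀ t, intDet u v t ≠ 0 → ‖latticeVector x y z w‖ ≤ ‖latticeVector x' y' z' t‖ := by
  set L := latticeVector x y z with hL
  have hD' : (intDet u v w : ℝ) ≠ 0 := by exact_mod_cast hD
  have hs0 : 0 < s := one_pos.trans_le hs
  obtain ⟨α, β, hmin⟩ := exists_min_norm_add_smul (L u) (L v) (L w)
  set P : Fin 4 → ℝ := L w + α • L u + β • L v with hP
  set f : (Fin 3 → ℤ) → ℝ := fun t => intDet u v t / intDet u v w with hf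
  have hval : ∀ t, latticeVector (fun i => s * x i + (1 - s) * f ![1, 0, 0] * P i)
      (fun i => s * y i + (1 - s) * f ![0, 1, 0] * P i)
      (fun i => s * z i + (1 - s) * f ![0, 0, 1] * P i) t = s • L t + ((1 - s) * f t) • P := by
    intro t
    have : f t = t 0 * f ![1, 0, 0] + t 1 * f ![0, 1, 0] + t 2 * f ![0, 0, 1] := by
      simp only [hf]
      field_simp
      simp [intDet]
      ring
    funext i
    simp only [hL, latticeVector, Pi.add_apply, Pi.smul_apply, smul_eq_mul, this]
    ring
  refine ⟨fun i => s * x i + (1 - s) * f ![1, 0, 0] * P i,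
    fun i => s * y i + (1 - s) * f ![0, 1, 0] * P i,
    fun i => s * z i + (1 - s) * f ![0, 0, 1] * P i, fun i j k => ?_, fun t ht => ?_, fun t ht => ?_⟩
  · rw [minor_rank_one x y z P s (1 - s) _ _ _ (w 0 + α * u 0 + β * v 0) (w 1 + α * u 1 + β * v 1)
      (w 2 + α * u 2 + β * v 2) (fun i => by simp [hP, hL, latticeVector]; ring)]
    have : f ![1, 0, 0] * (w 0 + α * u 0 + β * v 0) + f ![0, 1, 0] * (w 1 + α * u 1 + β * v 1) +
        f ![0, 0, 1] * (w 2 + α * u 2 + β * v 2) = 1 := by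
      simp only [hf]
      field_simp
      simp [intDet]
      ring
    rw [this]
    ring
  · rw [hval]
    simp [hf, ht]
  · rw [hval]
    have hft : f t ≠ 0 := div_ne_zero (by exact_mod_cast ht) hD'
    have hLt : L t = (intDet t v w / intDet u v w : ℝ) • L u +
        (intDet u t w / intDet u v w : ℝ) • L v + f t • L w := by
      funext i
      have := smul_latticeVector_eq (x := x) (y := y) (z := z) u v w t i
      simp only [hf, hL, Pi.add_apply, Pi.smul_apply, smul_eq_mul]
      field_simp
      linarith
    set γ : ℝ := intDet t v w / intDet u v w
    set δ : ℝ := intDet u t w / intDet u v w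
    set V : Fin 4 → ℝ := s • L t + ((1 - s) * f t) • P with hV
    have h₁ : |f t| * ‖P‖ ≤ ‖V‖ := by
      have hVP : V = f t • (L w + (α + s * (γ - f t * α) / f t) • L u +
          (β + s * (δ - f t * β) / f t) • L v) := by
        funext i
        simp only [hV, hLt, hP, Pi.add_apply, Pi.smul_apply, smul_eq_mul]
        field_simp
        ring
      rw [hVP, norm_smul, Real.norm_eq_abs]
      exact mul_le_mul_of_nonneg_left (hmin _ _) (abs_nonneg _)
    have h₂ : s * ‖L t‖ ≤ ‖V‖ + (s - 1) * (|f t| * ‖P‖) := by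
      have e : s • L t = V + ((s - 1) * f t) • P := by
        rw [hV]
        module
      have := norm_add_le V (((s - 1) * f t) • P)
      rw [← e, norm_smul, norm_smul, Real.norm_eq_abs, Real.norm_eq_abs, abs_mul, abs_of_pos hs0,
        abs_of_nonneg (by linarith : 0 ≤ s - 1)] at this
      linarith
    have h₃ := mul_le_mul_of_nonneg_left h₁ (by linarith : 0 ≤ s - 1)
    refine (hw t ht).trans (le_of_mul_le_mul_left ?_ hs0)
    linarith

/-- The product of the successive minima of a lattice of rank three in `ℝ⁴`. -/
theorem exists_norm_mul_norm_mul_norm_le (h : minor p q r x y z ≠ 0) {M : ℝ}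
    (hM : ∀ i j k, |minor i j k x y z| ≤ M) :
    ∃ u v w : Fin 3 → ℤ, intDet u v w ≠ 0 ∧
      ‖latticeVector x y z u‖ * ‖latticeVector x y z v‖ * ‖latticeVector x y z w‖ ≤ 27 / 19 * M := by
  obtain ⟨u, v, w, hD, hu, hv, hw⟩ := exists_successive_minima h
  refine ⟨u, v, w, hD, ?_⟩
  by_contra! hlt
  set μ₁ := ‖latticeVector x y z u‖ with hμ₁
  set μ₂ := ‖latticeVector x y z v‖ with hμ₂
  set μ₃ := ‖latticeVector x y z w‖ with hμ₃
  have hu0 : u ≠ 0 := by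
    rintro rfl
    simp [intDet] at hD
  have hv0 : v ≠ 0 := by
    rintro rfl
    simp [intDet] at hD
  have h1 : 0 < μ₁ := norm_latticeVector_pos h hu0
  have h12 : μ₁ ≤ μ₂ := hu v hv0
  have h23 : μ₂ ≤ μ₃ := hv w v (by rwa [intDet_comm, neg_ne_zero])
  have h2 : 0 < μ₂ := h1.trans_le h12
  have h3 : 0 < μ₃ := h2.trans_le h23
  have hs : 1 ≤ μ₃ / μ₂ := (one_le_div h2).2 h23
  obtain ⟨x', y', z', hmin, hin, hout⟩ := exists_stretch hD hw hs
  set s := μ₃ / μ₂ with hsd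
  have hs0 : 0 < s := one_pos.trans_le hs
  have attained : ∀ f : Fin 4 → ℝ, ∃ i, |f i| = ‖f‖ := by
    intro f
    obtain ⟨i, hi⟩ := Finite.exists_max fun i => |f i|
    exact ⟨i, (norm_le_pi_norm f i).antisymm ((pi_norm_le_iff_of_nonneg (abs_nonneg _)).2 hi)⟩
  obtain ⟨c, hc⟩ := attained (latticeVector x y z u)
  rw [← hμ₁] at hc
  set e : Fin 4 → ℝ := fun i => if i = c then (s * μ₁)⁻¹ else μ₃⁻¹ with he
  have hec : e c = (s * μ₁)⁻¹ := if_pos rfl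
  have heo : ∀ i, i ≠ c → e i = μ₃⁻¹ := fun i hi => if_neg hi
  have hsμ : s * μ₂ = μ₃ := div_mul_cancel₀ _ h2.ne'
  have he3 : ∀ i, μ₃⁻¹ ≤ e i := by
    intro i
    by_cases hi : i = c
    · rw [hi, hec]
      exact inv_anti₀ (mul_pos hs0 h1) (hsμ ▸ mul_le_mul_of_nonneg_left h12 hs0.le)
    · rw [heo i hi]
  have he0 : ∀ i, 0 < e i := fun i => (inv_pos.2 h3).trans_le (he3 i)
  have hmul : ∀ i j k, minor i j k (fun i => e i * x' i) (fun i => e i * y' i)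
      (fun i => e i * z' i) = e i * e j * e k * s ^ 2 * minor i j k x y z := by
    intro i j k
    rw [mul_assoc, ← hmin]
    simp only [minor]
    ring
  have hbad : IsBad (fun i => e i * x' i) (fun i => e i * y' i) (fun i => e i * z' i) := by
    constructor
    · intro a b d habd
      obtain ⟨t, rfl, rfl, rfl⟩ : ∃ t : Fin 3 → ℤ, t 0 = a ∧ t 1 = b ∧ t 2 = d :=
        ⟨![a, b, d], rfl, rfl, rfl⟩
      have ht0 : t ≠ 0 := by
        rintro rfl
        simp at habd
      have hval : ∀ i, t 0 * (e i * x' i) + t 1 * (e i * y' i) + t 2 * (e i * z' i) =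
          e i * latticeVector x' y' z' t i := by
        intro i
        simp only [latticeVector]
        ring
      simp only [hval, abs_mul, abs_of_pos (he0 _)]
      have large : μ₃ ≤ ‖latticeVector x' y' z' t‖ →
          ∃ i, 1 ≤ e i * |latticeVector x' y' z' t i| := by
        intro hle
        obtain ⟨i, hi⟩ := attained (latticeVector x' y' z' t)
        refine ⟨i, ?_⟩
        rw [hi, ← inv_mul_cancel₀ h3.ne']
        exact mul_le_mul (he3 i) hle h3.le (he0 i).le
      by_cases ht : intDet u v t = 0
      · rw [hin t ht] at large ⊢
        by_cases ht' : ∀ t', intDet u t t' = 0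
        · obtain ⟨m, hm⟩ := Function.ne_iff.1 hu0
          have hm0 : 0 < |(u m : ℝ)| := abs_pos.2 (by exact_mod_cast hm)
          have hpar : ∀ i, |(u m : ℝ)| * |latticeVector x y z t i| =
              |(t m : ℝ)| * |latticeVector x y z u i| := by
            intro i
            rw [← abs_mul, ← abs_mul, ← latticeVector_smul, ← latticeVector_smul,
              smul_eq_smul_of_intDet_eq_zero ht']
          obtain ⟨j, hj⟩ := attained (latticeVector x y z t)
          have hut : |(u m : ℝ)| * μ₁ ≤ |(t m : ℝ)| * μ₁ := by
            have k₁ := mul_le_mul_of_nonneg_left (hu t ht0) hm0.le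
            have k₂ := mul_le_mul_of_nonneg_left (norm_le_pi_norm (latticeVector x y z u) j)
              (abs_nonneg (t m : ℝ))
            rw [Real.norm_eq_abs, ← hpar, hj] at k₂
            exact k₁.trans k₂
          refine ⟨c, ?_⟩
          rw [← hc, ← hpar, hc] at hut
          have := le_of_mul_le_mul_left hut hm0
          rw [Pi.smul_apply, smul_eq_mul, abs_mul, abs_of_pos hs0, hec, ← div_eq_inv_mul,
            one_le_div (mul_pos hs0 h1)]
          exact mul_le_mul_of_nonneg_left this hs0.le
        · obtain ⟨t', ht'⟩ := not_forall.1 ht'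
          refine large ?_
          rw [norm_smul, Real.norm_eq_abs, abs_of_pos hs0, ← hsμ]
          exact mul_le_mul_of_nonneg_left (hv t t' ht') hs0.le
      · exact large (hout t ht)
    · have hle : ∀ i j k, i ≠ j → i ≠ k → j ≠ k → e i * e j * e k * s ^ 2 ≤ (μ₁ * μ₂ * μ₃)⁻¹ := by
        have hcol : (s * μ₁)⁻¹ * μ₃⁻¹ * μ₃⁻¹ * s ^ 2 = (μ₁ * μ₂ * μ₃)⁻¹ := by
          rw [hsd]
          field_simp
        have hother : μ₃⁻¹ * μ₃⁻¹ * μ₃⁻¹ * s ^ 2 ≤ (μ₁ * μ₂ * μ₃)⁻¹ := by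
          rw [← hcol]
          have := he3 c
          rw [hec] at this
          gcongr
        intro i j k hij hik hjk
        by_cases hi : i = c
        · subst hi
          rw [hec, heo j hij.symm, heo k hik.symm, hcol]
        · by_cases hj : j = c
          · subst hj
            rw [hec, heo i hij, heo k hjk.symm, mul_comm μ₃⁻¹, hcol]
          · by_cases hk : k = c
            · subst hk
              rw [hec, heo i hik, heo j hjk, mul_comm _ (s * μ₁)⁻¹, ← mul_assoc, hcol]
            · rw [heo i hi, heo j hj, heo k hk]
              exact hother
      intro i j k
      rw [hmul]
      by_cases hd : i ≠ j ∧ i ≠ k ∧ j ≠ k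
      · have hpos : 0 < e i * e j * e k * s ^ 2 :=
          mul_pos (mul_pos (mul_pos (he0 i) (he0 j)) (he0 k)) (pow_pos hs0 2)
        rw [abs_mul, abs_of_pos hpos]
        have hprod : 0 < μ₁ * μ₂ * μ₃ := mul_pos (mul_pos h1 h2) h3
        refine (mul_le_mul (hle i j k hd.1 hd.2.1 hd.2.2) (hM i j k) (abs_nonneg _)
          (inv_pos.2 hprod).le).trans_lt ?_
        rw [← div_eq_inv_mul, div_lt_iff₀ hprod]
        linarith
      · have h0 : minor i j k x y z = 0 := by
          by_cases hij : i = j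
          · subst hij
            simp only [minor]
            ring
          · by_cases hik : i = k
            · subst hik
              simp only [minor]
              ring
            · have hjk : j = k := by
                by_contra hjk
                exact hd ⟨hij, hik, hjk⟩
              subst hjk
              simp only [minor]
              ring
        rw [h0]
        norm_num
  have := hbad.minor_eq_zero p q r
  rw [hmul] at this
  exact mul_ne_zero (mul_pos (mul_pos (mul_pos (he0 p) (he0 q)) (he0 r)) (pow_pos hs0 2)).ne' h this

end

/-- The orthogonal complement of an integer vector has a basis whose minors are bounded by the
entries of the vector. -/
theorem exists_orthogonal_basis (a : Fin 4 → ℤ) (ha : a ≠ 0) :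
    ∃ x y z : Fin 4 → ℤ, ∑ i, a i * x i = 0 ∧ ∑ i, a i * y i = 0 ∧ ∑ i, a i * z i = 0 ∧
      (∀ i j k, ∃ l, |minor i j k (fun i => (x i : ℝ)) (fun i => (y i : ℝ)) fun i => (z i : ℝ)| ≤
        |(a l : ℝ)|) ∧
      ∃ i j k, minor i j k (fun i => (x i : ℝ)) (fun i => (y i : ℝ)) (fun i => (z i : ℝ)) ≠ 0 := by
  have bezout : ∀ m n : ℤ, ∃ g m' n' u v : ℤ, m = g * m' ∧ n = g * n' ∧ u * m' + v * n' = 1 := by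
    intro m n
    by_cases h : Int.gcd m n = 0
    · obtain ⟨rfl, rfl⟩ := Int.gcd_eq_zero_iff.1 h
      exact ⟨0, 1, 0, 1, 0, by simp⟩
    · obtain ⟨m', hm⟩ := Int.gcd_dvd_left m n
      obtain ⟨n', hn⟩ := Int.gcd_dvd_right m n
      refine ⟨Int.gcd m n, m', n', Int.gcdA m n, Int.gcdB m n, hm, hn, ?_⟩
      have hg : (Int.gcd m n : ℤ) ≠ 0 := by exact_mod_cast h
      apply mul_left_cancel₀ hg
      have := Int.gcd_eq_gcd_ab m n
      linear_combination (-1 : ℤ) * this - Int.gcdA m n * hm - Int.gcdB m n * hn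
  obtain ⟨g, p, q, u, v, hp, hq, huv⟩ := bezout (a 0) (a 1)
  obtain ⟨h, g', r, u', v', hg, hr, huv'⟩ := bezout g (a 2)
  have hp' : (a 0 : ℝ) = h * g' * p := by exact_mod_cast hg ▸ hp
  have hq' : (a 1 : ℝ) = h * g' * q := by exact_mod_cast hg ▸ hq
  have hr' : (a 2 : ℝ) = h * r := by exact_mod_cast hr
  have e : (u * p + v * q : ℝ) = 1 := by exact_mod_cast huv
  have e' : (u' * g' + v' * r : ℝ) = 1 := by exact_mod_cast huv'
  set x : Fin 4 → ℤ := ![q, -p, 0, 0] with hx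
  set y : Fin 4 → ℤ := ![u * r, v * r, -g', 0] with hy
  set z : Fin 4 → ℤ := ![u * u' * a 3, v * u' * a 3, v' * a 3, -h] with hz
  set m := fun i j k => minor i j k (fun i => (x i : ℝ)) (fun i => (y i : ℝ)) fun i => (z i : ℝ)
    with hm
  have swap_left : ∀ i j k, |m j i k| = |m i j k| := by
    intro i j k
    rw [← abs_neg]
    congr 1
    simp only [hm, minor]
    ring
  have swap_right : ∀ i j k, |m i k j| = |m i j k| := by
    intro i j k
    rw [← abs_neg]
    congr 1
    simp only [hm, minor]
    ring
  have eq_zero : ∀ i j, |m i i j| = 0 := by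
    intro i j
    rw [abs_eq_zero]
    simp only [hm, minor]
    ring
  have m₀ : |m 1 2 3| = |(a 0 : ℝ)| := by
    rw [← abs_neg]
    congr 1
    simp [hm, hx, hy, hz, minor]
    linear_combination -hp'
  have m₁ : |m 0 2 3| = |(a 1 : ℝ)| := by
    congr 1
    simp [hm, hx, hy, hz, minor]
    linear_combination -hq'
  have m₂ : |m 0 1 3| = |(a 2 : ℝ)| := by
    rw [← abs_neg]
    congr 1
    simp [hm, hx, hy, hz, minor]
    linear_combination h * r * e - hr'
  have m₃ : |m 0 1 2| = |(a 3 : ℝ)| := by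
    congr 1
    simp [hm, hx, hy, hz, minor]
    linear_combination a 3 * (u' * g' + v' * r) * e + a 3 * e'
  refine ⟨x, y, z, ?_, ?_, ?_, fun i j k => ?_, ?_⟩
  · simp [Fin.sum_univ_four, hx, hp, hq]
    ring
  · simp [Fin.sum_univ_four, hy, hp, hq, hg, hr]
    linear_combination h * g' * r * huv
  · simp [Fin.sum_univ_four, hz, hp, hq, hg, hr]
    linear_combination h * g' * u' * a 3 * huv + h * a 3 * huv'
  · change ∃ l, |m i j k| ≤ |(a l : ℝ)|
    have sorted : ∀ i j k, i < j → j < k → ∃ l, |m i j k| = |(a l : ℝ)| := by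
      intro i j k hij hjk
      have : i = 1 ∧ j = 2 ∧ k = 3 ∨ i = 0 ∧ j = 2 ∧ k = 3 ∨ i = 0 ∧ j = 1 ∧ k = 3 ∨
          i = 0 ∧ j = 1 ∧ k = 2 := by
        omega
      obtain ⟨rfl, rfl, rfl⟩ | ⟨rfl, rfl, rfl⟩ | ⟨rfl, rfl, rfl⟩ | ⟨rfl, rfl, rfl⟩ := this
      exacts [⟨0, m₀⟩, ⟨1, m₁⟩, ⟨2, m₂⟩, ⟨3, m₃⟩]
    have le : ∀ i j k, i ≤ j → j ≤ k → ∃ l, |m i j k| ≤ |(a l : ℝ)| := by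
      intro i j k hij hjk
      obtain rfl | hij := hij.eq_or_lt
      · exact ⟨0, by rw [eq_zero]; positivity⟩
      obtain rfl | hjk := hjk.eq_or_lt
      · exact ⟨0, by rw [← swap_left, ← swap_right, eq_zero]; positivity⟩
      · exact (sorted i j k hij hjk).imp fun _ => le_of_eq
    obtain hij | hij := le_total i j
    · obtain hjk | hjk := le_total j k
      · exact le i j k hij hjk
      · rw [← swap_right]
        obtain hik | hik := le_total i k
        · exact le i k j hik hjk
        · rw [← swap_left]
          exact le k i j hik hij
    · rw [← swap_left]
      obtain hik | hik := le_total i k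
      · exact le j i k hij hik
      · rw [← swap_right]
        obtain hjk | hjk := le_total j k
        · exact le j k i hjk hik
        · rw [← swap_left]
          exact le k j i hjk hij
  · change ∃ i j k, m i j k ≠ 0
    by_contra! h0
    apply ha
    have : ∀ l, |(a l : ℝ)| = 0 → a l = 0 := by simp
    funext l
    apply this
    fin_cases l
    exacts [m₀ ▸ by simp [h0], m₁ ▸ by simp [h0], m₂ ▸ by simp [h0], m₃ ▸ by simp [h0]]

/-- For every nonzero `a ∈ ℤ⁴` there exist linearly independent
`x₁, x₂, x₃ ∈ ℤ⁴` orthogonal to `a` with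
`‖x₁‖_∞ · ‖x₂‖_∞ · ‖x₃‖_∞ ≤ (27/19) · ‖a‖_∞`. -/
theorem stmt_1 (a : Fin 4 → ℤ) (ha : a ≠ 0) :
    ∃ x₁ x₂ x₃ : Fin 4 → ℤ, LinearIndependent ℤ ![x₁, x₂, x₃] ∧
      (∑ i, a i * x₁ i) = 0 ∧ (∑ i, a i * x₂ i) = 0 ∧ (∑ i, a i * x₃ i) = 0 ∧
      ‖(fun i => (x₁ i : ℝ) : Fin 4 → ℝ)‖ * ‖(fun i => (x₂ i : ℝ) : Fin 4 → ℝ)‖ *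
          ‖(fun i => (x₃ i : ℝ) : Fin 4 → ℝ)‖ ≤
        (27 / 19) * ‖(fun i => (a i : ℝ) : Fin 4 → ℝ)‖ := by
  obtain ⟨x, y, z, hx, hy, hz, hle, i, j, k, hne⟩ := exists_orthogonal_basis a ha
  set M := ‖(fun i => (a i : ℝ) : Fin 4 → ℝ)‖
  obtain ⟨u, v, w, hD, hprod⟩ := exists_norm_mul_norm_mul_norm_le (M := M) hne fun i j k =>
    let ⟨l, hl⟩ := hle i j k
    hl.trans (norm_le_pi_norm (fun i => (a i : ℝ)) l)
  set X : (Fin 3 → ℤ) → Fin 4 → ℤ := fun t i => t 0 * x i + t 1 * y i + t 2 * z i with hX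
  have cast : ∀ t, (fun i => (X t i : ℝ)) =
      latticeVector (fun i => (x i : ℝ)) (fun i => (y i : ℝ)) (fun i => (z i : ℝ)) t := by
    intro t
    funext i
    simp [hX, latticeVector]
  have orth : ∀ t, ∑ i, a i * X t i = 0 := by
    intro t
    rw [Fin.sum_univ_four] at hx hy hz ⊢
    simp only [hX]
    linear_combination t 0 * hx + t 1 * hy + t 2 * hz
  refine ⟨X u, X v, X w, ?_, orth u, orth v, orth w, ?_⟩
  · rw [Fintype.linearIndependent_iff]
    intro c hc
    have key : X (c 0 • u + c 1 • v + c 2 • w) = 0 := by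
      rw [← hc]
      funext i
      simp [Fin.sum_univ_three, hX]
      ring
    have h0 : c 0 • u + c 1 • v + c 2 • w = 0 := by
      by_contra h0
      have := norm_latticeVector_pos hne h0
      rw [← cast, key] at this
      simp at this
    obtain ⟨h₀, h₁, h₂⟩ := eq_zero_of_intDet_ne_zero hD h0
    intro m
    fin_cases m
    exacts [h₀, h₁, h₂]
  · rwa [cast, cast, cast]
end

section
/- Let n > 3 and let 0 < α₁ ≤ ⋯ ≤ α_{n-1} ≤ 1 be real numbers. Set β_i = α_i/α_{n-2} for i = 1,…,n-3. Then the set K_{β₁,…,β_{n-3},1,1} is contained in K_{α₁,…,α_{n-1}}. -/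
/-- For `n > 3` and `0 < α₁ ≤ ⋯ ≤ α_{n-1} ≤ 1`, setting
`β_i = α_i / α_{n-2}` for `i = 1, …, n-3` (and `β_{n-2} = β_{n-1} = 1`), the
generalized hexagon `K_{β₁,…,β_{n-3},1,1}` is contained in `K_{α₁,…,α_{n-1}}`,
where `K_α = {x ∈ ℝ^{n-1} : ‖x‖_∞ ≤ 1, |∑ α_i x_i| ≤ 1}`.
(Vectors are indexed by `Fin (n-1)`, with the 1-based index `j` of the paper
corresponding to the 0-based index `j - 1`; thus `α_{n-2}` is `α ⟨n-3, _⟩`.) -/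
theorem stmt_3 (n : ℕ) (hn : 3 < n) (α : Fin (n - 1) → ℝ)
    (hpos : ∀ i, 0 < α i) (hmono : Monotone α) (hle : ∀ i, α i ≤ 1)
    (β : Fin (n - 1) → ℝ)
    (hβ : ∀ i : Fin (n - 1),
      β i = if (i : ℕ) < n - 3 then α i / α ⟨n - 3, by omega⟩ else 1) :
    {x : Fin (n - 1) → ℝ | ‖x‖ ≤ 1 ∧ |∑ i, β i * x i| ≤ 1} ⊆
      {x : Fin (n - 1) → ℝ | ‖x‖ ≤ 1 ∧ |∑ i, α i * x i| ≤ 1} := by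
  rintro x ⟨hx, hs⟩
  refine ⟨hx, ?_⟩
  set a := α ⟨n - 3, by omega⟩ with ha
  set l : Fin (n - 1) := ⟨n - 2, by omega⟩ with hl
  have ha0 : 0 < a := hpos _
  have hal : a ≤ α l := hmono (Fin.mk_le_mk.mpr (by omega))
  have hα : ∀ i, α i = a * β i + if i = l then α l - a else 0 := by
    intro i
    rw [hβ i]
    by_cases h : (i : ℕ) < n - 3
    · have hil : i ≠ l := by
        rintro rfl
        simp only [hl] at h
        omega
      rw [if_pos h, if_neg hil]
      field_simp
      ring
    · rw [if_neg h]
      by_cases hil : i = l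
      · rw [if_pos hil, hil]
        ring
      · have hi : i = ⟨n - 3, by omega⟩ := by
          have hne : (i : ℕ) ≠ n - 2 := fun h' => hil (Fin.ext h')
          have := i.isLt
          exact Fin.ext (by simp only; omega)
        rw [if_neg hil, hi, ← ha]
        ring
  have hsum : ∑ i, α i * x i = a * ∑ i, β i * x i + (α l - a) * x l := by
    calc ∑ i, α i * x i
        = ∑ i, (a * (β i * x i) + if i = l then (α l - a) * x i else 0) := by
          refine Finset.sum_congr rfl fun i _ => ?_
          rw [hα i]
          split_ifs <;> ring
      _ = a * ∑ i, β i * x i + (α l - a) * x l := by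
          simp [Finset.sum_add_distrib, Finset.mul_sum]
  have hxl : |x l| ≤ 1 := (norm_le_pi_norm x l).trans hx
  have hl1 := hle l
  rw [hsum]
  rw [abs_le] at hs hxl ⊢
  constructor <;> nlinarith
end
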